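/- The set D_{{1,2,3,4,5}} has natural density one: lim_{N→∞} #{d ∈ D_{{1,2,3,4,5}} : d ≤ N} / N = 1. In other words, almost every positive integer is the denominator of a reduced fraction whose continued fraction expansion has all partial quotients bounded by 5. -/

import Mathlib

/-- The generator matrix `[[0,1],[1,a]]`. -/
def cfGen (a : ℕ) : Matrix (Fin 2) (Fin 2) ℤ := !![0, 1; 1, (a : ℤ)]

/-- The semigroup `G_A`: all nonempty finite products of the generators
`[[0,1],[1,a]]` with `a ∈ A`. -/
def GSemigroup (A : Set ℕ) : Set (Matrix (Fin 2) (Fin 2) ℤ) :=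
  { M | ∃ l : List ℕ, l ≠ [] ∧ (∀ a ∈ l, a ∈ A) ∧ M = (l.map cfGen).prod }

/-- The set `D_A` of bottom-right entries of matrices in `G_A`. -/
def Denoms (A : Set ℕ) : Set ℕ :=
  { d | ∃ M ∈ GSemigroup A, M 1 1 = (d : ℤ) }

open scoped Pointwise

/-- Integer matrices of size two. -/
abbrev Mat := Matrix (Fin 2) (Fin 2) ℤ

/-- The generators with partial quotient at most five. -/
def gens : Finset Mat := (Finset.Icc 1 5).image cfGen

/-- The identity, or a matrix with the entry inequalities of a nonempty word. -/
structure Adm (γ : Mat) : Prop where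
  det : γ.det = 1 ∨ γ.det = -1
  red : γ = 1 ∨ (0 ≤ γ 0 0 ∧ γ 0 0 ≤ γ 0 1 ∧ γ 0 0 ≤ γ 1 0 ∧ γ 0 1 ≤ γ 1 1 ∧
    γ 1 0 ≤ γ 1 1 ∧ 1 ≤ γ 1 1)

namespace Adm

lemma one : Adm 1 := ⟨by simp, Or.inl rfl⟩

lemma bounds {γ : Mat} (h : Adm γ) : 0 ≤ γ 0 0 ∧ 0 ≤ γ 0 1 ∧ 0 ≤ γ 1 0 ∧
    γ 0 1 ≤ γ 1 1 ∧ γ 1 0 ≤ γ 1 1 ∧ 1 ≤ γ 1 1 ∧ γ 0 0 ≤ γ 1 1 := by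
  rcases h.red with rfl | h
  · simp
  · omega

lemma d_pos {γ : Mat} (h : Adm γ) : 0 < γ 1 1 := by have := h.bounds; omega

lemma transpose {γ : Mat} (h : Adm γ) : Adm γ.transpose := by
  refine ⟨by simpa using h.det, ?_⟩
  rcases h.red with rfl | h
  · left; simp
  · right; simp only [Matrix.transpose_apply]; omega

lemma mul {γ δ : Mat} (h : Adm γ) (h' : Adm δ) : Adm (γ * δ) := by
  refine ⟨?_, ?_⟩
  · rw [Matrix.det_mul]
    rcases h.det with h1 | h1 <;> rcases h'.det with h2 | h2 <;> simp [h1, h2]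
  rcases h.red with rfl | ⟨h1, h2, h3, h4, h5, h6⟩
  · simpa using h'.red
  rcases h'.red with rfl | ⟨k1, k2, k3, k4, k5, k6⟩
  · right; simp; omega
  right
  simp only [Matrix.mul_apply, Fin.sum_univ_two]
  refine ⟨?_, ?_, ?_, ?_, ?_, ?_⟩ <;> nlinarith [mul_nonneg h1 k1]

lemma mul_d {γ δ : Mat} : (γ * δ) 1 1 = γ 1 0 * δ 0 1 + γ 1 1 * δ 1 1 := by
  simp [Matrix.mul_apply, Fin.sum_univ_two]

lemma d_mul_le {γ δ : Mat} (h : Adm γ) (h' : Adm δ) :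
    (γ * δ) 1 1 ≤ 2 * (γ 1 1 * δ 1 1) := by
  have h1 := h.bounds
  have h2 := h'.bounds
  rw [mul_d]
  nlinarith [mul_le_mul h1.2.2.2.2.1 h2.2.2.2.1 h2.2.1 (by omega)]

lemma le_d_mul {γ δ : Mat} (h : Adm γ) (h' : Adm δ) :
    γ 1 1 * δ 1 1 ≤ (γ * δ) 1 1 := by
  have h1 := h.bounds
  have h2 := h'.bounds
  rw [mul_d]
  nlinarith [mul_nonneg h1.2.2.1 h2.2.1]

lemma coprime_col {γ : Mat} (h : Adm γ) : IsCoprime (γ 0 1) (γ 1 1) := by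
  have hd := h.det
  rw [Matrix.det_fin_two] at hd
  rcases hd with hd | hd
  · exact ⟨-γ 1 0, γ 0 0, by linarith⟩
  · exact ⟨γ 1 0, -γ 0 0, by linarith⟩

end Adm

lemma adm_cfGen {a : ℕ} (ha : 1 ≤ a) : Adm (cfGen a) := by
  refine ⟨by simp [cfGen, Matrix.det_fin_two], Or.inr ?_⟩
  simp [cfGen]; omega

lemma mem_gens {γ : Mat} : γ ∈ gens ↔ ∃ a : ℕ, 1 ≤ a ∧ a ≤ 5 ∧ cfGen a = γ := by
  simp [gens, and_assoc]

lemma adm_of_mem_pow {n : ℕ} : ∀ {γ : Mat}, γ ∈ gens ^ n → Adm γ := by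
  induction n with
  | zero => intro γ h; rw [pow_zero, Finset.mem_one] at h; subst h; exact Adm.one
  | succ n ih =>
    intro γ h
    rw [pow_succ, Finset.mem_mul] at h
    obtain ⟨x, hx, y, hy, rfl⟩ := h
    obtain ⟨a, ha, -, rfl⟩ := mem_gens.1 hy
    exact (ih hx).mul (adm_cfGen ha)

lemma det_of_mem_pow {n : ℕ} : ∀ {γ : Mat}, γ ∈ gens ^ n → γ.det = (-1) ^ n := by
  induction n with
  | zero => intro γ h; rw [pow_zero, Finset.mem_one] at h; subst h; simp
  | succ n ih =>
    intro γ h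
    rw [pow_succ, Finset.mem_mul] at h
    obtain ⟨x, hx, y, hy, rfl⟩ := h
    obtain ⟨a, ha, -, rfl⟩ := mem_gens.1 hy
    rw [Matrix.det_mul, ih hx, pow_succ]
    simp [cfGen, Matrix.det_fin_two]

lemma transpose_mem_pow {n : ℕ} : ∀ {γ : Mat}, γ ∈ gens ^ n → γ.transpose ∈ gens ^ n := by
  induction n with
  | zero => intro γ h; rw [pow_zero, Finset.mem_one] at h; subst h; simp
  | succ n ih =>
    intro γ h
    rw [pow_succ, Finset.mem_mul] at h
    obtain ⟨x, hx, y, hy, rfl⟩ := h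
    obtain ⟨a, h1, h5, rfl⟩ := mem_gens.1 hy
    rw [Matrix.transpose_mul, pow_succ']
    refine Finset.mul_mem_mul (mem_gens.2 ⟨a, h1, h5, ?_⟩) (ih hx)
    ext i j; fin_cases i <;> fin_cases j <;> simp [cfGen]

lemma exists_list_of_mem_pow {n : ℕ} : ∀ {γ : Mat}, γ ∈ gens ^ n →
    ∃ l : List ℕ, l.length = n ∧ (∀ a ∈ l, a ∈ ({1, 2, 3, 4, 5} : Set ℕ)) ∧
      γ = (l.map cfGen).prod := by
  induction n with
  | zero =>
    intro γ h; rw [pow_zero, Finset.mem_one] at h; subst h; exact ⟨[], by simp⟩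
  | succ n ih =>
    intro γ h
    rw [pow_succ', Finset.mem_mul] at h
    obtain ⟨x, hx, y, hy, rfl⟩ := h
    obtain ⟨a, h1, h5, rfl⟩ := mem_gens.1 hx
    obtain ⟨l, hl, hA, rfl⟩ := ih hy
    refine ⟨a :: l, by simp [hl], ?_, by simp⟩
    intro b hb
    rcases List.mem_cons.1 hb with rfl | hb
    · simp; omega
    · exact hA b hb

lemma denoms_of_mem_pow {n : ℕ} (hn : n ≠ 0) {γ : Mat} (h : γ ∈ gens ^ n) {d : ℕ}
    (hd : γ 1 1 = d) : d ∈ Denoms {1, 2, 3, 4, 5} := by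
  obtain ⟨l, hl, hA, rfl⟩ := exists_list_of_mem_pow h
  refine ⟨_, ⟨l, ?_, hA, rfl⟩, hd⟩
  rintro rfl
  exact hn hl.symm

lemma one_le_of_mem_pow_succ {n : ℕ} {γ : Mat} (h : γ ∈ gens ^ (n + 1)) : 1 ≤ γ 0 1 := by
  rw [pow_succ', Finset.mem_mul] at h
  obtain ⟨x, hx, y, hy, rfl⟩ := h
  obtain ⟨a, h1, h5, rfl⟩ := mem_gens.1 hx
  have := (adm_of_mem_pow hy).d_pos
  simp [cfGen, Matrix.mul_apply, Fin.sum_univ_two]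
  omega

lemma cfGen_mul_col {n : ℕ} {a a' : ℕ} {M M' : Mat} (hM : M ∈ gens ^ n) (hM' : M' ∈ gens ^ n)
    (h0 : (cfGen a * M) 0 1 = (cfGen a' * M') 0 1) (h1 : (cfGen a * M) 1 1 = (cfGen a' * M') 1 1) :
    a = a' ∧ M 0 1 = M' 0 1 ∧ M 1 1 = M' 1 1 := by
  simp only [cfGen, Matrix.mul_apply, Fin.sum_univ_two] at h0 h1
  simp at h0 h1
  suffices h : (a : ℤ) = a' by
    refine ⟨by exact_mod_cast h, ?_, h0⟩
    rw [h, h0] at h1; omega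
  have hb : -M 1 1 < M 0 1 - M' 0 1 ∧ M 0 1 - M' 0 1 < M 1 1 := by
    cases n with
    | zero => rw [pow_zero, Finset.mem_one] at hM hM'; subst hM hM'; simp
    | succ n =>
      have := one_le_of_mem_pow_succ hM
      have := one_le_of_mem_pow_succ hM'
      have := (adm_of_mem_pow hM).bounds
      have := (adm_of_mem_pow hM').bounds
      omega
  rw [← h0] at h1
  have hd := (adm_of_mem_pow hM).d_pos
  by_contra hne
  rcases lt_or_gt_of_ne hne with hlt | hlt
  · nlinarith
  · nlinarith

lemma col_inj {n : ℕ} : ∀ {γ δ : Mat}, γ ∈ gens ^ n → δ ∈ gens ^ n → γ 0 1 = δ 0 1 →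
    γ 1 1 = δ 1 1 → γ = δ := by
  induction n with
  | zero =>
    intro γ δ h h' _ _
    rw [pow_zero, Finset.mem_one] at h h'; rw [h, h']
  | succ n ih =>
    intro γ δ h h' h0 h1
    rw [pow_succ', Finset.mem_mul] at h h'
    obtain ⟨x, hx, y, hy, rfl⟩ := h
    obtain ⟨x', hx', y', hy', rfl⟩ := h'
    obtain ⟨a, -, -, rfl⟩ := mem_gens.1 hx
    obtain ⟨a', -, -, rfl⟩ := mem_gens.1 hx'
    obtain ⟨rfl, h2, h3⟩ := cfGen_mul_col hy hy' h0 h1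
    rw [ih hy hy' h2 h3]

lemma row_inj {n : ℕ} {γ δ : Mat} (h : γ ∈ gens ^ n) (h' : δ ∈ gens ^ n)
    (h0 : γ 1 0 = δ 1 0) (h1 : γ 1 1 = δ 1 1) : γ = δ :=
  Matrix.transpose_injective (col_inj (transpose_mem_pow h) (transpose_mem_pow h') h0 h1)

lemma mul_inj_of_mem_pow {n k : ℕ} : ∀ {γ γ' δ δ' : Mat}, γ ∈ gens ^ n → γ' ∈ gens ^ n →
    δ ∈ gens ^ k → δ' ∈ gens ^ k → γ * δ = γ' * δ' → γ = γ' ∧ δ = δ' := by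
  induction n with
  | zero =>
    intro γ γ' δ δ' h h' _ _ he
    rw [pow_zero, Finset.mem_one] at h h'; subst h h'; simpa using he
  | succ n ih =>
    intro γ γ' δ δ' h h' hd hd' he
    rw [pow_succ', Finset.mem_mul] at h h'
    obtain ⟨x, hx, y, hy, rfl⟩ := h
    obtain ⟨x', hx', y', hy', rfl⟩ := h'
    obtain ⟨a, -, -, rfl⟩ := mem_gens.1 hx
    obtain ⟨a', -, -, rfl⟩ := mem_gens.1 hx'
    have m1 : y * δ ∈ gens ^ (n + k) := by rw [pow_add]; exact Finset.mul_mem_mul hy hd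
    have m2 : y' * δ' ∈ gens ^ (n + k) := by rw [pow_add]; exact Finset.mul_mem_mul hy' hd'
    rw [Matrix.mul_assoc, Matrix.mul_assoc] at he
    obtain ⟨rfl, h2, h3⟩ := cfGen_mul_col m1 m2 (by rw [he]) (by rw [he])
    obtain ⟨rfl, rfl⟩ := ih hy hy' hd hd' (col_inj m1 m2 h2 h3)
    exact ⟨rfl, rfl⟩

lemma d_le_of_mem_pow {n : ℕ} : ∀ {γ : Mat}, γ ∈ gens ^ n → γ 1 1 ≤ 10 ^ n := by
  induction n with
  | zero => intro γ h; rw [pow_zero, Finset.mem_one] at h; subst h; simp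
  | succ n ih =>
    intro γ h
    rw [pow_succ, Finset.mem_mul] at h
    obtain ⟨x, hx, y, hy, rfl⟩ := h
    obtain ⟨a, ha, h5, rfl⟩ := mem_gens.1 hy
    have h1 := (adm_of_mem_pow hx).d_mul_le (adm_cfGen ha)
    have h2 : cfGen a 1 1 = a := by simp [cfGen]
    have h3 := ih hx
    have h4 := (adm_of_mem_pow hx).d_pos
    rw [h2] at h1
    have h6 : (a : ℤ) ≤ 5 := by exact_mod_cast h5
    rw [pow_succ]
    nlinarith

lemma le_d_of_mem_pow {n : ℕ} : ∀ {γ : Mat}, γ ∈ gens ^ (2 * n) → 2 ^ n ≤ γ 1 1 := by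
  induction n with
  | zero => intro γ h; rw [mul_zero, pow_zero, Finset.mem_one] at h; subst h; simp
  | succ n ih =>
    intro γ h
    rw [mul_add, pow_add, Finset.mem_mul] at h
    obtain ⟨x, hx, y, hy, rfl⟩ := h
    have h1 := (adm_of_mem_pow hx).le_d_mul (adm_of_mem_pow hy)
    have h2 : 2 ≤ y 1 1 := by
      rw [mul_one, pow_two, Finset.mem_mul] at hy
      obtain ⟨u, hu, v, hv, rfl⟩ := hy
      obtain ⟨a, ha, -, rfl⟩ := mem_gens.1 hu
      obtain ⟨b, hb, -, rfl⟩ := mem_gens.1 hv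
      simp [cfGen, Matrix.mul_apply, Fin.sum_univ_two]
      have : (1:ℤ) ≤ a := by exact_mod_cast ha
      have : (1:ℤ) ≤ b := by exact_mod_cast hb
      nlinarith
    have h3 := ih hx
    rw [pow_succ]
    nlinarith [(adm_of_mem_pow hx).d_pos]

lemma rpow_tangent {c y z : ℝ} (hc : 0 ≤ c) (hz : 0 < z) (hcz : c ^ 20 ≤ z ^ 33) (hy : 0 ≤ y)
    (hpos : 0 ≤ 1 + (33 / 20) * (y / z - 1)) :
    c * (1 + (33 / 20) * (y / z - 1)) ≤ y ^ (33 / 20 : ℝ) := by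
  have h1 : 1 + (33 / 20) * (y / z - 1) ≤ (y / z) ^ (33 / 20 : ℝ) := by
    have := one_add_mul_self_le_rpow_one_add (s := y / z - 1) (p := 33 / 20)
      (by have : 0 ≤ y / z := by positivity
          linarith) (by norm_num)
    simpa using this
  have h2 : c ≤ z ^ (33 / 20 : ℝ) := by
    have h3 : z ^ (33 / 20 : ℝ) = (z ^ 33) ^ (1 / 20 : ℝ) := by
      rw [← Real.rpow_natCast, ← Real.rpow_mul hz.le]; norm_num
    have h4 : c = (c ^ 20) ^ (1 / 20 : ℝ) := by
      rw [← Real.rpow_natCast, ← Real.rpow_mul hc]; norm_num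
    rw [h3, h4]
    exact Real.rpow_le_rpow (by positivity) hcz (by norm_num)
  calc c * (1 + (33 / 20) * (y / z - 1)) ≤ z ^ (33 / 20 : ℝ) * (y / z) ^ (33 / 20 : ℝ) :=
        mul_le_mul h2 h1 hpos (by positivity)
    _ = y ^ (33 / 20 : ℝ) := by
        rw [← Real.mul_rpow hz.le (by positivity), mul_div_cancel₀ _ hz.ne']

lemma one_le_sum_rpow {x : ℝ} (h0 : 0 ≤ x) :
    1 ≤ ∑ a ∈ Finset.Icc (1 : ℕ) 5, ((2 + x) / (2 * a + 1 + 2 * x)) ^ (33 / 20 : ℝ) := by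
  have e1 : 1 + (33 / 20) * ((2 + x) / (2 * 1 + 1 + 2 * x) / (2 / 3) - 1)
      = 1 - 33 / 40 * (x / (3 + 2 * x)) := by field_simp; ring
  have e2 : 1 + (33 / 20) * ((2 + x) / (2 * 2 + 1 + 2 * x) / (2 / 5) - 1)
      = 1 + 33 / 40 * (x / (5 + 2 * x)) := by field_simp; ring
  have e3 : 1 + (33 / 20) * ((2 + x) / (2 * 3 + 1 + 2 * x) / (2 / 7) - 1)
      = 1 + 33 / 40 * 3 * (x / (7 + 2 * x)) := by field_simp; ring
  have e4 : 1 + (33 / 20) * ((2 + x) / (2 * 4 + 1 + 2 * x) / (2 / 9) - 1)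
      = 1 + 33 / 40 * 5 * (x / (9 + 2 * x)) := by field_simp; ring
  have e5 : 1 + (33 / 20) * ((2 + x) / (2 * 5 + 1 + 2 * x) / (2 / 11) - 1)
      = 1 + 33 / 40 * 7 * (x / (11 + 2 * x)) := by field_simp; ring
  have b1 : x / (3 + 2 * x) ≤ 1 := by rw [div_le_one (by positivity)]; linarith
  have t1 := rpow_tangent (c := 0.512) (z := 2 / 3) (y := (2 + x) / (2 * 1 + 1 + 2 * x))
    (by norm_num) (by norm_num) (by norm_num) (by positivity)
    (by rw [e1]; linarith)
  have t2 := rpow_tangent (c := 0.22) (z := 2 / 5) (y := (2 + x) / (2 * 2 + 1 + 2 * x))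
    (by norm_num) (by norm_num) (by norm_num) (by positivity) (by rw [e2]; positivity)
  have t3 := rpow_tangent (c := 0.126) (z := 2 / 7) (y := (2 + x) / (2 * 3 + 1 + 2 * x))
    (by norm_num) (by norm_num) (by norm_num) (by positivity) (by rw [e3]; positivity)
  have t4 := rpow_tangent (c := 0.083) (z := 2 / 9) (y := (2 + x) / (2 * 4 + 1 + 2 * x))
    (by norm_num) (by norm_num) (by norm_num) (by positivity) (by rw [e4]; positivity)
  have t5 := rpow_tangent (c := 0.06) (z := 2 / 11) (y := (2 + x) / (2 * 5 + 1 + 2 * x))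
    (by norm_num) (by norm_num) (by norm_num) (by positivity) (by rw [e5]; positivity)
  rw [e1] at t1; rw [e2] at t2; rw [e3] at t3; rw [e4] at t4; rw [e5] at t5
  have key : 0.512 * (x / (3 + 2 * x)) ≤ 0.22 * (x / (5 + 2 * x)) + 0.126 * 3 * (x / (7 + 2 * x))
      + 0.083 * 5 * (x / (9 + 2 * x)) + 0.06 * 7 * (x / (11 + 2 * x)) := by
    have f (k : ℝ) (hk : 3 ≤ k) : 3 / k * (x / (3 + 2 * x)) ≤ x / (k + 2 * x) := by
      rw [div_mul_div_comm, div_le_div_iff₀ (by positivity) (by positivity)]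
      nlinarith [mul_nonneg h0 (sub_nonneg.2 hk), mul_nonneg h0 h0,
        mul_nonneg (mul_nonneg h0 h0) (sub_nonneg.2 hk)]
    have f5 := f 5 (by norm_num)
    have f7 := f 7 (by norm_num)
    have f9 := f 9 (by norm_num)
    have f11 := f 11 (by norm_num)
    have hn : 0 ≤ x / (3 + 2 * x) := by positivity
    linarith
  have hs : Finset.Icc (1 : ℕ) 5 = {1, 2, 3, 4, 5} := by rfl
  rw [hs]
  simp
  linarith

lemma cfGen_injective : Function.Injective cfGen := by
  intro a b h
  have := congrFun (congrFun h 1) 1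
  simpa [cfGen] using this

lemma sum_mul_pow {n m : ℕ} {A B : Finset Mat} (hA : A ⊆ gens ^ n) (hB : B ⊆ gens ^ m)
    {β : Type*} [AddCommMonoid β] (f : Mat → β) :
    ∑ γ ∈ A * B, f γ = ∑ a ∈ A, ∑ b ∈ B, f (a * b) := by
  rw [Finset.mul_def, Finset.sum_image, Finset.sum_product]
  rintro ⟨a, b⟩ h ⟨a', b'⟩ h' he
  simp only [Finset.coe_product, Set.mem_prod, Finset.mem_coe] at h h'
  obtain ⟨rfl, rfl⟩ := mul_inj_of_mem_pow (hA h.1) (hA h'.1) (hB h.2) (hB h'.2) he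
  rfl

lemma one_le_sum_weight (n : ℕ) :
    1 ≤ ∑ γ ∈ gens ^ n, ((γ 1 1 : ℝ) + γ 1 0 / 2) ^ (-(33 / 20) : ℝ) := by
  induction n with
  | zero => rw [pow_zero, ← Finset.singleton_one, Finset.sum_singleton]; simp
  | succ n ih =>
    refine ih.trans ?_
    rw [pow_succ, sum_mul_pow (n := n) (m := 1) subset_rfl (by simp)]
    refine Finset.sum_le_sum fun γ hγ => ?_
    rw [gens, Finset.sum_image (fun _ _ _ _ h => cfGen_injective h)]
    obtain ⟨-, -, h1, -, -, h3, -⟩ := (adm_of_mem_pow hγ).bounds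
    set d : ℝ := (γ 1 1 : ℝ) with hd
    set c : ℝ := (γ 1 0 : ℝ) with hc
    have h1' : 0 ≤ c := by rw [hc]; exact_mod_cast h1
    have h3' : 0 < d := by rw [hd]; exact_mod_cast h3
    have key := one_le_sum_rpow (x := c / d) (by positivity)
    have hpos : 0 < d + c / 2 := by positivity
    calc (d + c / 2) ^ (-(33 / 20) : ℝ) = (d + c / 2) ^ (-(33 / 20) : ℝ) * 1 := by ring
      _ ≤ (d + c / 2) ^ (-(33 / 20) : ℝ) *
          ∑ a ∈ Finset.Icc (1 : ℕ) 5, ((2 + c / d) / (2 * a + 1 + 2 * (c / d))) ^ (33 / 20 : ℝ) :=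
          mul_le_mul_of_nonneg_left key (by positivity)
      _ = ∑ a ∈ Finset.Icc (1 : ℕ) 5, (((γ * cfGen a) 1 1 : ℤ) + ((γ * cfGen a) 1 0 : ℤ) / 2 : ℝ)
            ^ (-(33 / 20) : ℝ) := by
          rw [Finset.mul_sum]
          refine Finset.sum_congr rfl fun a _ => ?_
          have e1 : (((γ * cfGen a) 1 1 : ℤ) + ((γ * cfGen a) 1 0 : ℤ) / 2 : ℝ)
              = c + a * d + d / 2 := by
            simp [cfGen, Matrix.mul_apply, Fin.sum_univ_two, hc, hd]; ring
          have e2 : (2 + c / d) / (2 * a + 1 + 2 * (c / d)) = (d + c / 2) / (c + a * d + d / 2) := by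
            field_simp
            ring
          rw [e1, e2, Real.div_rpow hpos.le (by positivity), Real.rpow_neg hpos.le,
            Real.rpow_neg (by positivity)]
          have := Real.rpow_pos_of_pos hpos (33 / 20)
          field_simp
      _ ≤ _ := le_rfl

lemma one_le_sum_d_rpow (n : ℕ) :
    1 ≤ ∑ γ ∈ gens ^ n, (γ 1 1 : ℝ) ^ (-(33 / 20) : ℝ) := by
  refine (one_le_sum_weight n).trans (Finset.sum_le_sum fun γ hγ => ?_)
  obtain ⟨-, -, h1, -, h2, h3, -⟩ := (adm_of_mem_pow hγ).bounds
  have h1' : (0 : ℝ) ≤ γ 1 0 := by exact_mod_cast h1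
  have h3' : (0 : ℝ) < γ 1 1 := by exact_mod_cast h3
  exact Real.rpow_le_rpow_of_nonpos h3' (by linarith) (by norm_num)

namespace Adm

lemma cast_bounds {γ : Mat} (h : Adm γ) : (0 : ℝ) ≤ γ 0 0 ∧ (0 : ℝ) ≤ γ 0 1 ∧ (0 : ℝ) ≤ γ 1 0 ∧
    (γ 0 1 : ℝ) ≤ γ 1 1 ∧ (γ 1 0 : ℝ) ≤ γ 1 1 ∧ (1 : ℝ) ≤ γ 1 1 ∧ (γ 0 0 : ℝ) ≤ γ 1 1 := by
  have := h.bounds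
  exact_mod_cast this

lemma abs_row_ratio_sub_le {M s : Mat} (hM : Adm M) (hs : Adm s) :
    |((M * s) 1 0 : ℝ) / (M * s) 1 1 - (s 1 0 : ℝ) / s 1 1| ≤ 1 / (s 1 1 : ℝ) ^ 2 := by
  obtain ⟨-, h1, h2, h3, h4, h5, -⟩ := hM.cast_bounds
  obtain ⟨k0, k1, k2, k3, k4, k5, -⟩ := hs.cast_bounds
  have hdet : (s 0 0 : ℝ) * s 1 1 - s 0 1 * s 1 0 = 1 ∨
      (s 0 0 : ℝ) * s 1 1 - s 0 1 * s 1 0 = -1 := by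
    have := hs.det
    rw [Matrix.det_fin_two] at this
    exact_mod_cast this
  have e0 : ((M * s) 1 0 : ℝ) = M 1 0 * s 0 0 + M 1 1 * s 1 0 := by
    simp [Matrix.mul_apply, Fin.sum_univ_two]
  have e1 : ((M * s) 1 1 : ℝ) = M 1 0 * s 0 1 + M 1 1 * s 1 1 := by
    simp [Matrix.mul_apply, Fin.sum_univ_two]
  rw [e0, e1]
  have hX : 0 < (M 1 0 : ℝ) * s 0 1 + M 1 1 * s 1 1 := by positivity
  have : ((M 1 0 : ℝ) * s 0 0 + M 1 1 * s 1 0) / (M 1 0 * s 0 1 + M 1 1 * s 1 1) - s 1 0 / s 1 1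
      = M 1 0 * (s 0 0 * s 1 1 - s 0 1 * s 1 0) /
        ((M 1 0 * s 0 1 + M 1 1 * s 1 1) * s 1 1) := by
    field_simp
    ring
  rw [this, abs_div, abs_mul, abs_of_nonneg h2]
  have ha : |(s 0 0 : ℝ) * s 1 1 - s 0 1 * s 1 0| = 1 := by
    rcases hdet with h | h <;> rw [h] <;> norm_num
  rw [ha, abs_of_pos (by positivity), div_le_div_iff₀ (by positivity) (by positivity)]
  nlinarith [mul_nonneg (sub_nonneg.2 h4) (sq_nonneg (s 1 1 : ℝ)),
    mul_nonneg (mul_nonneg h2 k1) (by linarith : (0 : ℝ) ≤ s 1 1)]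

lemma abs_col_ratio_sub_le {M s : Mat} (hM : Adm M) (hs : Adm s) :
    |((s * M) 0 1 : ℝ) / (s * M) 1 1 - (s 0 1 : ℝ) / s 1 1| ≤ 1 / (s 1 1 : ℝ) ^ 2 := by
  have := abs_row_ratio_sub_le hM.transpose hs.transpose
  rw [← Matrix.transpose_mul] at this
  simpa only [Matrix.transpose_apply] using this

end Adm

/-- A sequence of blocks of words with nearly constant size and nearly constant shape. -/
structure Blocks where
  m : ℕ
  m_pos : 0 < m
  B : ℕ → Finset Mat
  subset_pow : ∀ j, B j ⊆ gens ^ (2 * (m * (j + 1)))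
  nonempty : ∀ j, (B j).Nonempty
  size : ∀ j, ∀ γ ∈ B j, ∀ γ' ∈ B j, (γ 1 1 : ℝ) ≤ (1 + (1 / 2) ^ j) * γ' 1 1
  row : ∀ j, ∀ γ ∈ B j, ∀ γ' ∈ B j,
    |(γ 1 0 : ℝ) / γ 1 1 - (γ' 1 0 : ℝ) / γ' 1 1| ≤ (1 / 2) ^ j
  col : ∀ j, ∀ γ ∈ B j, ∀ γ' ∈ B j,
    |(γ 0 1 : ℝ) / γ 1 1 - (γ' 0 1 : ℝ) / γ' 1 1| ≤ (1 / 2) ^ j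
  card : ∀ j, ∀ γ ∈ B j, (2 * (γ 1 1 : ℝ)) ^ (41 / 25 : ℝ) ≤ (B j).card

lemma exists_mem_pow (n : ℕ) : ∃ s : Mat, s ∈ gens ^ n :=
  ⟨cfGen 1 ^ n, Finset.pow_mem_pow (mem_gens.2 ⟨1, le_rfl, by norm_num, rfl⟩)⟩

lemma exists_heavy_fiber {α : Type*} (F : Finset α) (w : α → ℝ) (key : α → ℕ) (R : ℕ)
    (hR : 0 < R) (hkey : ∀ x ∈ F, key x < R) :
    ∃ r, (∑ x ∈ F, w x) / R ≤ ∑ x ∈ F.filter (fun x => key x = r), w x := by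
  have h : ∑ r ∈ Finset.range R, ∑ x ∈ F.filter (fun x => key x = r), w x = ∑ x ∈ F, w x :=
    Finset.sum_fiberwise_of_maps_to (fun x hx => Finset.mem_range.2 (hkey x hx)) w
  obtain ⟨r, -, hr⟩ := Finset.exists_le_of_sum_le (s := Finset.range R)
    (f := fun _ => (∑ x ∈ F, w x) / R)
    (g := fun r => ∑ x ∈ F.filter (fun x => key x = r), w x) ⟨0, Finset.mem_range.2 hR⟩ (by
      rw [h, Finset.sum_const, Finset.card_range, nsmul_eq_mul, mul_div_cancel₀]
      exact_mod_cast hR.ne')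
  exact ⟨r, hr⟩

lemma exists_wrapped_words (m k : ℕ) (hm : 2 ≤ m) (hk : 1 ≤ k) :
    ∃ F ⊆ gens ^ (2 * (m * k)),
      (∀ γ ∈ F, ∀ γ' ∈ F, |(γ 1 0 : ℝ) / γ 1 1 - (γ' 1 0 : ℝ) / γ' 1 1| ≤ 2 / 4 ^ k) ∧
      (∀ γ ∈ F, ∀ γ' ∈ F, |(γ 0 1 : ℝ) / γ 1 1 - (γ' 0 1 : ℝ) / γ' 1 1| ≤ 2 / 4 ^ k) ∧
      (1 / 10 ^ (9 * k) : ℝ) ≤ ∑ γ ∈ F, (γ 1 1 : ℝ) ^ (-(33 / 20) : ℝ) := by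
  obtain ⟨s, hs⟩ := exists_mem_pow (2 * k)
  obtain ⟨n, rfl⟩ := Nat.exists_eq_add_of_le' hm
  have hsA := adm_of_mem_pow hs
  have hs2 : (2 : ℝ) ^ k ≤ s 1 1 := by exact_mod_cast le_d_of_mem_pow hs
  have hs10 : (s 1 1 : ℝ) ≤ 10 ^ (2 * k) := by exact_mod_cast d_le_of_mem_pow hs
  have hs1 : (1 / (s 1 1 : ℝ) ^ 2) ≤ 1 / 4 ^ k := by
    have : (4 : ℝ) ^ k = (2 ^ k) ^ 2 := by rw [← pow_mul, mul_comm, pow_mul]; norm_num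
    rw [this]
    gcongr
  set Γ := gens ^ (2 * (n * k)) with hΓ
  have hsub1 : ({s} : Finset Mat) ⊆ gens ^ (2 * k) := by simpa using hs
  have hsub2 : ({s} : Finset Mat) * Γ ⊆ gens ^ (2 * k + 2 * (n * k)) := by
    rw [pow_add]; exact Finset.mul_subset_mul hsub1 subset_rfl
  have hsub3 : ({s} : Finset Mat) * Γ * {s} ⊆ gens ^ (2 * k + 2 * (n * k) + 2 * k) := by
    rw [pow_add]; exact Finset.mul_subset_mul hsub2 hsub1
  have hexp : 2 * k + 2 * (n * k) + 2 * k = 2 * ((n + 2) * k) := by ring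
  have hrow : ∀ γ ∈ ({s} : Finset Mat) * Γ * {s},
      |(γ 1 0 : ℝ) / γ 1 1 - (s 1 0 : ℝ) / s 1 1| ≤ 1 / 4 ^ k := by
    intro γ hγ
    obtain ⟨x, hx, y, hy, rfl⟩ := Finset.mem_mul.1 hγ
    rw [Finset.mem_singleton] at hy; subst hy
    exact (Adm.abs_row_ratio_sub_le (adm_of_mem_pow (hsub2 hx)) hsA).trans hs1
  have hcol : ∀ γ ∈ ({s} : Finset Mat) * Γ * {s},
      |(γ 0 1 : ℝ) / γ 1 1 - (s 0 1 : ℝ) / s 1 1| ≤ 1 / 4 ^ k := by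
    intro γ hγ
    obtain ⟨x, hx, y, hy, rfl⟩ := Finset.mem_mul.1 hγ
    obtain ⟨z, hz, w, hw, rfl⟩ := Finset.mem_mul.1 hx
    rw [Finset.mem_singleton] at hy hz; subst hy; subst hz
    rw [Matrix.mul_assoc]
    exact (Adm.abs_col_ratio_sub_le ((adm_of_mem_pow hw).mul hsA) hsA).trans hs1
  refine ⟨({s} : Finset Mat) * Γ * {s}, hexp ▸ hsub3, ?_, ?_, ?_⟩
  · intro γ hγ γ' hγ'
    have h1 := abs_le.1 (hrow γ hγ)
    have h2 := abs_le.1 (hrow γ' hγ')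
    have : (2 : ℝ) / 4 ^ k = 1 / 4 ^ k + 1 / 4 ^ k := by ring
    rw [abs_le]; constructor <;> linarith
  · intro γ hγ γ' hγ'
    have h1 := abs_le.1 (hcol γ hγ)
    have h2 := abs_le.1 (hcol γ' hγ')
    have : (2 : ℝ) / 4 ^ k = 1 / 4 ^ k + 1 / 4 ^ k := by ring
    rw [abs_le]; constructor <;> linarith
  · rw [sum_mul_pow hsub2 hsub1, sum_mul_pow hsub1 subset_rfl, Finset.sum_singleton]
    simp only [Finset.sum_singleton]
    have key : ∀ γ ∈ Γ, (1 / 10 ^ (9 * k) : ℝ) * (γ 1 1 : ℝ) ^ (-(33 / 20) : ℝ)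
        ≤ ((s * γ * s) 1 1 : ℝ) ^ (-(33 / 20) : ℝ) := by
      intro γ hγ
      have hγA := adm_of_mem_pow hγ
      have d1 : (1 : ℝ) ≤ γ 1 1 := hγA.cast_bounds.2.2.2.2.2.1
      have d2 : (1 : ℝ) ≤ (s * γ * s) 1 1 :=
        ((hsA.mul hγA).mul hsA).cast_bounds.2.2.2.2.2.1
      have d3 : ((s * γ * s) 1 1 : ℝ) ≤ 2 * ((s * γ) 1 1 * s 1 1) := by
        exact_mod_cast (hsA.mul hγA).d_mul_le hsA
      have d4 : ((s * γ) 1 1 : ℝ) ≤ 2 * (s 1 1 * γ 1 1) := by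
        exact_mod_cast hsA.d_mul_le hγA
      have d5 : (1 : ℝ) ≤ s 1 1 := hsA.cast_bounds.2.2.2.2.2.1
      have d6 : ((s * γ * s) 1 1 : ℝ) ≤ 10 ^ (5 * k) * γ 1 1 := by
        have h4 : (4 : ℝ) ≤ 10 ^ k := by
          calc (4 : ℝ) ≤ 10 ^ 1 := by norm_num
            _ ≤ 10 ^ k := pow_le_pow_right₀ (by norm_num) hk
        calc ((s * γ * s) 1 1 : ℝ) ≤ 2 * ((s * γ) 1 1 * s 1 1) := d3
          _ ≤ 2 * ((2 * (s 1 1 * γ 1 1)) * s 1 1) := by gcongr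
          _ = 4 * (s 1 1 * s 1 1) * γ 1 1 := by ring
          _ ≤ 10 ^ k * (10 ^ (2 * k) * 10 ^ (2 * k)) * γ 1 1 := by gcongr
          _ = 10 ^ (5 * k) * γ 1 1 := by rw [← pow_add, ← pow_add]; congr 2; ring
      calc (1 / 10 ^ (9 * k) : ℝ) * (γ 1 1 : ℝ) ^ (-(33 / 20) : ℝ)
          ≤ (10 ^ (5 * k) : ℝ) ^ (-(33 / 20) : ℝ) * (γ 1 1 : ℝ) ^ (-(33 / 20) : ℝ) := by
            gcongr
            rw [← Real.rpow_natCast, ← Real.rpow_natCast, ← Real.rpow_mul (by norm_num), one_div,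
              ← Real.rpow_neg (by norm_num)]
            apply Real.rpow_le_rpow_of_exponent_le (by norm_num)
            push_cast
            have : (0 : ℝ) ≤ k := by positivity
            linarith
        _ = (10 ^ (5 * k) * γ 1 1 : ℝ) ^ (-(33 / 20) : ℝ) := by
            rw [Real.mul_rpow (by positivity) (by linarith)]
        _ ≤ _ := Real.rpow_le_rpow_of_nonpos (by linarith) d6 (by norm_num)
    calc (1 / 10 ^ (9 * k) : ℝ) ≤ (1 / 10 ^ (9 * k) : ℝ) * ∑ γ ∈ Γ, (γ 1 1 : ℝ) ^ (-(33 / 20) : ℝ) :=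
          le_mul_of_one_le_right (by positivity) (one_le_sum_d_rpow _)
      _ ≤ _ := by rw [Finset.mul_sum]; exact Finset.sum_le_sum key

lemma exists_thin_fiber (m k : ℕ) (hm : 0 < m) (hk : 1 ≤ k) (F : Finset Mat)
    (hF : F ⊆ gens ^ (2 * (m * k)))
    (hs : (1 / 10 ^ (9 * k) : ℝ) ≤ ∑ γ ∈ F, (γ 1 1 : ℝ) ^ (-(33 / 20) : ℝ)) :
    ∃ F' ⊆ F, (1 / 10 ^ (9 * k) : ℝ) / (7 * m * 4 ^ k) ≤ ∑ γ ∈ F', (γ 1 1 : ℝ) ^ (-(33 / 20) : ℝ) ∧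
      ∀ γ ∈ F', ∀ γ' ∈ F', (γ 1 1 : ℝ) ≤ (1 + 2 * (1 / 2) ^ k) * γ' 1 1 := by
  have hlog10 : Real.log 10 ≤ 3 := by
    rw [Real.log_le_iff_le_exp (by norm_num)]
    have h1 : (2.7 : ℝ) ≤ Real.exp 1 := by linarith [Real.exp_one_gt_d9]
    calc (10 : ℝ) ≤ 2.7 ^ 3 := by norm_num
      _ ≤ Real.exp 1 ^ 3 := by gcongr
      _ = Real.exp 3 := by rw [← Real.exp_nat_mul]; norm_num
  have hmR : (1 : ℝ) ≤ m := by exact_mod_cast hm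
  have hkR : (1 : ℝ) ≤ k := by exact_mod_cast hk
  set key : Mat → ℕ := fun γ => ⌊Real.log (γ 1 1) * 2 ^ k⌋₊ with hkey
  have hd1 : ∀ γ ∈ F, (1 : ℝ) ≤ γ 1 1 := fun γ hγ =>
    (adm_of_mem_pow (hF hγ)).cast_bounds.2.2.2.2.2.1
  obtain ⟨r, hr⟩ := exists_heavy_fiber F (fun γ => (γ 1 1 : ℝ) ^ (-(33 / 20) : ℝ)) key
    (7 * (m * k) * 2 ^ k) (by positivity) (by
      intro γ hγ
      have h1 := hd1 γ hγ
      have h2 : (γ 1 1 : ℝ) ≤ 10 ^ (2 * (m * k)) := by exact_mod_cast d_le_of_mem_pow (hF hγ)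
      have h3 : Real.log (γ 1 1) ≤ 6 * (m * k) := by
        calc Real.log (γ 1 1) ≤ Real.log (10 ^ (2 * (m * k))) := Real.log_le_log (by linarith) h2
          _ = 2 * (m * k) * Real.log 10 := by rw [Real.log_pow]; push_cast; ring
          _ ≤ 2 * (m * k) * 3 := by gcongr
          _ = 6 * (m * k) := by ring
      rw [hkey, Nat.floor_lt (mul_nonneg (Real.log_nonneg h1) (by positivity))]
      push_cast
      gcongr
      refine h3.trans_lt ?_
      gcongr
      norm_num)
  refine ⟨F.filter (fun γ => key γ = r), Finset.filter_subset _ _, le_trans ?_ hr, ?_⟩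
  · have hk2 : (k : ℝ) ≤ 2 ^ k := by exact_mod_cast (Nat.lt_two_pow_self).le
    have h4 : (4 : ℝ) ^ k = 2 ^ k * 2 ^ k := by rw [← mul_pow]; norm_num
    push_cast
    apply div_le_div₀ (le_trans (by positivity) hs) hs (by positivity)
    rw [h4]
    have : (m : ℝ) * k * 2 ^ k ≤ m * 2 ^ k * 2 ^ k := by gcongr
    nlinarith
  · intro γ hγ γ' hγ'
    rw [Finset.mem_filter] at hγ hγ'
    have h1 := hd1 γ hγ.1
    have h2 := hd1 γ' hγ'.1
    have f1 := Nat.lt_floor_add_one (Real.log (γ 1 1) * 2 ^ k)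
    have f2 := Nat.floor_le (mul_nonneg (Real.log_nonneg h2) (by positivity : (0:ℝ) ≤ 2 ^ k))
    have e1 : ⌊Real.log (γ 1 1) * 2 ^ k⌋₊ = r := hγ.2
    have e2 : ⌊Real.log (γ' 1 1) * 2 ^ k⌋₊ = r := hγ'.2
    rw [e1] at f1; rw [e2] at f2
    have h3 : (Real.log (γ 1 1) - Real.log (γ' 1 1)) * 2 ^ k ≤ 1 := by linarith
    have h4 : Real.log (γ 1 1) - Real.log (γ' 1 1) ≤ (1 / 2) ^ k := by
      rw [one_div, inv_pow, ← one_div, le_div_iff₀ (by positivity)]; exact h3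
    have hx : ((1 : ℝ) / 2) ^ k ≤ 1 / 2 := by
      calc ((1 : ℝ) / 2) ^ k ≤ (1 / 2) ^ 1 :=
            pow_le_pow_of_le_one (by norm_num) (by norm_num) hk
        _ = 1 / 2 := by norm_num
    have hx0 : 0 < ((1 : ℝ) / 2) ^ k := by positivity
    set x := ((1 : ℝ) / 2) ^ k
    have h5 : Real.exp x ≤ 1 + 2 * x := by
      have := Real.exp_bound_div_one_sub_of_interval hx0.le (by linarith)
      refine this.trans ?_
      rw [div_le_iff₀ (by linarith)]
      nlinarith
    calc (γ 1 1 : ℝ) = Real.exp (Real.log (γ 1 1)) := (Real.exp_log (by linarith)).symm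
      _ ≤ Real.exp (x + Real.log (γ' 1 1)) := Real.exp_le_exp.2 (by linarith)
      _ = Real.exp x * γ' 1 1 := by rw [Real.exp_add, Real.exp_log (by linarith)]
      _ ≤ _ := by gcongr

lemma card_of_thin {m k : ℕ} (hm : m = 10000) (hk : 1 ≤ k) {F : Finset Mat} {d : ℝ}
    (hd : 2 ^ (m * k) ≤ d)
    (hs : (1 / 10 ^ (9 * k) : ℝ) / (7 * m * 4 ^ k) ≤
      ∑ γ ∈ F, (γ 1 1 : ℝ) ^ (-(33 / 20) : ℝ))
    (h : ∀ γ ∈ F, d ≤ 2 * γ 1 1) : (2 * d) ^ (41 / 25 : ℝ) ≤ F.card := by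
  subst hm
  have hd0 : 0 < d := lt_of_lt_of_le (by positivity) hd
  have h1 : ∑ γ ∈ F, (γ 1 1 : ℝ) ^ (-(33 / 20) : ℝ) ≤ F.card * (d / 2) ^ (-(33 / 20) : ℝ) := by
    rw [← nsmul_eq_mul]
    refine Finset.sum_le_card_nsmul _ _ _ fun γ hγ => ?_
    have := h γ hγ
    exact Real.rpow_le_rpow_of_nonpos (by positivity) (by linarith) (by norm_num)
  have h2 := hs.trans h1
  have hy : (2 : ℝ) ^ (100 * k) ≤ d ^ (1 / 100 : ℝ) := by
    calc (2 : ℝ) ^ (100 * k) = (2 ^ (10000 * k)) ^ (1 / 100 : ℝ) := by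
          rw [← Real.rpow_natCast, ← Real.rpow_natCast, ← Real.rpow_mul (by norm_num)]
          congr 1; push_cast; ring
      _ ≤ _ := Real.rpow_le_rpow (by positivity) hd (by norm_num)
  have hbig : (16 * (7 * 10000)) * ((4 : ℝ) ^ k * 10 ^ (9 * k)) ≤ 2 ^ (100 * k) := by
    calc (16 * (7 * 10000)) * ((4 : ℝ) ^ k * 10 ^ (9 * k))
        ≤ (16 * (7 * 10000)) ^ k * ((4 : ℝ) ^ k * 10 ^ (9 * k)) := by
          gcongr
          exact le_self_pow₀ (by norm_num) (by omega)
      _ = (16 * (7 * 10000) * (4 * 10 ^ 9)) ^ k := by rw [pow_mul, ← mul_pow, ← mul_pow]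
      _ ≤ (2 ^ 100) ^ k := by gcongr; norm_num
      _ = _ := by rw [pow_mul]
  have e1 : (2 * d) ^ (41 / 25 : ℝ) ≤ 4 * d ^ (41 / 25 : ℝ) := by
    rw [Real.mul_rpow (by norm_num) hd0.le]
    gcongr
    calc (2 : ℝ) ^ (41 / 25 : ℝ) ≤ 2 ^ (2 : ℝ) :=
          Real.rpow_le_rpow_of_exponent_le (by norm_num) (by norm_num)
      _ = 4 := by norm_num
  have e2 : (d / 2) ^ (-(33 / 20) : ℝ) ≤ 4 * (d ^ (41 / 25 : ℝ) * d ^ (1 / 100 : ℝ))⁻¹ := by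
    rw [← Real.rpow_add hd0, Real.div_rpow hd0.le (by norm_num), ← Real.rpow_neg hd0.le, div_eq_mul_inv,
      ← Real.rpow_neg (by norm_num), mul_comm]
    have : (41 / 25 + 1 / 100 : ℝ) = 33 / 20 := by norm_num
    rw [this]
    gcongr
    calc (2 : ℝ) ^ (-(-(33 / 20)) : ℝ) ≤ 2 ^ (2 : ℝ) :=
          Real.rpow_le_rpow_of_exponent_le (by norm_num) (by norm_num)
      _ = 4 := by norm_num
  refine e1.trans ?_
  have hA : 0 < d ^ (41 / 25 : ℝ) := by positivity
  have hY : 0 < d ^ (1 / 100 : ℝ) := by positivity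
  set A := d ^ (41 / 25 : ℝ)
  set Y := d ^ (1 / 100 : ℝ)
  have h3 : (1 / 10 ^ (9 * k) : ℝ) / (7 * (10000 : ℕ) * 4 ^ k) ≤ F.card * (4 * (A * Y)⁻¹) :=
    h2.trans (by gcongr)
  have h4 : A * Y ≤ F.card * 4 * ((7 * 10000) * (4 ^ k * 10 ^ (9 * k))) := by
    rw [div_div, ← div_eq_mul_inv, ← mul_div_assoc,
      div_le_div_iff₀ (by positivity) (by positivity)] at h3
    push_cast at h3
    linarith
  have h5 : A * ((16 * (7 * 10000)) * ((4 : ℝ) ^ k * 10 ^ (9 * k))) ≤ A * Y := by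
    gcongr; exact hbig.trans hy
  have hP : 0 < (4 : ℝ) ^ k * 10 ^ (9 * k) := by positivity
  set P := (4 : ℝ) ^ k * 10 ^ (9 * k)
  have h6 : (4 * A) * P ≤ F.card * P := by linarith
  exact le_of_mul_le_mul_right h6 hP

lemma exists_block {m : ℕ} (hm : m = 10000) (j : ℕ) : ∃ B : Finset Mat, B ⊆ gens ^ (2 * (m * (j + 1))) ∧ B.Nonempty ∧
    (∀ γ ∈ B, ∀ γ' ∈ B, (γ 1 1 : ℝ) ≤ (1 + (1 / 2) ^ j) * γ' 1 1) ∧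
    (∀ γ ∈ B, ∀ γ' ∈ B, |(γ 1 0 : ℝ) / γ 1 1 - (γ' 1 0 : ℝ) / γ' 1 1| ≤ (1 / 2) ^ j) ∧
    (∀ γ ∈ B, ∀ γ' ∈ B, |(γ 0 1 : ℝ) / γ 1 1 - (γ' 0 1 : ℝ) / γ' 1 1| ≤ (1 / 2) ^ j) ∧
    (∀ γ ∈ B, (2 * (γ 1 1 : ℝ)) ^ (41 / 25 : ℝ) ≤ B.card) := by
  obtain ⟨F, hF, hrow, hcol, hs⟩ := exists_wrapped_words m (j + 1) (by omega) (by omega)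
  obtain ⟨F', hF', hs', hd⟩ := exists_thin_fiber m (j + 1) (by omega) (by omega) F hF hs
  have hj : (2 : ℝ) / 4 ^ (j + 1) ≤ (1 / 2) ^ j := by
    have : (4 : ℝ) ^ j = 2 ^ j * 2 ^ j := by rw [← mul_pow]; norm_num
    rw [pow_succ, this, one_div, inv_pow, ← one_div, div_le_div_iff₀ (by positivity) (by positivity)]
    have : (1 : ℝ) ≤ 2 ^ j := one_le_pow₀ (by norm_num)
    nlinarith
  have hj2 : (1 : ℝ) + 2 * (1 / 2) ^ (j + 1) = 1 + (1 / 2) ^ j := by rw [pow_succ]; ring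
  refine ⟨F', hF'.trans hF, ?_, ?_, ?_, ?_, ?_⟩
  · rw [Finset.nonempty_iff_ne_empty]
    rintro rfl
    rw [Finset.sum_empty] at hs'
    have : (0 : ℝ) < (1 / 10 ^ (9 * (j + 1)) : ℝ) / (7 * m * 4 ^ (j + 1)) := by
      have : 0 < m := by omega
      positivity
    linarith
  · simpa only [hj2] using hd
  · exact fun γ h γ' h' => (hrow γ (hF' h) γ' (hF' h')).trans hj
  · exact fun γ h γ' h' => (hcol γ (hF' h) γ' (hF' h')).trans hj
  · intro γ hγ
    refine card_of_thin (k := j + 1) hm (by omega) ?_ hs' ?_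
    · exact_mod_cast le_d_of_mem_pow (hF (hF' hγ))
    · intro γ' hγ'
      refine (hd γ hγ γ' hγ').trans ?_
      have h1 := (adm_of_mem_pow (hF (hF' hγ'))).cast_bounds.2.2.2.2.2.1
      have : (1 / 2 : ℝ) ^ j ≤ 1 := pow_le_one₀ (by norm_num) (by norm_num)
      rw [hj2]
      gcongr
      linarith

theorem exists_blocks : Nonempty Blocks := by
  choose B h using exists_block (m := 10000) rfl
  exact ⟨⟨10000, by norm_num, B, fun j => (h j).1, fun j => (h j).2.1, fun j => (h j).2.2.1,
    fun j => (h j).2.2.2.1, fun j => (h j).2.2.2.2.1, fun j => (h j).2.2.2.2.2⟩⟩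

namespace Blocks

/-- Products of the blocks with indices in `[i, k)`. -/
def U (S : Blocks) (i k : ℕ) : Finset Mat := ((List.range' i (k - i)).map S.B).prod

/-- Half the word length of the elements of `U i k`. -/
def len (S : Blocks) (i k : ℕ) : ℕ := ((List.range' i (k - i)).map fun j => S.m * (j + 1)).sum

/-- The largest bottom-right entry in `U i k`. -/
def D (S : Blocks) (i k : ℕ) : ℕ := (S.U i k).sup fun γ => (γ 1 1).toNat

variable (S : Blocks)

lemma U_self (i : ℕ) : S.U i i = 1 := by simp [U]

lemma range'_split {i j k : ℕ} (h : i ≤ j) (h' : j ≤ k) :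
    List.range' i (k - i) = List.range' i (j - i) ++ List.range' j (k - j) := by
  have := List.range'_append (s := i) (m := j - i) (n := k - j) (step := 1)
  rw [one_mul, Nat.add_sub_cancel' h] at this
  rw [this]; congr 1; omega

lemma U_mul {i j k : ℕ} (h : i ≤ j) (h' : j ≤ k) : S.U i j * S.U j k = S.U i k := by
  rw [U, U, U, range'_split h h', List.map_append, List.prod_append]

lemma U_one (k : ℕ) : S.U k (k + 1) = S.B k := by simp [U]

lemma len_one (k : ℕ) : S.len k (k + 1) = S.m * (k + 1) := by simp [len]

lemma U_subset (i k : ℕ) : S.U i k ⊆ gens ^ (2 * S.len i k) := by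
  rw [U, len]
  induction List.range' i (k - i) with
  | nil => simp
  | cons a l ih =>
    simp only [List.map_cons, List.prod_cons, List.sum_cons]
    rw [mul_add, pow_add]
    exact Finset.mul_subset_mul (S.subset_pow a) ih

lemma U_nonempty (i k : ℕ) : (S.U i k).Nonempty := by
  rw [U]
  induction List.range' i (k - i) with
  | nil => simp
  | cons a l ih =>
    simp only [List.map_cons, List.prod_cons]
    exact (S.nonempty a).mul ih

variable {S}

lemma adm {i k : ℕ} {γ : Mat} (h : γ ∈ S.U i k) : Adm γ := adm_of_mem_pow (S.U_subset i k h)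

lemma one_le_d {i k : ℕ} {γ : Mat} (h : γ ∈ S.U i k) : (1 : ℝ) ≤ γ 1 1 :=
  (adm h).cast_bounds.2.2.2.2.2.1

variable (S)

lemma sum_U {i j k : ℕ} (h : i ≤ j) (h' : j ≤ k) {β : Type*} [AddCommMonoid β] (f : Mat → β) :
    ∑ γ ∈ S.U i k, f γ = ∑ a ∈ S.U i j, ∑ b ∈ S.U j k, f (a * b) := by
  rw [← S.U_mul h h']
  exact sum_mul_pow (S.U_subset i j) (S.U_subset j k) f

lemma card_U {i j k : ℕ} (h : i ≤ j) (h' : j ≤ k) :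
    (S.U i k).card = (S.U i j).card * (S.U j k).card := by
  have := S.sum_U h h' (fun _ => 1)
  simpa using this

lemma size_aux {k : ℕ} {P P' x x' : Mat} (hP : Adm P) (hP' : Adm P') (hx : Adm x) (hx' : Adm x')
    {A : ℝ} (h1 : (P 1 1 : ℝ) ≤ A * P' 1 1) (h2 : (x 1 1 : ℝ) ≤ (1 + (1 / 2) ^ k) * x' 1 1)
    (h3 : |(P 1 0 : ℝ) / P 1 1 - (P' 1 0 : ℝ) / P' 1 1| ≤ 6 * (1 / 2) ^ k)
    (h4 : |(x 0 1 : ℝ) / x 1 1 - (x' 0 1 : ℝ) / x' 1 1| ≤ (1 / 2) ^ k) :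
    ((P * x) 1 1 : ℝ) ≤ A * Real.exp (8 * (1 / 2) ^ k) * (P' * x') 1 1 := by
  obtain ⟨-, -, p2, -, p4, p5, -⟩ := hP.cast_bounds
  obtain ⟨-, -, p2', -, p4', p5', -⟩ := hP'.cast_bounds
  obtain ⟨-, q1, -, q3, -, q5, -⟩ := hx.cast_bounds
  obtain ⟨-, q1', -, q3', -, q5', -⟩ := hx'.cast_bounds
  have e (P x : Mat) (h : (1 : ℝ) ≤ P 1 1) (h' : (1 : ℝ) ≤ x 1 1) : ((P * x) 1 1 : ℝ) =
      P 1 1 * x 1 1 * (1 + (P 1 0 / P 1 1) * (x 0 1 / x 1 1)) := by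
    rw [Adm.mul_d]; push_cast; field_simp; ring
  rw [e P x p5 q5, e P' x' p5' q5']
  set ε : ℝ := (1 / 2) ^ k with hε
  have hε0 : 0 < ε := by positivity
  have r1 : 0 ≤ (P 1 0 : ℝ) / P 1 1 := by positivity
  have r1' : (P 1 0 : ℝ) / P 1 1 ≤ 1 := by rw [div_le_one (by linarith)]; exact p4
  have r2 : 0 ≤ (P' 1 0 : ℝ) / P' 1 1 := by positivity
  have r3 : 0 ≤ (x 0 1 : ℝ) / x 1 1 := by positivity
  have r4 : 0 ≤ (x' 0 1 : ℝ) / x' 1 1 := by positivity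
  have r4' : (x' 0 1 : ℝ) / x' 1 1 ≤ 1 := by rw [div_le_one (by linarith)]; exact q3'
  set ρ := (P 1 0 : ℝ) / P 1 1
  set ρ' := (P' 1 0 : ℝ) / P' 1 1
  set σ := (x 0 1 : ℝ) / x 1 1
  set σ' := (x' 0 1 : ℝ) / x' 1 1
  have h3' := (abs_le.1 h3).2
  have h4' := (abs_le.1 h4).2
  have hA : 0 ≤ A := by
    by_contra hA
    nlinarith
  have h5 : 1 + ρ * σ ≤ (1 + 7 * ε) * (1 + ρ' * σ') := by
    have : ρ * σ - ρ' * σ' ≤ 7 * ε := by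
      have : ρ * σ - ρ' * σ' = ρ * (σ - σ') + (ρ - ρ') * σ' := by ring
      rw [this]
      have a1 : ρ * (σ - σ') ≤ 1 * ε := by
        calc ρ * (σ - σ') ≤ ρ * ε := mul_le_mul_of_nonneg_left h4' r1
          _ ≤ 1 * ε := by gcongr
      have a2 : (ρ - ρ') * σ' ≤ 6 * ε * 1 := by
        calc (ρ - ρ') * σ' ≤ 6 * ε * σ' := mul_le_mul_of_nonneg_right h3' r4
          _ ≤ 6 * ε * 1 := by gcongr
      linarith
    nlinarith [mul_nonneg r2 r4, mul_nonneg (mul_nonneg r2 r4) hε0.le]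
  have h6 : (1 + ε) * (1 + 7 * ε) ≤ Real.exp (8 * ε) := by
    have b1 : 1 + ε ≤ Real.exp ε := by linarith [Real.add_one_le_exp ε]
    have b2 : 1 + 7 * ε ≤ Real.exp (7 * ε) := by linarith [Real.add_one_le_exp (7 * ε)]
    calc (1 + ε) * (1 + 7 * ε) ≤ Real.exp ε * Real.exp (7 * ε) := by gcongr
      _ = Real.exp (8 * ε) := by rw [← Real.exp_add]; ring_nf
  calc (P 1 1 : ℝ) * x 1 1 * (1 + ρ * σ)
      ≤ (A * P' 1 1) * ((1 + ε) * x' 1 1) * ((1 + 7 * ε) * (1 + ρ' * σ')) := by gcongr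
    _ = A * ((1 + ε) * (1 + 7 * ε)) * (P' 1 1 * x' 1 1 * (1 + ρ' * σ')) := by ring
    _ ≤ A * Real.exp (8 * ε) * (P' 1 1 * x' 1 1 * (1 + ρ' * σ')) := by gcongr

lemma row_close {i k : ℕ} (h : i ≤ k) {P P' : Mat} (hP : P ∈ S.U i (k + 1))
    (hP' : P' ∈ S.U i (k + 1)) :
    |(P 1 0 : ℝ) / P 1 1 - (P' 1 0 : ℝ) / P' 1 1| ≤ 3 * (1 / 2) ^ k := by
  rw [← S.U_mul h (Nat.le_succ k), U_one] at hP hP'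
  obtain ⟨x, hx, y, hy, rfl⟩ := Finset.mem_mul.1 hP
  obtain ⟨x', hx', y', hy', rfl⟩ := Finset.mem_mul.1 hP'
  have h1 := abs_le.1 (Adm.abs_row_ratio_sub_le (adm hx) (adm_of_mem_pow (S.subset_pow k hy)))
  have h2 := abs_le.1 (Adm.abs_row_ratio_sub_le (adm hx') (adm_of_mem_pow (S.subset_pow k hy')))
  have h3 := abs_le.1 (S.row k y hy y' hy')
  have key : ∀ y ∈ S.B k, 1 / (y 1 1 : ℝ) ^ 2 ≤ (1 / 2) ^ k := by
    intro y hy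
    have : (2 : ℝ) ^ (S.m * (k + 1)) ≤ y 1 1 := by
      exact_mod_cast le_d_of_mem_pow (S.subset_pow k hy)
    have h4 : (2 : ℝ) ^ k ≤ 2 ^ (S.m * (k + 1)) := by
      apply pow_le_pow_right₀ (by norm_num)
      have := S.m_pos
      nlinarith
    have h5 : (1 : ℝ) ≤ 2 ^ k := one_le_pow₀ (by norm_num)
    rw [one_div (2 : ℝ), inv_pow, ← one_div]
    apply one_div_le_one_div_of_le (by positivity)
    nlinarith
  have := key y hy
  have := key y' hy'
  rw [abs_le]
  constructor <;> linarith

lemma size_le {i k : ℕ} (h : i ≤ k) : ∀ γ ∈ S.U i k, ∀ γ' ∈ S.U i k,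
    (γ 1 1 : ℝ) ≤ Real.exp (16 - 16 * (1 / 2) ^ k) * γ' 1 1 := by
  induction k, h using Nat.le_induction with
  | base =>
    intro γ hγ γ' hγ'
    rw [U_self, Finset.mem_one] at hγ hγ'
    subst hγ hγ'
    have : (1 / 2 : ℝ) ^ i ≤ 1 := pow_le_one₀ (by norm_num) (by norm_num)
    simpa using this
  | succ k h ih =>
    intro γ hγ γ' hγ'
    rw [← S.U_mul h (Nat.le_succ k), U_one] at hγ hγ'
    obtain ⟨P, hP, x, hx, rfl⟩ := Finset.mem_mul.1 hγ
    obtain ⟨P', hP', x', hx', rfl⟩ := Finset.mem_mul.1 hγ'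
    have h3 : |(P 1 0 : ℝ) / P 1 1 - (P' 1 0 : ℝ) / P' 1 1| ≤ 6 * (1 / 2) ^ k := by
      rcases Nat.eq_or_lt_of_le h with rfl | hlt
      · rw [U_self, Finset.mem_one] at hP hP'
        subst hP hP'; simp
      · obtain ⟨k', rfl⟩ : ∃ k', k = k' + 1 := ⟨k - 1, by omega⟩
        have := S.row_close (by omega) hP hP'
        rw [pow_succ]; linarith
    have := size_aux (adm hP) (adm hP') (adm_of_mem_pow (S.subset_pow k hx))
      (adm_of_mem_pow (S.subset_pow k hx')) (ih P hP P' hP') (S.size k x hx x' hx') h3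
      (S.col k x hx x' hx')
    refine this.trans (le_of_eq ?_)
    rw [← Real.exp_add]
    congr 2
    rw [pow_succ]; ring

/-- Sizes within one `U i k` agree up to this factor. -/
noncomputable def C0 : ℝ := Real.exp 16

lemma one_le_C0 : 1 ≤ C0 := by rw [C0]; exact Real.one_le_exp (by norm_num)

variable {S}

lemma d_le_C0 {i k : ℕ} (h : i ≤ k) {γ γ' : Mat} (hγ : γ ∈ S.U i k) (hγ' : γ' ∈ S.U i k) :
    (γ 1 1 : ℝ) ≤ C0 * γ' 1 1 := by
  refine (S.size_le h γ hγ γ' hγ').trans ?_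
  have := one_le_d hγ'
  rw [C0]
  gcongr
  have : (0 : ℝ) ≤ (1 / 2) ^ k := by positivity
  linarith

lemma d_le_D {i k : ℕ} {γ : Mat} (h : γ ∈ S.U i k) : γ 1 1 ≤ S.D i k := by
  have h1 : (γ 1 1).toNat ≤ S.D i k := Finset.le_sup (f := fun γ : Mat => (γ 1 1).toNat) h
  have := (adm h).d_pos
  omega

lemma d_le_D' {i k : ℕ} {γ : Mat} (h : γ ∈ S.U i k) : (γ 1 1 : ℝ) ≤ S.D i k := by
  exact_mod_cast d_le_D h

variable (S)

lemma exists_eq_D (i k : ℕ) : ∃ γ ∈ S.U i k, γ 1 1 = S.D i k := by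
  obtain ⟨γ, hγ, h⟩ := Finset.exists_mem_eq_sup (S.U i k) (S.U_nonempty i k)
    (fun γ : Mat => (γ 1 1).toNat)
  refine ⟨γ, hγ, ?_⟩
  rw [D, h]
  have := (adm hγ).d_pos
  omega

lemma exists_eq_D' (i k : ℕ) : ∃ γ ∈ S.U i k, (γ 1 1 : ℝ) = S.D i k := by
  obtain ⟨γ, hγ, h⟩ := S.exists_eq_D i k
  exact ⟨γ, hγ, by exact_mod_cast h⟩

lemma one_le_D (i k : ℕ) : (1 : ℝ) ≤ S.D i k := by
  obtain ⟨γ, hγ, h⟩ := S.exists_eq_D' i k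
  rw [← h]; exact one_le_d hγ

lemma D_self (i : ℕ) : S.D i i = 1 := by
  obtain ⟨γ, hγ, h⟩ := S.exists_eq_D i i
  rw [U_self, Finset.mem_one] at hγ
  subst hγ
  simp at h
  omega

lemma D_le_C0 {i k : ℕ} (h : i ≤ k) {γ : Mat} (hγ : γ ∈ S.U i k) : (S.D i k : ℝ) ≤ C0 * γ 1 1 := by
  obtain ⟨δ, hδ, h'⟩ := S.exists_eq_D' i k
  rw [← h']; exact d_le_C0 h hδ hγ

lemma D_le_mul {i j k : ℕ} (h : i ≤ j) (h' : j ≤ k) :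
    (S.D i k : ℝ) ≤ 2 * (S.D i j * S.D j k) := by
  obtain ⟨γ, hγ, e⟩ := S.exists_eq_D' i k
  rw [← S.U_mul h h'] at hγ
  obtain ⟨x, hx, y, hy, rfl⟩ := Finset.mem_mul.1 hγ
  rw [← e]
  have h1 : ((x * y) 1 1 : ℝ) ≤ 2 * (x 1 1 * y 1 1) := by
    exact_mod_cast (adm hx).d_mul_le (adm hy)
  have := d_le_D' hx
  have := d_le_D' hy
  have := one_le_d hx
  have := one_le_d hy
  refine h1.trans ?_
  gcongr

lemma mul_D_le {i j k : ℕ} (h : i ≤ j) (h' : j ≤ k) :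
    (S.D i j : ℝ) * S.D j k ≤ S.D i k := by
  obtain ⟨x, hx, e⟩ := S.exists_eq_D' i j
  obtain ⟨y, hy, e'⟩ := S.exists_eq_D' j k
  rw [← e, ← e']
  have h1 : (x 1 1 : ℝ) * y 1 1 ≤ (x * y) 1 1 := by
    exact_mod_cast (adm hx).le_d_mul (adm hy)
  refine h1.trans (d_le_D' ?_)
  rw [← S.U_mul h h']
  exact Finset.mul_mem_mul hx hy

lemma card_B {k : ℕ} : (2 * (S.D k (k + 1) : ℝ)) ^ (41 / 25 : ℝ) ≤ (S.U k (k + 1)).card := by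
  obtain ⟨x, hx, e⟩ := S.exists_eq_D' k (k + 1)
  rw [← e]
  rw [U_one] at hx ⊢
  exact S.card k x hx

lemma rpow_D_le_card {i k : ℕ} (h : i ≤ k) :
    (S.D i k : ℝ) ^ (41 / 25 : ℝ) ≤ (S.U i k).card := by
  induction k, h using Nat.le_induction with
  | base => simp [D_self, U_self]
  | succ k h ih =>
    rw [S.card_U h (Nat.le_succ k)]
    push_cast
    have h1 := S.one_le_D i k
    have h2 := S.one_le_D k (k + 1)
    calc (S.D i (k + 1) : ℝ) ^ (41 / 25 : ℝ) ≤ (S.D i k * (2 * S.D k (k + 1))) ^ (41 / 25 : ℝ) := by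
          apply Real.rpow_le_rpow (by positivity) _ (by norm_num)
          linarith [S.D_le_mul h (Nat.le_succ k)]
      _ = (S.D i k : ℝ) ^ (41 / 25 : ℝ) * (2 * (S.D k (k + 1) : ℝ)) ^ (41 / 25 : ℝ) :=
          Real.mul_rpow (by positivity) (by positivity)
      _ ≤ _ := by gcongr; exact S.card_B

lemma D_succ_le (k : ℕ) : (S.D k (k + 1) : ℝ) ≤ 100 ^ (S.m * (k + 1)) := by
  obtain ⟨x, hx, e⟩ := S.exists_eq_D' k (k + 1)
  have h1 := d_le_of_mem_pow (S.U_subset _ _ hx)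
  rw [len_one, pow_mul] at h1
  rw [← e]
  norm_num at h1
  exact_mod_cast h1

lemma two_pow_le_D (k : ℕ) : (2 : ℝ) ^ (k * k) ≤ (S.D 0 k : ℝ) ^ 2 := by
  induction k with
  | zero => simp [D_self]
  | succ k ih =>
    have h1 := S.mul_D_le (Nat.zero_le k) (Nat.le_succ k)
    have h2 : (2 : ℝ) ^ (k + 1) ≤ S.D k (k + 1) := by
      obtain ⟨x, hx, e⟩ := S.exists_eq_D' k (k + 1)
      have h1 := le_d_of_mem_pow (S.U_subset _ _ hx)
      rw [len_one] at h1
      rw [← e]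
      have h3 : (2 : ℤ) ^ (k + 1) ≤ 2 ^ (S.m * (k + 1)) := by
        apply pow_le_pow_right₀ (by norm_num)
        exact Nat.le_mul_of_pos_left _ S.m_pos
      exact_mod_cast h3.trans h1
    calc (2 : ℝ) ^ ((k + 1) * (k + 1)) ≤ 2 ^ (k * k + 2 * (k + 1)) :=
          pow_le_pow_right₀ (by norm_num) (by ring_nf; omega)
      _ = 2 ^ (k * k) * (2 ^ (k + 1)) ^ 2 := by rw [pow_add, ← pow_mul, mul_comm 2 (k + 1)]
      _ ≤ (S.D 0 k : ℝ) ^ 2 * (S.D k (k + 1) : ℝ) ^ 2 := by gcongr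
      _ = (S.D 0 k * S.D k (k + 1) : ℝ) ^ 2 := by ring
      _ ≤ _ := by gcongr

lemma exists_growth {ε : ℝ} (hε : 0 < ε) : ∃ C : ℝ, 1 ≤ C ∧ ∀ i k : ℕ, i ≤ k →
    (S.D i (k + 1) : ℝ) ≤ C * (S.D i k * (S.D 0 k : ℝ) ^ ε) := by
  set a : ℝ := S.m * Real.log 100 with ha
  have hlog2 : 0 < Real.log 2 := Real.log_pos (by norm_num)
  have ha0 : 0 ≤ a := mul_nonneg (by positivity) (Real.log_nonneg (by norm_num))
  set c : ℝ := ε * Real.log 2 / 2 with hc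
  have hc0 : 0 < c := by positivity
  refine ⟨2 * Real.exp (a + a ^ 2 / c), ?_, ?_⟩
  · have : 1 ≤ Real.exp (a + a ^ 2 / c) := Real.one_le_exp (by positivity)
    linarith
  intro i k hik
  have h1 : (S.D k (k + 1) : ℝ) ≤ Real.exp (a + a ^ 2 / c) * (S.D 0 k : ℝ) ^ ε := by
    have hD := S.one_le_D 0 k
    have h2 : (S.D k (k + 1) : ℝ) ≤ Real.exp (a * (k + 1)) := by
      refine (S.D_succ_le k).trans (le_of_eq ?_)
      rw [ha, show (S.m : ℝ) * Real.log 100 * (k + 1) = ((S.m * (k + 1) : ℕ) : ℝ) * Real.log 100 by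
        push_cast; ring, Real.exp_nat_mul, Real.exp_log (by norm_num)]
    have h3 : Real.exp (c * k ^ 2) ≤ (S.D 0 k : ℝ) ^ ε := by
      have h4 : Real.log 2 * (k * k) ≤ 2 * Real.log (S.D 0 k) := by
        have := Real.log_le_log (by positivity) (S.two_pow_le_D k)
        rw [Real.log_pow, Real.log_pow] at this
        push_cast at this
        linarith
      rw [Real.rpow_def_of_pos (by linarith), Real.exp_le_exp, hc]
      nlinarith
    refine h2.trans ?_
    calc Real.exp (a * (k + 1)) ≤ Real.exp ((a + a ^ 2 / c) + c * k ^ 2) := by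
          rw [Real.exp_le_exp]
          have : a * k ≤ a ^ 2 / c + c * k ^ 2 := by
            rw [div_add' _ _ _ hc0.ne', le_div_iff₀ hc0]
            nlinarith [sq_nonneg (a - c * k), sq_nonneg (a + c * k), sq_nonneg (c * k), sq_nonneg a]
          linarith
      _ = Real.exp (a + a ^ 2 / c) * Real.exp (c * k ^ 2) := Real.exp_add _ _
      _ ≤ _ := by gcongr
  have h0 := S.one_le_D i k
  calc (S.D i (k + 1) : ℝ) ≤ 2 * (S.D i k * S.D k (k + 1)) := S.D_le_mul hik (Nat.le_succ k)
    _ ≤ 2 * (S.D i k * (Real.exp (a + a ^ 2 / c) * (S.D 0 k : ℝ) ^ ε)) := by gcongr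
    _ = _ := by ring

lemma exists_scale (i : ℕ) {T : ℝ} (hT : 1 ≤ T) :
    ∃ k, i ≤ k ∧ (S.D i k : ℝ) ≤ T ∧ T < S.D i (k + 1) := by
  have hex : ∃ n, T < S.D i (i + n) := by
    have hlb : ∀ n, (2 : ℝ) ^ n ≤ S.D i (i + n) := by
      intro n
      induction n with
      | zero => simp [D_self]
      | succ n ih =>
        have h1 := S.mul_D_le (Nat.le_add_right i n) (Nat.le_succ (i + n))
        have h2 : (2 : ℝ) ≤ S.D (i + n) (i + n + 1) := by
          obtain ⟨x, hx, e⟩ := S.exists_eq_D' (i + n) (i + n + 1)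
          have h1 := le_d_of_mem_pow (S.U_subset _ _ hx)
          rw [len_one] at h1
          rw [← e]
          have h3 : (2 : ℤ) ^ 1 ≤ 2 ^ (S.m * (i + n + 1)) := by
            apply pow_le_pow_right₀ (by norm_num)
            have := S.m_pos
            nlinarith
          exact_mod_cast (by linarith : (2 : ℤ) ≤ x 1 1)
        calc (2 : ℝ) ^ (n + 1) = 2 ^ n * 2 := pow_succ _ _
          _ ≤ S.D i (i + n) * S.D (i + n) (i + n + 1) := by gcongr
          _ ≤ _ := h1
    obtain ⟨n, hn⟩ := pow_unbounded_of_one_lt T (by norm_num : (1 : ℝ) < 2)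
    exact ⟨n, hn.trans_le (hlb n)⟩
  classical
  have hpos : Nat.find hex ≠ 0 := by
    intro h0
    have := Nat.find_spec hex
    rw [h0] at this
    simp [D_self] at this
    linarith
  obtain ⟨n, hn⟩ := Nat.exists_eq_succ_of_ne_zero hpos
  refine ⟨i + n, Nat.le_add_right _ _, ?_, ?_⟩
  · exact not_lt.1 (Nat.find_min hex (by omega : n < Nat.find hex))
  · have := Nat.find_spec hex
    rw [hn] at this
    exact this

lemma D_mono {i j k : ℕ} (h : i ≤ j) (h' : j ≤ k) : (S.D i j : ℝ) ≤ S.D i k := by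
  have := S.mul_D_le h h'
  have := S.one_le_D j k
  have := S.one_le_D i j
  nlinarith

end Blocks

/-- The additive character `x ↦ exp(2πix)`. -/
noncomputable def ex (x : ℝ) : ℂ := Complex.exp (2 * Real.pi * x * Complex.I)

lemma ex_add (x y : ℝ) : ex (x + y) = ex x * ex y := by
  rw [ex, ex, ex, ← Complex.exp_add]; push_cast; ring_nf

lemma ex_zero : ex 0 = 1 := by simp [ex]

lemma norm_ex (x : ℝ) : ‖ex x‖ = 1 := by
  rw [ex, show 2 * (Real.pi : ℂ) * x * Complex.I = ((2 * Real.pi * x : ℝ) : ℂ) * Complex.I by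
    push_cast; ring, Complex.norm_exp_ofReal_mul_I]

lemma conj_ex (x : ℝ) : (starRingEnd ℂ) (ex x) = ex (-x) := by
  rw [ex, ex, ← Complex.exp_conj]; simp [Complex.conj_ofNat]

lemma ex_eq_one_iff (x : ℝ) : ex x = 1 ↔ ∃ n : ℤ, x = n := by
  rw [ex, Complex.exp_eq_one_iff]
  have h0 : (2 * Real.pi * Complex.I : ℂ) ≠ 0 := by simp [Real.pi_ne_zero]
  constructor
  · rintro ⟨n, hn⟩
    refine ⟨n, ?_⟩
    have : (2 * Real.pi * Complex.I : ℂ) * x = (2 * Real.pi * Complex.I) * n := by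
      linear_combination hn
    exact_mod_cast mul_left_cancel₀ h0 this
  · rintro ⟨n, rfl⟩
    exact ⟨n, by push_cast; ring⟩

lemma ex_int (n : ℤ) : ex n = 1 := (ex_eq_one_iff n).2 ⟨n, rfl⟩

lemma ex_nat_mul (n : ℕ) (x : ℝ) : ex (n * x) = ex x ^ n := by
  rw [ex, ex, ← Complex.exp_nat_mul]; push_cast; ring_nf

lemma sum_ex {L : ℕ} (hL : 0 < L) (n : ℤ) :
    ∑ x ∈ Finset.range L, ex (x * n / L) = if (L : ℤ) ∣ n then (L : ℂ) else 0 := by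
  have hL' : (L : ℝ) ≠ 0 := by positivity
  have h1 : ∀ x : ℕ, ex (x * n / L) = ex (n / L) ^ x := fun x => by
    rw [← ex_nat_mul]; ring_nf
  simp_rw [h1]
  split_ifs with h
  · obtain ⟨k, rfl⟩ := h
    have : ((L * k : ℤ) : ℝ) / L = (k : ℤ) := by push_cast; field_simp
    rw [this, ex_int]; simp
  · have hne : ex (n / L) ≠ 1 := by
      rw [Ne, ex_eq_one_iff]
      rintro ⟨k, hk⟩
      rw [div_eq_iff hL'] at hk
      exact h ⟨k, by rw [mul_comm]; exact_mod_cast hk⟩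
    rw [geom_sum_eq hne, ← ex_nat_mul, mul_div_cancel₀ _ hL', ex_int]; simp

/-- `s` is within `L / (6 * m)` of a multiple of `L`. -/
def Near (L m : ℕ) (s : ℤ) : Prop := ∃ r z : ℤ, s = r + L * z ∧ |r| * (6 * m) < L

/-- The average of the first `n` powers of `ex (x / L)`. -/
noncomputable def expAvg (L n : ℕ) (x : ℝ) : ℂ := (1 / n : ℂ) * ∑ k ∈ Finset.range n, ex (k * x / L)

lemma half_le_norm_expAvg {L n m : ℕ} (hn : 0 < n) (h : 6 * m * n ≤ L) {x : ℕ} (hx : x ≤ m) :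
    1 / 2 ≤ ‖expAvg L n x‖ := by
  have hre : ∀ k ∈ Finset.range n, (1 / 2 : ℝ) ≤ (ex (k * x / L)).re := by
    intro k hk
    have hk' : k < n := Finset.mem_range.1 hk
    have e : (ex (k * x / L)).re = Real.cos (2 * Real.pi * (k * x / L)) := by
      rw [ex, show 2 * (Real.pi : ℂ) * ((k * x / L : ℝ) : ℂ) * Complex.I
        = ((2 * Real.pi * (k * x / L) : ℝ) : ℂ) * Complex.I by push_cast; ring,
        Complex.exp_ofReal_mul_I_re]
    rw [e, ← Real.cos_pi_div_three]
    have hkx : 6 * (k * x) ≤ L := by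
      calc 6 * (k * x) ≤ 6 * (n * m) := by gcongr
        _ = 6 * m * n := by ring
        _ ≤ L := h
    have hkx' : (6 : ℝ) * (k * x) ≤ L := by exact_mod_cast hkx
    have hq : (k * x : ℝ) / L ≤ 1 / 6 := by
      rcases Nat.eq_zero_or_pos L with rfl | hL
      · simp
      · rw [div_le_div_iff₀ (by positivity) (by norm_num)]; linarith
    have hq0 : (0 : ℝ) ≤ k * x / L := by positivity
    have hpi := Real.pi_pos
    apply Real.cos_le_cos_of_nonneg_of_le_pi (by positivity) (by linarith)
    nlinarith
  have hn' : (0 : ℝ) < n := by positivity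
  have h1 : (1 / 2 : ℝ) ≤ (expAvg L n x).re := by
    rw [expAvg, show (1 / n : ℂ) = ((1 / n : ℝ) : ℂ) by push_cast; rfl, Complex.re_ofReal_mul,
      Complex.re_sum]
    have := Finset.card_nsmul_le_sum _ _ _ hre
    rw [Finset.card_range, nsmul_eq_mul] at this
    calc (1 / 2 : ℝ) = 1 / n * (n * (1 / 2)) := by field_simp
      _ ≤ _ := by gcongr
  exact h1.trans (Complex.re_le_norm _)

lemma sum_expAvg {L n m : ℕ} (hn : 0 < n) (hnL : n ≤ L) (h : 6 * m * n ≤ L) (s : ℤ) :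
    ‖∑ x ∈ Finset.range L, ((‖expAvg L n x‖ ^ 2 : ℝ) : ℂ) * ex (x * s / L)‖ ≤
      L / n * (open Classical in if Near L m s then 1 else 0) := by
  classical
  have hL : 0 < L := by omega
  have e1 : ∀ x : ℕ, ((‖expAvg L n x‖ ^ 2 : ℝ) : ℂ) = (1 / n : ℂ) ^ 2 *
      ∑ k ∈ Finset.range n, ∑ k' ∈ Finset.range n, ex (x * ((k - k' : ℤ) : ℝ) / L) := by
    intro x
    push_cast
    rw [← Complex.mul_conj', expAvg, map_mul, map_sum, mul_mul_mul_comm, Finset.sum_mul_sum]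
    congr 1
    · simp [sq]
    · refine Finset.sum_congr rfl fun k _ => Finset.sum_congr rfl fun k' _ => ?_
      rw [conj_ex, ← ex_add]
      congr 1
      ring
  have e2 : ∑ x ∈ Finset.range L, ((‖expAvg L n x‖ ^ 2 : ℝ) : ℂ) * ex (x * s / L) =
      (1 / n : ℂ) ^ 2 * ∑ k ∈ Finset.range n, ∑ k' ∈ Finset.range n,
        if (L : ℤ) ∣ (k - k' + s) then (L : ℂ) else 0 := by
    simp_rw [e1, mul_assoc, ← Finset.mul_sum, Finset.sum_mul]
    congr 1
    rw [Finset.sum_comm]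
    refine Finset.sum_congr rfl fun k _ => ?_
    rw [Finset.sum_comm]
    refine Finset.sum_congr rfl fun k' _ => ?_
    rw [← sum_ex hL]
    refine Finset.sum_congr rfl fun x _ => ?_
    rw [← ex_add]
    congr 1
    push_cast
    ring
  rw [e2, norm_mul]
  have hnn : ‖(1 / n : ℂ) ^ 2‖ = 1 / (n : ℝ) ^ 2 := by simp
  rw [hnn]
  split_ifs with hs
  · have hin : ∀ k ∈ Finset.range n, ‖∑ k' ∈ Finset.range n,
        if (L : ℤ) ∣ (k - k' + s) then (L : ℂ) else 0‖ ≤ L := by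
      intro k _
      rw [← Finset.sum_filter, Finset.sum_const, nsmul_eq_mul, norm_mul]
      have hc : (Finset.filter (fun k' : ℕ => (L : ℤ) ∣ (k - k' + s)) (Finset.range n)).card ≤ 1 := by
        rw [Finset.card_le_one]
        intro a ha b hb
        rw [Finset.mem_filter, Finset.mem_range] at ha hb
        have hd : (L : ℤ) ∣ (a - b : ℤ) := by
          have := dvd_sub hb.2 ha.2
          ring_nf at this ⊢
          exact this
        have := Int.eq_zero_of_abs_lt_dvd hd (by rw [abs_lt]; omega)
        omega
      have hc' : ((Finset.filter (fun k' : ℕ => (L : ℤ) ∣ (k - k' + s)) (Finset.range n)).card : ℝ)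
          ≤ 1 := by exact_mod_cast hc
      simp only [Complex.norm_natCast]
      nlinarith [(Nat.cast_nonneg L : (0 : ℝ) ≤ L)]
    have := norm_sum_le_of_le _ hin
    rw [Finset.sum_const, Finset.card_range, nsmul_eq_mul] at this
    calc _ ≤ 1 / (n : ℝ) ^ 2 * (n * L) := by gcongr
      _ = _ := by field_simp
  · rw [Finset.sum_eq_zero, norm_zero, mul_zero, mul_zero]
    intro k hk
    refine Finset.sum_eq_zero fun k' hk' => ?_
    rw [if_neg]
    rintro ⟨z, hz⟩
    apply hs
    rw [Finset.mem_range] at hk hk'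
    refine ⟨k' - k, z, by linarith, ?_⟩
    have h1 : |(k' : ℤ) - k| ≤ n - 1 := by rw [abs_le]; omega
    have h2 : (6 * m * n : ℤ) ≤ L := by exact_mod_cast h
    have h3 : |(k' : ℤ) - k| * (6 * m) ≤ (n - 1) * (6 * m) := by gcongr
    rcases Nat.eq_zero_or_pos m with rfl | hm
    · simp; omega
    · have : (0 : ℤ) < m := by exact_mod_cast hm
      nlinarith

lemma Near.neg {L m : ℕ} {s : ℤ} (h : Near L m s) : Near L m (-s) := by
  obtain ⟨r, z, h1, h2⟩ := h
  exact ⟨-r, -z, by rw [h1]; ring, by rwa [abs_neg]⟩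

lemma sum_norm_sq_le {τ : Type*} (T : Finset τ) (a : τ → ℂ) (w₀ w₁ : τ → ℤ) (U : Finset (ℕ × ℕ))
    {m L : ℕ} (hm : 0 < m) (hL : 6 * m ≤ L) (hU : ∀ u ∈ U, u.1 ≤ m ∧ u.2 ≤ m) {M : ℝ}
    (hM : ∀ x ∈ T, (({y ∈ T | Near L m (w₀ x - w₀ y) ∧ Near L m (w₁ x - w₁ y)} : Set τ).ncard : ℝ)
      ≤ M) :
    ∑ u ∈ U, ‖∑ x ∈ T, a x * ex ((u.1 * w₀ x + u.2 * w₁ x) / L)‖ ^ 2 ≤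
      2304 * m ^ 2 * M * ∑ x ∈ T, ‖a x‖ ^ 2 := by
  classical
  set n := L / (6 * m) with hn_def
  have hn : 0 < n := Nat.div_pos hL (by positivity)
  have hnm : 6 * m * n ≤ L := Nat.mul_div_le L (6 * m)
  have hnL : n ≤ L := Nat.div_le_self _ _
  have hL0 : 0 < L := by omega
  have hLn : (L : ℝ) / n ≤ 12 * m := by
    rw [div_le_iff₀ (by positivity)]
    have h1 : L < 6 * m * (n + 1) := by
      have := Nat.lt_div_mul_add (a := L) (b := 6 * m) (by positivity)
      rw [← hn_def] at this
      linarith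
    have h2 : L ≤ 12 * m * n := by nlinarith
    exact_mod_cast h2
  set f : ℕ → ℝ := fun x => ‖expAvg L n x‖ ^ 2 with hf
  have hf0 : ∀ x, 0 ≤ f x := fun x => by positivity
  have hf1 : ∀ x ≤ m, 1 / 4 ≤ f x := fun x hx => by
    have := half_le_norm_expAvg hn hnm hx
    simp only [hf]; nlinarith
  set A : ℕ × ℕ → ℂ := fun u => ∑ x ∈ T, a x * ex ((u.1 * w₀ x + u.2 * w₁ x) / L) with hA
  have step1 : ∑ u ∈ U, ‖A u‖ ^ 2 ≤
      16 * ∑ u ∈ Finset.range L ×ˢ Finset.range L, f u.1 * f u.2 * ‖A u‖ ^ 2 := by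
    rw [Finset.mul_sum]
    have hsub : U ⊆ Finset.range L ×ˢ Finset.range L := by
      intro u hu
      have := hU u hu
      rw [Finset.mem_product, Finset.mem_range, Finset.mem_range]
      omega
    refine (Finset.sum_le_sum fun u hu => ?_).trans
      (Finset.sum_le_sum_of_subset_of_nonneg hsub fun u _ _ => ?_)
    · have h1 := hf1 _ (hU u hu).1
      have h2 := hf1 _ (hU u hu).2
      have h3 : 1 / 16 ≤ f u.1 * f u.2 := by nlinarith
      nlinarith [sq_nonneg ‖A u‖]
    · have := hf0 u.1
      have := hf0 u.2
      positivity
  set R : τ → τ → Prop := fun x y => Near L m (w₀ x - w₀ y) ∧ Near L m (w₁ x - w₁ y) with hR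
  have key : ((∑ u ∈ Finset.range L ×ˢ Finset.range L, f u.1 * f u.2 * ‖A u‖ ^ 2 : ℝ) : ℂ) =
      ∑ x ∈ T, ∑ y ∈ T, a x * (starRingEnd ℂ) (a y) *
        ((∑ i ∈ Finset.range L, (f i : ℂ) * ex (i * (w₀ x - w₀ y : ℤ) / L)) *
          ∑ i ∈ Finset.range L, (f i : ℂ) * ex (i * (w₁ x - w₁ y : ℤ) / L)) := by
    push_cast
    have : ∀ u : ℕ × ℕ, (f u.1 : ℂ) * f u.2 * (‖A u‖ : ℂ) ^ 2 = ∑ x ∈ T, ∑ y ∈ T,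
        a x * (starRingEnd ℂ) (a y) * (((f u.1 : ℂ) * ex (u.1 * (w₀ x - w₀ y : ℤ) / L)) *
          ((f u.2 : ℂ) * ex (u.2 * (w₁ x - w₁ y : ℤ) / L))) := by
      intro u
      rw [← Complex.mul_conj', hA]
      simp only []
      rw [map_sum, Finset.sum_mul_sum, Finset.mul_sum]
      refine Finset.sum_congr rfl fun x _ => ?_
      rw [Finset.mul_sum]
      refine Finset.sum_congr rfl fun y _ => ?_
      rw [map_mul, conj_ex]
      have e : ex ((u.1 * w₀ x + u.2 * w₁ x) / L) * ex (-((u.1 * w₀ y + u.2 * w₁ y) / L)) =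
          ex (u.1 * (w₀ x - w₀ y : ℤ) / L) * ex (u.2 * (w₁ x - w₁ y : ℤ) / L) := by
        rw [← ex_add, ← ex_add]; congr 1; push_cast; ring
      linear_combination (f u.1 : ℂ) * f u.2 * a x * (starRingEnd ℂ) (a y) * e
    simp_rw [this]
    rw [Finset.sum_comm]
    refine Finset.sum_congr rfl fun x _ => ?_
    rw [Finset.sum_comm]
    refine Finset.sum_congr rfl fun y _ => ?_
    rw [← Finset.mul_sum, Finset.sum_mul_sum, Finset.sum_product]
    push_cast
    rfl
  have step2 : ∑ u ∈ Finset.range L ×ˢ Finset.range L, f u.1 * f u.2 * ‖A u‖ ^ 2 ≤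
      ∑ x ∈ T, ∑ y ∈ T, (12 * m) ^ 2 * (‖a x‖ * ‖a y‖ * if R x y then 1 else 0) := by
    have h0 : 0 ≤ ∑ u ∈ Finset.range L ×ˢ Finset.range L, f u.1 * f u.2 * ‖A u‖ ^ 2 :=
      Finset.sum_nonneg fun u _ => by
        have := hf0 u.1
        have := hf0 u.2
        positivity
    rw [← Real.norm_of_nonneg h0, ← Complex.norm_real, key]
    refine norm_sum_le_of_le _ fun x _ => norm_sum_le_of_le _ fun y _ => ?_
    rw [norm_mul, norm_mul, norm_mul, RCLike.norm_conj]
    have h1 := sum_expAvg hn hnL hnm (w₀ x - w₀ y)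
    have h2 := sum_expAvg hn hnL hnm (w₁ x - w₁ y)
    have h3 := mul_le_mul h1 h2 (norm_nonneg _) (by positivity)
    have h4 : (L / n * if Near L m (w₀ x - w₀ y) then (1 : ℝ) else 0) *
        (L / n * if Near L m (w₁ x - w₁ y) then (1 : ℝ) else 0) ≤
        (12 * m) ^ 2 * if R x y then 1 else 0 := by
      by_cases hr : R x y
      · rw [if_pos hr, if_pos hr.1, if_pos hr.2, mul_one, mul_one, sq]
        gcongr
      · rw [if_neg hr]
        simp only [hR, not_and_or] at hr
        rcases hr with h | h <;> simp [h]
    calc _ ≤ ‖a x‖ * ‖a y‖ * ((12 * m) ^ 2 * if R x y then 1 else 0) := by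
          exact mul_le_mul_of_nonneg_left (h3.trans h4) (by positivity)
      _ = _ := by ring
  have hRs : ∀ x y, R x y → R y x := fun x y h =>
    ⟨by simpa using h.1.neg, by simpa using h.2.neg⟩
  have hrow : ∀ x ∈ T, ∑ y ∈ T, (if R x y then (1 : ℝ) else 0) ≤ M := by
    intro x hx
    have := hM x hx
    rw [← Finset.sum_filter, Finset.sum_const, nsmul_eq_mul, mul_one]
    rw [← Set.ncard_coe_finset]
    simpa [hR] using this
  have step3 : ∑ x ∈ T, ∑ y ∈ T, (‖a x‖ * ‖a y‖ * if R x y then (1 : ℝ) else 0) ≤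
      M * ∑ x ∈ T, ‖a x‖ ^ 2 := by
    have h1 : ∀ x y, (‖a x‖ * ‖a y‖ * if R x y then (1 : ℝ) else 0) ≤
        1 / 2 * (‖a x‖ ^ 2 * (if R x y then (1 : ℝ) else 0)) +
        1 / 2 * (‖a y‖ ^ 2 * (if R y x then (1 : ℝ) else 0)) := by
      intro x y
      by_cases hr : R x y
      · rw [if_pos hr, if_pos (hRs _ _ hr)]
        nlinarith [sq_nonneg (‖a x‖ - ‖a y‖)]
      · rw [if_neg hr, if_neg fun h => hr (hRs _ _ h)]
        simp
    have h2 : ∑ x ∈ T, ∑ y ∈ T, ‖a x‖ ^ 2 * (if R x y then (1 : ℝ) else 0) ≤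
        M * ∑ x ∈ T, ‖a x‖ ^ 2 := by
      rw [Finset.mul_sum]
      refine Finset.sum_le_sum fun x hx => ?_
      rw [← Finset.mul_sum]
      nlinarith [hrow x hx, sq_nonneg ‖a x‖]
    have h3 : ∑ x ∈ T, ∑ y ∈ T, (‖a x‖ * ‖a y‖ * if R x y then (1 : ℝ) else 0) ≤
        ∑ x ∈ T, ∑ y ∈ T, (1 / 2 * (‖a x‖ ^ 2 * (if R x y then (1 : ℝ) else 0)) +
        1 / 2 * (‖a y‖ ^ 2 * (if R y x then (1 : ℝ) else 0))) :=
      Finset.sum_le_sum fun x _ => Finset.sum_le_sum fun y _ => h1 x y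
    refine h3.trans ?_
    simp only [Finset.sum_add_distrib]
    rw [Finset.sum_comm (f := fun x y => 1 / 2 * (‖a y‖ ^ 2 * if R y x then (1 : ℝ) else 0))]
    simp only [← Finset.mul_sum] at h2 ⊢
    linarith
  calc _ ≤ _ := step1
    _ ≤ 16 * ∑ x ∈ T, ∑ y ∈ T, (12 * m) ^ 2 * (‖a x‖ * ‖a y‖ * if R x y then (1 : ℝ) else 0) := by
        gcongr
    _ ≤ 16 * ((12 * m) ^ 2 * (M * ∑ x ∈ T, ‖a x‖ ^ 2)) := by
        simp_rw [← Finset.mul_sum]; gcongr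
    _ = _ := by ring

/-- Bilinear bound: the mean square over `P` of `∑ u v, ex (t (u · v) / L)`. -/
lemma bilinear_bound {ν : Type*} (P : Finset ℕ) (V : Finset ν) (v₀ v₁ : ν → ℤ)
    (U : Finset (ℕ × ℕ)) {m L : ℕ} (hm : 0 < m) (hL : 6 * m ≤ L)
    (hU : ∀ u ∈ U, u.1 ≤ m ∧ u.2 ≤ m) {M : ℝ} (hM0 : 0 ≤ M)
    (hM : ∀ t ∈ P, ∀ v ∈ V, ∀ A : Finset (ℕ × ν), (∀ y ∈ A, y.1 ∈ P ∧ y.2 ∈ V ∧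
      Near L m (t * v₀ v - y.1 * v₀ y.2) ∧ Near L m (t * v₁ v - y.1 * v₁ y.2)) → (A.card : ℝ) ≤ M) :
    ∑ t ∈ P, ‖∑ u ∈ U, ∑ v ∈ V, ex (t * (u.1 * v₀ v + u.2 * v₁ v) / L)‖ ^ 2 ≤
      2304 * m ^ 2 * M * U.card * V.card := by
  classical
  set A : ℕ → ℂ := fun t => ∑ u ∈ U, ∑ v ∈ V, ex (t * (u.1 * v₀ v + u.2 * v₁ v) / L) with hA
  set Z : ℝ := ∑ t ∈ P, ‖A t‖ ^ 2 with hZ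
  have hZ0 : 0 ≤ Z := Finset.sum_nonneg fun _ _ => by positivity
  set B : ℕ × ℕ → ℂ := fun u => ∑ x ∈ P ×ˢ V, (starRingEnd ℂ) (A x.1) *
    ex ((u.1 * ((x.1 * v₀ x.2 : ℤ) : ℝ) + u.2 * ((x.1 * v₁ x.2 : ℤ) : ℝ)) / L) with hB
  have h1 : ∑ u ∈ U, ‖B u‖ ^ 2 ≤ 2304 * m ^ 2 * M *
      ∑ x ∈ P ×ˢ V, ‖(starRingEnd ℂ) (A x.1)‖ ^ 2 := by
    apply sum_norm_sq_le (P ×ˢ V) (fun x => (starRingEnd ℂ) (A x.1))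
      (fun x => (x.1 * v₀ x.2 : ℤ)) (fun x => (x.1 * v₁ x.2 : ℤ)) U hm hL hU
    intro x hx
    rw [Finset.mem_product] at hx
    have hfin : {y | y ∈ P ×ˢ V ∧ Near L m (x.1 * v₀ x.2 - y.1 * v₀ y.2) ∧
        Near L m (x.1 * v₁ x.2 - y.1 * v₁ y.2)}.Finite :=
      (P ×ˢ V).finite_toSet.subset fun y hy => hy.1
    rw [Set.ncard_eq_toFinset_card _ hfin]
    refine hM x.1 hx.1 x.2 hx.2 _ fun y hy => ?_
    rw [Set.Finite.mem_toFinset] at hy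
    have h := Finset.mem_product.1 hy.1
    exact ⟨h.1, h.2, hy.2⟩
  have h2 : ∑ x ∈ P ×ˢ V, ‖(starRingEnd ℂ) (A x.1)‖ ^ 2 = V.card * Z := by
    rw [Finset.sum_product]
    simp only [RCLike.norm_conj, Finset.sum_const, nsmul_eq_mul]
    rw [← Finset.mul_sum]
  have h3 : (Z : ℂ) = ∑ u ∈ U, B u := by
    rw [hZ]
    push_cast
    simp_rw [← Complex.mul_conj', hB]
    rw [Finset.sum_comm, Finset.sum_product]
    refine Finset.sum_congr rfl fun t _ => ?_
    rw [mul_comm, ← Finset.sum_comm, Finset.mul_sum]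
    simp_rw [← Finset.mul_sum]
    congr 1
    refine Finset.sum_congr rfl fun u _ => Finset.sum_congr rfl fun v _ => ?_
    congr 1
    push_cast
    ring
  have h4 : Z ≤ ∑ u ∈ U, ‖B u‖ := by
    rw [← Real.norm_of_nonneg hZ0, ← Complex.norm_real, h3]
    exact norm_sum_le _ _
  have h5 : Z ^ 2 ≤ U.card * ∑ u ∈ U, ‖B u‖ ^ 2 :=
    (pow_le_pow_left₀ hZ0 h4 2).trans sq_sum_le_card_mul_sum_sq
  rw [h2] at h1
  have h6 : Z ^ 2 ≤ U.card * (2304 * m ^ 2 * M * (V.card * Z)) := h5.trans (by gcongr)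
  rcases hZ0.eq_or_lt with h | h
  · rw [← h]; positivity
  · have : Z * Z ≤ (2304 * m ^ 2 * M * U.card * V.card) * Z := by nlinarith
    exact le_of_mul_le_mul_right this h

/-- Integers in `[0, L)` which are pairwise close modulo `L` are few. -/
lemma card_close_mod {L : ℕ} (T : Finset ℕ) (hT : ∀ t ∈ T, t < L) {κ : ℝ} (hκ : 0 ≤ κ)
    (h : ∀ t ∈ T, ∀ t' ∈ T, ∃ k : ℤ, |(t : ℝ) - t' - k * L| ≤ κ) : (T.card : ℝ) ≤ 2 * κ + 1 := by
  classical
  rcases T.eq_empty_or_nonempty with rfl | ⟨t₀, ht₀⟩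
  · simp; linarith
  have hsub : T.image (fun t : ℕ => (t : ℤ)) ⊆
      (Finset.Icc (-⌊κ⌋) ⌊κ⌋).image (fun r => (t₀ + r) % (L : ℤ)) := by
    intro s hs
    obtain ⟨t, ht, rfl⟩ := Finset.mem_image.1 hs
    obtain ⟨k, hk⟩ := h t ht t₀ ht₀
    have hk' : (((|(t : ℤ) - t₀ - k * L| : ℤ)) : ℝ) ≤ κ := by push_cast; exact hk
    have := abs_le.1 (Int.le_floor.2 hk')
    refine Finset.mem_image.2 ⟨(t : ℤ) - t₀ - k * L, Finset.mem_Icc.2 this, ?_⟩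
    have e : (t₀ : ℤ) + (t - t₀ - k * L) = t + L * (-k) := by ring
    rw [e, Int.add_mul_emod_self_left]
    exact Int.emod_eq_of_lt (by positivity) (by exact_mod_cast hT t ht)
  have h1 := (Finset.card_le_card hsub).trans Finset.card_image_le
  rw [Finset.card_image_of_injective _ Nat.cast_injective, Int.card_Icc] at h1
  have h2 : (0 : ℤ) ≤ ⌊κ⌋ := Int.floor_nonneg.2 hκ
  have h3 : (T.card : ℤ) ≤ 2 * ⌊κ⌋ + 1 := by omega
  have h4 : (T.card : ℝ) ≤ 2 * (⌊κ⌋ : ℝ) + 1 := by exact_mod_cast h3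
  linarith [Int.floor_le κ]

lemma card_spaced {α : Type*} (G : Finset α) (f : α → ℝ) {δ ρ c : ℝ} (hδ : 0 < δ) (hρ : 0 ≤ ρ)
    (hs : ∀ x ∈ G, ∀ y ∈ G, x ≠ y → δ ≤ |f x - f y|) (hc : ∀ x ∈ G, |f x - c| ≤ ρ * δ) :
    (G.card : ℝ) ≤ 2 * ρ + 2 := by
  classical
  have hinj : Set.InjOn (fun x => ⌊f x / δ⌋) (G : Set α) := by
    intro x hx y hy hxy
    by_contra hne
    have h1 := hs x hx y hy hne
    have h2 : |f x / δ - f y / δ| < 1 := Int.abs_sub_lt_one_of_floor_eq_floor hxy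
    rw [← sub_div, abs_div, abs_of_pos hδ, div_lt_one hδ] at h2
    linarith
  have hsub : G.image (fun x => ⌊f x / δ⌋) ⊆ Finset.Icc ⌊c / δ - ρ⌋ ⌊c / δ + ρ⌋ := by
    intro z hz
    obtain ⟨x, hx, rfl⟩ := Finset.mem_image.1 hz
    have h1 := abs_le.1 (hc x hx)
    refine Finset.mem_Icc.2 ⟨Int.floor_le_floor ?_, Int.floor_le_floor ?_⟩
    · rw [le_div_iff₀ hδ, sub_mul, div_mul_cancel₀ _ hδ.ne']; linarith
    · rw [div_le_iff₀ hδ, add_mul, div_mul_cancel₀ _ hδ.ne']; linarith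
  have h1 := Finset.card_le_card hsub
  rw [Finset.card_image_of_injOn hinj, Int.card_Icc] at h1
  have h2 : ⌊c / δ - ρ⌋ ≤ ⌊c / δ + ρ⌋ := Int.floor_le_floor (by linarith)
  have h3 : (G.card : ℤ) ≤ ⌊c / δ + ρ⌋ + 1 - ⌊c / δ - ρ⌋ := by omega
  have h4 : (G.card : ℝ) ≤ ⌊c / δ + ρ⌋ + 1 - ⌊c / δ - ρ⌋ := by exact_mod_cast h3
  linarith [Int.floor_le (c / δ + ρ), Int.lt_floor_add_one (c / δ - ρ)]

/-- `t / L` has an approximation `a / q` with `q ∈ [Q, 2 * Q)` and error about `K / L`. -/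
def InClass (L : ℕ) (K Q : ℝ) (t : ℕ) (a q : ℤ) : Prop :=
  IsCoprime a q ∧ Q ≤ q ∧ q < 2 * Q ∧ |(q * t - a * L : ℝ)| ≤ 2 * K * q ∧
    (K = 1 ∨ K * q ≤ |(q * t - a * L : ℝ)|)

lemma bracket_eq_zero {L : ℕ} {m K Q κ : ℝ} {t t' : ℕ} {a q a' q' v v' V V' r z : ℤ}
    (hL : 0 < L) (hm : 0 < m) (hK : 1 ≤ K) (hQ : 1 ≤ Q) (hκ : 1 ≤ κ)
    (hmKQ : 20 * κ * K * Q ^ 2 ≤ m) (hq1 : Q ≤ q) (hq2 : q < 2 * Q) (hq1' : Q ≤ q')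
    (hq2' : q' < 2 * Q) (hB : |(q * t - a * L : ℝ)| ≤ 2 * K * q)
    (hB' : |(q' * t' - a' * L : ℝ)| ≤ 2 * K * q')
    (hv : 0 ≤ v) (hv' : 0 ≤ v') (hvV : v ≤ V) (hvV' : v' ≤ V')
    (hb : m * V ≤ κ * L) (hb' : m * V' ≤ κ * L)
    (e : t * v - t' * v' = r + L * z) (hr : |(r : ℝ)| * (6 * m) < L) :
    q' * a * v - q * a' * v' - q * q' * z = 0 := by
  have hLr : (0 : ℝ) < L := by exact_mod_cast hL
  have hq : (0 : ℝ) < q := by linarith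
  have hq' : (0 : ℝ) < q' := by linarith
  have hvr : (v : ℝ) ≤ V := by exact_mod_cast hvV
  have hvr' : (v' : ℝ) ≤ V' := by exact_mod_cast hvV'
  have hv0 : (0 : ℝ) ≤ v := by exact_mod_cast hv
  have hv0' : (0 : ℝ) ≤ v' := by exact_mod_cast hv'
  have eR : (t : ℝ) * v - t' * v' = r + L * z := by exact_mod_cast e
  set E : ℤ := q' * a * v - q * a' * v' - q * q' * z with hE
  have hid : (L : ℝ) * E = q * q' * r - q' * v * (q * t - a * L) + q * v' * (q' * t' - a' * L) := by
    rw [hE]; push_cast; linear_combination ((q : ℝ) * q') * eR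
  have hbd : |(L : ℝ) * E| ≤ q * q' * (|(r : ℝ)| + 2 * K * V + 2 * K * V') := by
    rw [hid]
    calc _ ≤ |(q : ℝ) * q' * r| + |(q' : ℝ) * v * (q * t - a * L)| +
          |(q : ℝ) * v' * (q' * t' - a' * L)| :=
          (abs_add_le _ _).trans (add_le_add_left (abs_sub _ _) _)
      _ = q * q' * |(r : ℝ)| + q' * v * |(q * t - a * L : ℝ)| +
          q * v' * |(q' * t' - a' * L : ℝ)| := by
          rw [abs_mul, abs_mul (q' * v : ℝ), abs_mul (q * v' : ℝ), abs_of_pos (mul_pos hq hq'),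
            abs_of_nonneg (mul_nonneg hq'.le hv0), abs_of_nonneg (mul_nonneg hq.le hv0')]
      _ ≤ q * q' * |(r : ℝ)| + q' * V * (2 * K * q) + q * V' * (2 * K * q') := by
          have : (0 : ℝ) ≤ V := hv0.trans hvr
          have : (0 : ℝ) ≤ V' := hv0'.trans hvr'
          gcongr
      _ = _ := by ring
  have hlt : |(L : ℝ) * E| * m < L * m := by
    have hqq : (q : ℝ) * q' ≤ 4 * Q ^ 2 := by
      calc (q : ℝ) * q' ≤ (2 * Q) * (2 * Q) := by gcongr
        _ = _ := by ring
    have h6 : |(r : ℝ)| * m ≤ L / 6 := by linarith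
    have h7 : (|(r : ℝ)| + 2 * K * V + 2 * K * V') * m ≤ (1 / 6 + 4 * K * κ) * L := by
      calc (|(r : ℝ)| + 2 * K * V + 2 * K * V') * m =
            |(r : ℝ)| * m + 2 * K * (m * V) + 2 * K * (m * V') := by ring
        _ ≤ L / 6 + 2 * K * (κ * L) + 2 * K * (κ * L) := by gcongr
        _ = _ := by ring
    have h8 : (1 / 6 + 4 * K * κ) < 5 * (κ * K) := by nlinarith
    calc |(L : ℝ) * E| * m ≤ q * q' * (|(r : ℝ)| + 2 * K * V + 2 * K * V') * m := by gcongr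
      _ = q * q' * ((|(r : ℝ)| + 2 * K * V + 2 * K * V') * m) := by ring
      _ ≤ q * q' * ((1 / 6 + 4 * K * κ) * L) := by gcongr
      _ ≤ 4 * Q ^ 2 * ((1 / 6 + 4 * K * κ) * L) := by gcongr
      _ < 4 * Q ^ 2 * (5 * (κ * K) * L) := by gcongr
      _ = (20 * κ * K * Q ^ 2) * L := by ring
      _ ≤ m * L := by gcongr
      _ = L * m := by ring
  have h9 : |(L : ℝ) * E| < L := lt_of_mul_lt_mul_right hlt hm.le
  rw [abs_mul, abs_of_pos hLr] at h9
  have h10 : |(E : ℝ)| < 1 := by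
    by_contra hcon
    push Not at hcon
    nlinarith
  have h11 : |E| < 1 := by exact_mod_cast h10
  exact Int.abs_lt_one_iff.1 h11

/-- Two points of the same class which are close satisfy exact congruences. -/
lemma exact_of_near {L : ℕ} {m K Q κ : ℝ} {t t' : ℕ} {a q a' q' : ℤ} {v₀ v₁ v₀' v₁' : ℤ}
    {r₀ r₁ z₀ z₁ : ℤ} (hL : 0 < L) (hm : 0 < m) (hK : 1 ≤ K) (hQ : 1 ≤ Q) (hκ : 1 ≤ κ)
    (hmKQ : 20 * κ * K * Q ^ 2 ≤ m)
    (ht : InClass L K Q t a q) (ht' : InClass L K Q t' a' q')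
    (hv : IsCoprime v₀ v₁) (hv' : IsCoprime v₀' v₁')
    (h0 : 0 ≤ v₀) (h0' : 0 ≤ v₀') (h1 : v₀ ≤ v₁) (h1' : v₀' ≤ v₁')
    (hb : m * v₁ ≤ κ * L) (hb' : m * v₁' ≤ κ * L)
    (e₀ : t * v₀ - t' * v₀' = r₀ + L * z₀) (e₁ : t * v₁ - t' * v₁' = r₁ + L * z₁)
    (hr₀ : |(r₀ : ℝ)| * (6 * m) < L) (hr₁ : |(r₁ : ℝ)| * (6 * m) < L) :
    q = q' ∧ a * v₀ - a' * v₀' = q * z₀ ∧ a * v₁ - a' * v₁' = q * z₁ ∧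
      q * r₀ = (q * t - a * L) * v₀ - (q * t' - a' * L) * v₀' ∧
      q * r₁ = (q * t - a * L) * v₁ - (q * t' - a' * L) * v₁' := by
  obtain ⟨hc, hq1, hq2, hB, -⟩ := ht
  obtain ⟨hc', hq1', hq2', hB', -⟩ := ht'
  have hq : (0 : ℝ) < q := by linarith
  have hq' : (0 : ℝ) < q' := by linarith
  have k0 := bracket_eq_zero hL hm hK hQ hκ hmKQ hq1 hq2 hq1' hq2' hB hB' h0 h0' h1 h1' hb hb' e₀ hr₀
  have k1 := bracket_eq_zero hL hm hK hQ hκ hmKQ hq1 hq2 hq1' hq2' hB hB' (h0.trans h1)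
    (h0'.trans h1') le_rfl le_rfl hb hb' e₁ hr₁
  have hqz : (0 : ℤ) < q := by exact_mod_cast hq
  have hqz' : (0 : ℤ) < q' := by exact_mod_cast hq'
  have d1 : q ∣ q' := by
    obtain ⟨x, y, hxy⟩ := hv
    have hd : q ∣ q' * a := ⟨x * (a' * v₀' + q' * z₀) + y * (a' * v₁' + q' * z₁), by
      linear_combination (-(q' * a)) * hxy + x * k0 + y * k1⟩
    exact hc.symm.dvd_of_dvd_mul_right hd
  have d2 : q' ∣ q := by
    obtain ⟨x, y, hxy⟩ := hv'
    have hd : q' ∣ q * a' := ⟨x * (a * v₀ - q * z₀) + y * (a * v₁ - q * z₁), by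
      linear_combination (-(q * a')) * hxy - x * k0 - y * k1⟩
    exact hc'.symm.dvd_of_dvd_mul_right hd
  have hqq : q = q' := Int.dvd_antisymm hqz.le hqz'.le d1 d2
  subst hqq
  have f0 : a * v₀ - a' * v₀' = q * z₀ :=
    mul_left_cancel₀ hqz.ne' (by linear_combination k0)
  have f1 : a * v₁ - a' * v₁' = q * z₁ :=
    mul_left_cancel₀ hqz.ne' (by linear_combination k1)
  exact ⟨rfl, f0, f1, by linear_combination (-q) * e₀ + L * f0,
    by linear_combination (-q) * e₁ + L * f1⟩

lemma coprime_pair_eq {x₀ x₁ y₀ y₁ : ℤ} (hx : IsCoprime x₀ x₁) (hy : IsCoprime y₀ y₁)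
    (hx1 : 0 < x₁) (hy1 : 0 < y₁) (h : x₀ * y₁ = y₀ * x₁) : x₀ = y₀ ∧ x₁ = y₁ := by
  have d1 : x₁ ∣ y₁ := hx.symm.dvd_of_dvd_mul_left (Dvd.intro_left y₀ h.symm)
  have d2 : y₁ ∣ x₁ := hy.symm.dvd_of_dvd_mul_left (Dvd.intro_left x₀ h)
  have e := Int.dvd_antisymm hx1.le hy1.le d1 d2
  subst e
  exact ⟨mul_right_cancel₀ hx1.ne' h, rfl⟩

lemma wedge_mul (X w w' : Mat) :
    (X * w.transpose) 0 1 * (X * w'.transpose) 1 1 - (X * w.transpose) 1 1 * (X * w'.transpose) 0 1 =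
      X.det * (w 1 0 * w' 1 1 - w 1 1 * w' 1 0) := by
  simp only [Matrix.mul_apply, Fin.sum_univ_two, Matrix.det_fin_two, Matrix.transpose_apply]
  ring

namespace Blocks

variable {S : Blocks}

lemma ratio_spaced {j k : ℕ} {g g' : Mat} (hg : g ∈ S.U j k) (hg' : g' ∈ S.U j k) (hne : g ≠ g') :
    1 / (S.D j k : ℝ) ^ 2 ≤ |(g 0 1 : ℝ) / g 1 1 - (g' 0 1 : ℝ) / g' 1 1| := by
  have h1 := one_le_d hg
  have h2 := one_le_d hg'
  have h3 := d_le_D' hg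
  have h4 := d_le_D' hg'
  have hz : (g 0 1 * g' 1 1 - g 1 1 * g' 0 1 : ℤ) ≠ 0 := by
    intro h0
    obtain ⟨e1, e2⟩ := coprime_pair_eq (adm hg).coprime_col (adm hg').coprime_col (adm hg).d_pos
      (adm hg').d_pos (by linarith)
    exact hne (col_inj (S.U_subset _ _ hg) (S.U_subset _ _ hg') e1 e2)
  have hz' : (1 : ℝ) ≤ |(g 0 1 * g' 1 1 - g 1 1 * g' 0 1 : ℝ)| := by
    exact_mod_cast Int.one_le_abs hz
  rw [div_sub_div _ _ (by positivity) (by positivity), abs_div,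
    abs_of_pos (a := (g 1 1 : ℝ) * g' 1 1) (by positivity)]
  have h5 : (g 1 1 : ℝ) * g' 1 1 ≤ (S.D j k : ℝ) ^ 2 := by rw [sq]; gcongr
  gcongr

/-- Points of one class which are close to a given point. -/
structure CloseData (L : ℕ) (m K Q : ℝ) (t : ℕ) (a q v₀ v₁ : ℤ) (t' : ℕ) (v₀' v₁' : ℤ) where
  (a' z₀ z₁ r₀ r₁ : ℤ)
  cop : IsCoprime a' q
  cz₀ : a * v₀ - a' * v₀' = q * z₀
  cz₁ : a * v₁ - a' * v₁' = q * z₁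
  e₁ : t * v₁ - t' * v₁' = r₁ + L * z₁
  b₀ : |(r₀ : ℝ)| * (6 * m) < L
  b₁ : |(r₁ : ℝ)| * (6 * m) < L
  f₀ : q * r₀ = (q * t - a * L) * v₀ - (q * t' - a' * L) * v₀'
  f₁ : q * r₁ = (q * t - a * L) * v₁ - (q * t' - a' * L) * v₁'

lemma closeData_of_near {L m : ℕ} {K Q κ : ℝ} {t t' : ℕ} {a q v₀ v₁ v₀' v₁' : ℤ}
    (hL : 0 < L) (hm : 0 < m) (hK : 1 ≤ K) (hQ : 1 ≤ Q) (hκ : 1 ≤ κ)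
    (hmKQ : 20 * κ * K * Q ^ 2 ≤ m)
    (ht : InClass L K Q t a q) (ht' : ∃ a' q', InClass L K Q t' a' q')
    (hv : IsCoprime v₀ v₁) (hv' : IsCoprime v₀' v₁')
    (h0 : 0 ≤ v₀) (h0' : 0 ≤ v₀') (h1 : v₀ ≤ v₁) (h1' : v₀' ≤ v₁')
    (hb : (m : ℝ) * v₁ ≤ κ * L) (hb' : (m : ℝ) * v₁' ≤ κ * L)
    (n₀ : Near L m (t * v₀ - t' * v₀')) (n₁ : Near L m (t * v₁ - t' * v₁')) :
    Nonempty (CloseData L m K Q t a q v₀ v₁ t' v₀' v₁') := by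
  obtain ⟨a', q', ht'⟩ := ht'
  obtain ⟨r₀, z₀, e₀, hr₀⟩ := n₀
  obtain ⟨r₁, z₁, e₁, hr₁⟩ := n₁
  have hr₀' : |(r₀ : ℝ)| * (6 * m) < L := by exact_mod_cast hr₀
  have hr₁' : |(r₁ : ℝ)| * (6 * m) < L := by exact_mod_cast hr₁
  obtain ⟨rfl, c0, c1, f0, f1⟩ := exact_of_near (m := m) hL (by exact_mod_cast hm) hK hQ hκ hmKQ
    ht ht' hv hv' h0 h0' h1 h1' hb hb' e₀ e₁ hr₀' hr₁'
  exact ⟨⟨a', z₀, z₁, r₀, r₁, ht'.1, c0, c1, e₁, hr₀', hr₁', f0, f1⟩⟩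

lemma CloseData.time_close {L : ℕ} {m K Q κ : ℝ} {t t' t'' : ℕ} {a q v₀ v₁ v₀' v₁' : ℤ}
    (hm : 0 < m) (hq : q ≠ 0) (hv' : IsCoprime v₀' v₁') (hv1 : 0 < v₁')
    (hb : (L : ℝ) ≤ κ * (m * v₁')) (h : CloseData L m K Q t a q v₀ v₁ t' v₀' v₁')
    (h' : CloseData L m K Q t a q v₀ v₁ t'' v₀' v₁') :
    ∃ k : ℤ, |(t' : ℝ) - t'' - k * L| ≤ κ := by
  obtain ⟨x, y, hxy⟩ := hv'
  set k := x * (h'.z₀ - h.z₀) + y * (h'.z₁ - h.z₁) with hk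
  have ek : h.a' - h'.a' = q * k := by
    rw [hk]
    linear_combination (-(h.a' - h'.a')) * hxy + x * (h'.cz₀ - h.cz₀) + y * (h'.cz₁ - h.cz₁)
  have ez : h'.z₁ - h.z₁ = k * v₁' := mul_left_cancel₀ hq (by
    linear_combination h.cz₁ - h'.cz₁ + v₁' * ek)
  refine ⟨k, ?_⟩
  have e : ((t' : ℤ) - t'' - k * L) * v₁' = h'.r₁ - h.r₁ := by
    linear_combination h'.e₁ - h.e₁ + L * ez
  have eR : ((t' : ℝ) - t'' - k * L) * v₁' = h'.r₁ - h.r₁ := by exact_mod_cast e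
  have hv1r : (0 : ℝ) < v₁' := by exact_mod_cast hv1
  have hab : |(t' : ℝ) - t'' - k * L| * v₁' ≤ |(h'.r₁ : ℝ)| + |(h.r₁ : ℝ)| := by
    rw [← abs_of_pos hv1r, ← abs_mul, eR]; exact abs_sub _ _
  have h2 : |(t' : ℝ) - t'' - k * L| * (m * v₁') ≤ κ * (m * v₁') := by
    have := h.b₁
    have := h'.b₁
    have : (|(t' : ℝ) - t'' - k * L| * v₁') * m ≤ (|(h'.r₁ : ℝ)| + |(h.r₁ : ℝ)|) * m := by gcongr
    nlinarith
  exact le_of_mul_le_mul_right h2 (by positivity)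

lemma CloseData.ratio_close {L : ℕ} {m K Q κ : ℝ} {t t' : ℕ} {a q v₀ v₁ v₀' v₁' : ℤ}
    (hm : 0 < m) (hκ : 1 ≤ κ) (hK : 1 ≤ K) (ht : InClass L K Q t a q) (hQ : 1 ≤ Q)
    (h0 : 0 ≤ v₀) (h1 : v₀ ≤ v₁) (hv1 : 0 < v₁) (h0' : 0 ≤ v₀') (h1' : v₀' ≤ v₁') (hv1' : 0 < v₁')
    (hb : (L : ℝ) ≤ κ * (m * v₁)) (h : CloseData L m K Q t a q v₀ v₁ t' v₀' v₁') :
    |(v₀ : ℝ) / v₁ - (v₀' : ℝ) / v₁'| ≤ κ / K := by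
  obtain ⟨-, hq1, -, -, hKq⟩ := ht
  have hq : (0 : ℝ) < q := by linarith
  have p0 : (0 : ℝ) ≤ v₀ := by exact_mod_cast h0
  have p0' : (0 : ℝ) ≤ v₀' := by exact_mod_cast h0'
  have p1 : (v₀ : ℝ) ≤ v₁ := by exact_mod_cast h1
  have p1' : (v₀' : ℝ) ≤ v₁' := by exact_mod_cast h1'
  have q1 : (0 : ℝ) < v₁ := by exact_mod_cast hv1
  have q1' : (0 : ℝ) < v₁' := by exact_mod_cast hv1'
  rcases hKq with rfl | hKq
  · have a1 : (v₀ : ℝ) / v₁ ≤ 1 := by rw [div_le_one q1]; exact p1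
    have a2 : (v₀' : ℝ) / v₁' ≤ 1 := by rw [div_le_one q1']; exact p1'
    have a3 : (0 : ℝ) ≤ v₀ / v₁ := by positivity
    have a4 : (0 : ℝ) ≤ v₀' / v₁' := by positivity
    rw [div_one, abs_le]; constructor <;> linarith
  · have e : q * (h.r₀ * v₁' - h.r₁ * v₀') = (q * t - a * L) * (v₀ * v₁' - v₁ * v₀') := by
      linear_combination v₁' * h.f₀ - v₀' * h.f₁
    have eR : (q : ℝ) * (h.r₀ * v₁' - h.r₁ * v₀') = (q * t - a * L) * (v₀ * v₁' - v₁ * v₀') := by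
      exact_mod_cast e
    have h2 : K * |(v₀ : ℝ) * v₁' - v₁ * v₀'| ≤ |(h.r₀ : ℝ) * v₁' - h.r₁ * v₀'| := by
      have : q * (K * |(v₀ : ℝ) * v₁' - v₁ * v₀'|) ≤ q * |(h.r₀ : ℝ) * v₁' - h.r₁ * v₀'| := by
        rw [← abs_of_pos hq, ← abs_mul, abs_of_pos hq, eR, abs_mul]
        calc _ = (K * q) * |(v₀ : ℝ) * v₁' - v₁ * v₀'| := by ring
          _ ≤ _ := by gcongr
      exact le_of_mul_le_mul_left this hq
    have h3 : |(h.r₀ : ℝ) * v₁' - h.r₁ * v₀'| * m ≤ L * v₁' := by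
      have b0 := h.b₀
      have b1 := h.b₁
      calc |(h.r₀ : ℝ) * v₁' - h.r₁ * v₀'| * m ≤ (|(h.r₀ : ℝ)| * v₁' + |(h.r₁ : ℝ)| * v₁') * m := by
            gcongr
            refine (abs_sub _ _).trans ?_
            rw [abs_mul, abs_mul, abs_of_pos q1', abs_of_nonneg p0']
            gcongr
        _ = (|(h.r₀ : ℝ)| * m + |(h.r₁ : ℝ)| * m) * v₁' := by ring
        _ ≤ L * v₁' := by gcongr; linarith
    have h4 : (K * |(v₀ : ℝ) * v₁' - v₁ * v₀'|) * m ≤ κ * (v₁ * v₁') * m := by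
      calc _ ≤ |(h.r₀ : ℝ) * v₁' - h.r₁ * v₀'| * m := by gcongr
        _ ≤ L * v₁' := h3
        _ ≤ κ * (m * v₁) * v₁' := by gcongr
        _ = _ := by ring
    have h5 := le_of_mul_le_mul_right h4 hm
    rw [div_sub_div _ _ q1.ne' q1'.ne', abs_div, abs_of_pos (mul_pos q1 q1'),
      div_le_div_iff₀ (by positivity) (by positivity)]
    linarith

end Blocks

namespace Blocks

variable {S : Blocks}

lemma count_class {η : Type*} (H : Finset η) (M : η → Mat) (hM : ∀ h ∈ H, Adm (M h))
    {i j k L m : ℕ} {K Q κ : ℝ} (hjk : j ≤ k)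
    (hL : 0 < L) (hm : 0 < m) (hK : 1 ≤ K) (hQ : 1 ≤ Q) (hκ : 1 ≤ κ)
    (hmKQ : 20 * κ * K * Q ^ 2 ≤ m) (hG : (S.D j k : ℝ) ^ 2 ≤ K)
    (hW : i = 0 ∨ (S.D 0 i : ℝ) ^ 2 < Q)
    (hlo : ∀ g ∈ S.U j k, ∀ h ∈ H, ∀ w ∈ S.U 0 i,
      (L : ℝ) ≤ κ * (m * ((g * M h * w.transpose) 1 1 : ℤ)))
    (hhi : ∀ g ∈ S.U j k, ∀ h ∈ H, ∀ w ∈ S.U 0 i,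
      (m : ℝ) * ((g * M h * w.transpose) 1 1 : ℤ) ≤ κ * L)
    {t : ℕ} (ht : ∃ a q, InClass L K Q t a q) {v : Mat × η × Mat}
    (hv : v ∈ S.U j k ×ˢ H ×ˢ S.U 0 i) (A : Finset (ℕ × Mat × η × Mat))
    (hA : ∀ y ∈ A, (y.1 < L ∧ ∃ a q, InClass L K Q y.1 a q) ∧ y.2 ∈ S.U j k ×ˢ H ×ˢ S.U 0 i ∧
      Near L m (t * (v.1 * M v.2.1 * v.2.2.transpose) 0 1 -
        y.1 * (y.2.1 * M y.2.2.1 * y.2.2.2.transpose) 0 1) ∧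
      Near L m (t * (v.1 * M v.2.1 * v.2.2.transpose) 1 1 -
        y.1 * (y.2.1 * M y.2.2.1 * y.2.2.2.transpose) 1 1)) :
    (A.card : ℝ) ≤ (2 * κ + 1) * (2 * (κ + 2 * C0 ^ 2) + 2) * H.card := by
  classical
  obtain ⟨a, q, ht⟩ := ht
  set X : Mat × η × Mat → Mat := fun v => v.1 * M v.2.1 * v.2.2.transpose with hX
  have hmr : (0 : ℝ) < m := by exact_mod_cast hm
  have hq0 : (0 : ℝ) < q := by linarith [ht.2.1]
  have hqz : (0 : ℤ) < q := by exact_mod_cast hq0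
  have hadm : ∀ v ∈ S.U j k ×ˢ H ×ˢ S.U 0 i, Adm (X v) := by
    intro v hv
    rw [Finset.mem_product, Finset.mem_product] at hv
    exact ((adm hv.1).mul (hM _ hv.2.1)).mul (adm hv.2.2).transpose
  have hlo' : ∀ v ∈ S.U j k ×ˢ H ×ˢ S.U 0 i, (L : ℝ) ≤ κ * (m * (X v 1 1 : ℤ)) := by
    intro v hv
    rw [Finset.mem_product, Finset.mem_product] at hv
    exact hlo _ hv.1 _ hv.2.1 _ hv.2.2
  have hhi' : ∀ v ∈ S.U j k ×ˢ H ×ˢ S.U 0 i, (m : ℝ) * (X v 1 1 : ℤ) ≤ κ * L := by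
    intro v hv
    rw [Finset.mem_product, Finset.mem_product] at hv
    exact hhi _ hv.1 _ hv.2.1 _ hv.2.2
  have hAv := hadm v hv
  have hcd : ∀ y ∈ A, Nonempty (CloseData L m K Q t a q (X v 0 1) (X v 1 1) y.1
      (X y.2 0 1) (X y.2 1 1)) := by
    intro y hy
    obtain ⟨⟨-, hy1⟩, hy2, hn0, hn1⟩ := hA y hy
    have hAy := hadm _ hy2
    exact closeData_of_near hL hm hK hQ hκ hmKQ ht hy1 hAv.coprime_col hAy.coprime_col
      hAv.bounds.2.1 hAy.bounds.2.1 hAv.bounds.2.2.2.1 hAy.bounds.2.2.2.1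
      (hhi' _ hv) (hhi' _ hy2) hn0 hn1
  have step1 : (A.card : ℝ) ≤ (2 * κ + 1) * (A.image Prod.snd).card := by
    have h1 : ∀ b ∈ A.image Prod.snd, ({y ∈ A | y.2 = b}.card : ℝ) ≤ 2 * κ + 1 := by
      intro b _
      have hinj : Set.InjOn Prod.fst (({y ∈ A | y.2 = b} : Finset _) : Set (ℕ × Mat × η × Mat)) := by
        intro x hx y hy hxy
        rw [Finset.coe_filter, Set.mem_ofPred_eq] at hx hy
        exact Prod.ext hxy (hx.2.trans hy.2.symm)
      rw [← Finset.card_image_of_injOn hinj]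
      apply card_close_mod (L := L) _ _ (by linarith)
      · intro t₁ h₁ t₂ h₂
        obtain ⟨y, hy, rfl⟩ := Finset.mem_image.1 h₁
        obtain ⟨z, hz, rfl⟩ := Finset.mem_image.1 h₂
        rw [Finset.mem_filter] at hy hz
        obtain ⟨c1⟩ := hcd y hy.1
        obtain ⟨c2⟩ := hcd z hz.1
        have hb := (hA y hy.1).2.1
        rw [hz.2] at c2
        rw [hy.2] at c1 hb
        exact c1.time_close hmr hqz.ne' (hadm _ hb).coprime_col (hadm _ hb).d_pos
          (hlo' _ hb) c2
      · intro t₁ h₁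
        obtain ⟨y, hy, rfl⟩ := Finset.mem_image.1 h₁
        exact (hA y (Finset.mem_filter.1 hy).1).1.1
    rw [Finset.card_eq_sum_card_image Prod.snd A]
    push_cast
    calc _ ≤ ∑ b ∈ A.image Prod.snd, (2 * κ + 1) := Finset.sum_le_sum h1
      _ = _ := by rw [Finset.sum_const, nsmul_eq_mul]; ring
  set B := A.image Prod.snd with hB
  have hBA : ∀ b ∈ B, b ∈ S.U j k ×ˢ H ×ˢ S.U 0 i ∧ ∃ t' : ℕ,
      Nonempty (CloseData L m K Q t a q (X v 0 1) (X v 1 1) t' (X b 0 1) (X b 1 1)) := by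
    intro b hb
    obtain ⟨y, hy, rfl⟩ := Finset.mem_image.1 hb
    exact ⟨(hA y hy).2.1, y.1, hcd y hy⟩
  have hD : (0 : ℝ) < S.D j k := by linarith [S.one_le_D j k]
  have step2 : (B.card : ℝ) ≤ (2 * (κ + 2 * C0 ^ 2) + 2) * H.card := by
    have h1 : ∀ h ∈ B.image (fun b => b.2.1), ({b ∈ B | b.2.1 = h}.card : ℝ) ≤
        2 * (κ + 2 * C0 ^ 2) + 2 := by
      intro h _
      have hinj : Set.InjOn Prod.fst (({b ∈ B | b.2.1 = h} : Finset _) : Set (Mat × η × Mat)) := by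
        rintro ⟨g, h1, w⟩ hx ⟨g', h2, w'⟩ hy hxy
        rw [Finset.coe_filter, Set.mem_ofPred_eq] at hx hy
        obtain ⟨hx, e1⟩ := hx
        obtain ⟨hy, e2⟩ := hy
        simp only at e1 e2 hxy
        subst e1 e2 hxy
        obtain ⟨hxm, t₁, ⟨c1⟩⟩ := hBA _ hx
        obtain ⟨hym, t₂, ⟨c2⟩⟩ := hBA _ hy
        rw [Finset.mem_product, Finset.mem_product] at hxm hym
        have hw : w ∈ S.U 0 i := hxm.2.2
        have hw' : w' ∈ S.U 0 i := hym.2.2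
        suffices w = w' by rw [this]
        rcases hW with rfl | hW
        · rw [U_self, Finset.mem_one] at hw hw'
          rw [hw, hw']
        have hdvd : q ∣ w 1 0 * w' 1 1 - w 1 1 * w' 1 0 := by
          have hwd := wedge_mul (g * M h2) w w'
          have h3 : q ∣ c1.a' * (X (g, h2, w) 0 1 * X (g, h2, w') 1 1 -
              X (g, h2, w) 1 1 * X (g, h2, w') 0 1) :=
            ⟨X (g, h2, w') 1 1 * (c2.z₀ - c1.z₀) - X (g, h2, w') 0 1 * (c2.z₁ - c1.z₁), by
              linear_combination (-(X (g, h2, w') 1 1)) * c1.cz₀ + X (g, h2, w') 0 1 * c1.cz₁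
                + X (g, h2, w') 1 1 * c2.cz₀ - X (g, h2, w') 0 1 * c2.cz₁⟩
          have h4 := c1.cop.symm.dvd_of_dvd_mul_left h3
          simp only [hX] at h4
          rw [hwd] at h4
          have hdet := ((adm hxm.1).mul (hM _ hxm.2.1)).det
          rcases hdet with hd | hd
          · rw [hd, one_mul] at h4; exact h4
          · rw [hd, neg_one_mul, dvd_neg] at h4; exact h4
        have hlt : |w 1 0 * w' 1 1 - w 1 1 * w' 1 0| < q := by
          obtain ⟨-, -, w1, -, w2, w3, -⟩ := (adm hw).bounds
          obtain ⟨-, -, w1', -, w2', w3', -⟩ := (adm hw').bounds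
          have d1 := d_le_D hw
          have d2 := d_le_D hw'
          have hDq : (S.D 0 i : ℤ) ^ 2 < q := by
            have : (S.D 0 i : ℝ) ^ 2 < q := by linarith [ht.2.1]
            exact_mod_cast this
          have u1 : w 1 0 * w' 1 1 ≤ (S.D 0 i : ℤ) * S.D 0 i :=
            mul_le_mul (by omega) d2 (by omega) (by omega)
          have u2 : w 1 1 * w' 1 0 ≤ (S.D 0 i : ℤ) * S.D 0 i :=
            mul_le_mul d1 (by omega) (by omega) (by omega)
          have u3 : 0 ≤ w 1 0 * w' 1 1 := mul_nonneg w1 (by omega)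
          have u4 : 0 ≤ w 1 1 * w' 1 0 := mul_nonneg (by omega) w1'
          rw [abs_lt]
          constructor <;> nlinarith
        have hz := Int.eq_zero_of_abs_lt_dvd hdvd hlt
        obtain ⟨e1, e2⟩ := coprime_pair_eq (adm hw).transpose.coprime_col
          (adm hw').transpose.coprime_col (adm hw).d_pos (adm hw').d_pos
          (by simp only [Matrix.transpose_apply]; linarith)
        exact row_inj (S.U_subset _ _ hw) (S.U_subset _ _ hw') e1 e2
      rw [← Finset.card_image_of_injOn hinj]
      apply card_spaced _ (fun g : Mat => (g 0 1 : ℝ) / g 1 1) (δ := 1 / (S.D j k : ℝ) ^ 2)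
        (c := (X v 0 1 : ℝ) / X v 1 1) (by positivity) (by positivity)
      · intro g hg g' hg' hne
        obtain ⟨x, hx, rfl⟩ := Finset.mem_image.1 hg
        obtain ⟨y, hy, rfl⟩ := Finset.mem_image.1 hg'
        have m1 := (hBA x (Finset.mem_filter.1 hx).1).1
        have m2 := (hBA y (Finset.mem_filter.1 hy).1).1
        exact ratio_spaced (Finset.mem_product.1 m1).1 (Finset.mem_product.1 m2).1 hne
      · intro g hg
        obtain ⟨x, hx, rfl⟩ := Finset.mem_image.1 hg
        obtain ⟨m1, t₁, ⟨c1⟩⟩ := hBA x (Finset.mem_filter.1 hx).1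
        have hAx := hadm _ m1
        have r1 := c1.ratio_close hmr hκ hK ht hQ hAv.bounds.2.1 hAv.bounds.2.2.2.1 hAv.d_pos
          hAx.bounds.2.1 hAx.bounds.2.2.2.1 hAx.d_pos (hlo' _ hv)
        rw [Finset.mem_product, Finset.mem_product] at m1
        have r2 := Adm.abs_col_ratio_sub_le ((hM _ m1.2.1).mul (adm m1.2.2).transpose) (adm m1.1)
        rw [← Matrix.mul_assoc] at r2
        change |(X x 0 1 : ℝ) / X x 1 1 - (x.1 0 1 : ℝ) / x.1 1 1| ≤ _ at r2
        have r3 : κ / K ≤ κ * (1 / (S.D j k : ℝ) ^ 2) := by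
          rw [mul_one_div]; gcongr
        have r4 : 1 / (x.1 1 1 : ℝ) ^ 2 ≤ C0 ^ 2 * (1 / (S.D j k : ℝ) ^ 2) := by
          have h5 := one_le_d m1.1
          have h6 := S.D_le_C0 hjk m1.1
          rw [mul_one_div, div_le_div_iff₀ (by positivity) (by positivity), one_mul, ← mul_pow]
          gcongr
        have r5 : (κ + 2 * C0 ^ 2) * (1 / (S.D j k : ℝ) ^ 2) =
          κ * (1 / (S.D j k : ℝ) ^ 2) + 2 * (C0 ^ 2 * (1 / (S.D j k : ℝ) ^ 2)) := by ring
        have r6 : 0 ≤ C0 ^ 2 * (1 / (S.D j k : ℝ) ^ 2) := by positivity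
        rw [r5]
        have a1 := abs_le.1 r1
        have a2 := abs_le.1 r2
        rw [abs_le]
        constructor <;> linarith
    rw [Finset.card_eq_sum_card_image (fun b => b.2.1) B]
    push_cast
    calc _ ≤ ∑ b ∈ B.image (fun b => b.2.1), (2 * (κ + 2 * C0 ^ 2) + 2) := Finset.sum_le_sum h1
      _ = (2 * (κ + 2 * C0 ^ 2) + 2) * (B.image (fun b => b.2.1)).card := by
        rw [Finset.sum_const, nsmul_eq_mul]; ring
      _ ≤ _ := by
        have : B.image (fun b => b.2.1) ⊆ H := by
          intro h hh
          obtain ⟨b, hb, rfl⟩ := Finset.mem_image.1 hh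
          exact (Finset.mem_product.1 (Finset.mem_product.1 (hBA b hb).1).2).1
        gcongr
  calc (A.card : ℝ) ≤ (2 * κ + 1) * B.card := step1
    _ ≤ (2 * κ + 1) * ((2 * (κ + 2 * C0 ^ 2) + 2) * H.card) := by gcongr
    _ = _ := by ring

end Blocks

namespace Blocks

variable (S : Blocks)

lemma bilinear_bound_U {ν : Type*} (P : Finset ℕ) (V : Finset ν) (X : ν → Mat) (j : ℕ) {L : ℕ}
    (hL : 6 * S.D 0 j ≤ L) {M : ℝ} (hM0 : 0 ≤ M)
    (hM : ∀ t ∈ P, ∀ v ∈ V, ∀ A : Finset (ℕ × ν), (∀ y ∈ A, y.1 ∈ P ∧ y.2 ∈ V ∧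
      Near L (S.D 0 j) (t * X v 0 1 - y.1 * X y.2 0 1) ∧
      Near L (S.D 0 j) (t * X v 1 1 - y.1 * X y.2 1 1)) → (A.card : ℝ) ≤ M) :
    ∑ t ∈ P, ‖∑ u ∈ S.U 0 j, ∑ v ∈ V, ex (t * ((u * X v) 1 1 : ℤ) / L)‖ ^ 2 ≤
      2304 * (S.D 0 j : ℝ) ^ 2 * M * (S.U 0 j).card * V.card := by
  classical
  have hm : 0 < S.D 0 j := by
    have := S.one_le_D 0 j
    exact_mod_cast (by linarith : (0 : ℝ) < S.D 0 j)
  set f : Mat → ℕ × ℕ := fun u => ((u 1 0).toNat, (u 1 1).toNat) with hf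
  have hnn : ∀ u ∈ S.U 0 j, 0 ≤ u 1 0 ∧ 0 ≤ u 1 1 := fun u hu =>
    ⟨(adm hu).bounds.2.2.1, (adm hu).d_pos.le⟩
  have hinj : Set.InjOn f (S.U 0 j : Set Mat) := by
    intro u hu u' hu' h
    have h1 := hnn u hu
    have h2 := hnn u' hu'
    simp only [hf, Prod.mk.injEq] at h
    exact row_inj (S.U_subset _ _ hu) (S.U_subset _ _ hu') (by omega) (by omega)
  have key := bilinear_bound P V (fun v => X v 0 1) (fun v => X v 1 1) ((S.U 0 j).image f) hm hL
    (by
      intro u hu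
      obtain ⟨γ, hγ, rfl⟩ := Finset.mem_image.1 hu
      have h1 := d_le_D hγ
      have h2 := (adm hγ).bounds
      simp only [hf]
      omega) hM0 hM
  rw [Finset.card_image_of_injOn hinj] at key
  refine le_trans (le_of_eq ?_) key
  refine Finset.sum_congr rfl fun t _ => ?_
  rw [Finset.sum_image hinj]
  congr 2
  refine Finset.sum_congr rfl fun u hu => Finset.sum_congr rfl fun v _ => ?_
  obtain ⟨h1, h2⟩ := hnn u hu
  congr 3
  have e1 : (((u 1 0).toNat : ℕ) : ℝ) = (u 1 0 : ℝ) := by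
    exact_mod_cast Int.toNat_of_nonneg h1
  have e2 : (((u 1 1).toNat : ℕ) : ℝ) = (u 1 1 : ℝ) := by
    exact_mod_cast Int.toNat_of_nonneg h2
  simp only [hf, e1, e2, Matrix.mul_apply, Fin.sum_univ_two]
  push_cast
  ring

/-- The exponential sum over the products `x * p h * yᵀ`. -/
noncomputable def expSum {ι : Type*} (J₁ J₂ : ℕ) (I : Finset ι) (p : ι → Mat) (L t : ℕ) : ℂ :=
  ∑ x ∈ S.U 0 J₁, ∑ h ∈ I, ∑ y ∈ S.U 0 J₂, ex (t * ((x * p h * y.transpose) 1 1 : ℤ) / L)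

/-- All products `x * p h * yᵀ` have bottom-right entry of size about `L`. -/
structure Good {ι : Type*} (J₁ J₂ : ℕ) (I : Finset ι) (p : ι → Mat) (κ : ℝ) (L : ℕ) : Prop where
  adm : ∀ h ∈ I, Adm (p h)
  lo : ∀ x ∈ S.U 0 J₁, ∀ h ∈ I, ∀ y ∈ S.U 0 J₂,
    (L : ℝ) ≤ κ * ((x * p h * y.transpose) 1 1 : ℤ)
  hi : ∀ x ∈ S.U 0 J₁, ∀ h ∈ I, ∀ y ∈ S.U 0 J₂,
    (((x * p h * y.transpose) 1 1 : ℤ) : ℝ) ≤ κ * L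

/-- The size of the index set of `expSum`. -/
def vol {ι : Type*} (J₁ J₂ : ℕ) (I : Finset ι) : ℕ :=
  (S.U 0 J₁).card * I.card * (S.U 0 J₂).card

variable {S}

lemma expSum_split {ι : Type*} {J₁ J₂ j k i L t : ℕ} (I : Finset ι) (p : ι → Mat) (hjk : j ≤ k)
    (hk : k ≤ J₁) (hi : i ≤ J₂) :
    S.expSum J₁ J₂ I p L t = ∑ u ∈ S.U 0 j,
      ∑ v ∈ S.U j k ×ˢ (S.U k J₁ ×ˢ I ×ˢ S.U i J₂) ×ˢ S.U 0 i,
        ex (t * ((u * (v.1 * (v.2.1.1 * p v.2.1.2.1 * v.2.1.2.2.transpose) * v.2.2.transpose)) 1 1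
          : ℤ) / L) := by
  rw [expSum, S.sum_U (Nat.zero_le j) (hjk.trans hk)]
  refine Finset.sum_congr rfl fun u _ => ?_
  rw [S.sum_U hjk hk, Finset.sum_product]
  refine Finset.sum_congr rfl fun g _ => ?_
  rw [Finset.sum_product, Finset.sum_product]
  refine Finset.sum_congr rfl fun h _ => ?_
  rw [Finset.sum_product]
  refine Finset.sum_congr rfl fun q _ => ?_
  rw [S.sum_U (Nat.zero_le i) hi, Finset.sum_comm]
  refine Finset.sum_congr rfl fun z _ => Finset.sum_congr rfl fun w _ => ?_
  simp only [Matrix.transpose_mul, Matrix.mul_assoc]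

lemma Good.bounds_of_split {ι : Type*} {J₁ J₂ j L : ℕ} {I : Finset ι} {p : ι → Mat} {κ : ℝ}
    (hG : S.Good J₁ J₂ I p κ L) (hκ : 1 ≤ κ) (hj : j ≤ J₁) {x' y : Mat} {h : ι}
    (hx' : x' ∈ S.U j J₁) (hh : h ∈ I) (hy : y ∈ S.U 0 J₂) :
    (L : ℝ) ≤ 2 * C0 * κ * (S.D 0 j * ((x' * p h * y.transpose) 1 1 : ℤ)) ∧
      (S.D 0 j : ℝ) * ((x' * p h * y.transpose) 1 1 : ℤ) ≤ 2 * C0 * κ * L := by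
  obtain ⟨u, hu, -⟩ := S.exists_eq_D' 0 j
  have hux : u * x' ∈ S.U 0 J₁ := by
    rw [← S.U_mul (Nat.zero_le j) hj]; exact Finset.mul_mem_mul hu hx'
  have hX : Adm (x' * p h * y.transpose) :=
    ((Blocks.adm hx').mul (hG.adm _ hh)).mul (Blocks.adm hy).transpose
  have e : u * x' * p h * y.transpose = u * (x' * p h * y.transpose) := by
    simp only [Matrix.mul_assoc]
  have h1 := hG.lo _ hux _ hh _ hy
  have h2 := hG.hi _ hux _ hh _ hy
  rw [e] at h1 h2
  set X := x' * p h * y.transpose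
  have h3 : ((u * X) 1 1 : ℝ) ≤ 2 * ((u 1 1 : ℝ) * X 1 1) := by
    exact_mod_cast (Blocks.adm hu).d_mul_le hX
  have h4 : (u 1 1 : ℝ) * X 1 1 ≤ (u * X) 1 1 := by
    exact_mod_cast (Blocks.adm hu).le_d_mul hX
  have h5 := d_le_D' hu
  have h6 := S.D_le_C0 (Nat.zero_le j) hu
  have h7 : (0 : ℝ) < X 1 1 := by exact_mod_cast hX.d_pos
  have h8 := one_le_C0
  have h9 := one_le_d hu
  constructor
  · calc (L : ℝ) ≤ κ * (u * X) 1 1 := h1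
      _ ≤ κ * (2 * (S.D 0 j * X 1 1)) := by
        refine mul_le_mul_of_nonneg_left (h3.trans ?_) (by linarith)
        gcongr
      _ = 2 * 1 * κ * (S.D 0 j * X 1 1) := by ring
      _ ≤ _ := by gcongr
  · calc (S.D 0 j : ℝ) * X 1 1 ≤ C0 * u 1 1 * X 1 1 := by gcongr
      _ = C0 * (u 1 1 * X 1 1) := by ring
      _ ≤ C0 * (κ * L) := mul_le_mul_of_nonneg_left (h4.trans h2) (by linarith)
      _ = 1 * C0 * κ * L := by ring
      _ ≤ _ := by gcongr; norm_num

open Classical in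
lemma sum_class_le {ι : Type*} {J₁ J₂ j k i L : ℕ} {I : Finset ι} {p : ι → Mat} {κ K Q : ℝ}
    (hG : S.Good J₁ J₂ I p κ L) (hκ : 1 ≤ κ) (hjk : j ≤ k) (hk : k ≤ J₁) (hi : i ≤ J₂)
    (hL : 6 * S.D 0 j ≤ L) (hK : 1 ≤ K) (hQ : 1 ≤ Q)
    (hmKQ : 20 * (2 * C0 * κ) * K * Q ^ 2 ≤ S.D 0 j) (hDK : (S.D j k : ℝ) ^ 2 ≤ K)
    (hW : i = 0 ∨ (S.D 0 i : ℝ) ^ 2 < Q) :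
    (∑ t ∈ Finset.range L with ∃ a q, InClass L K Q t a q, ‖S.expSum J₁ J₂ I p L t‖ ^ 2) *
      ((S.U 0 j).card * (S.U j k).card * (S.U 0 i).card) ≤
      2304 * ((2 * (2 * C0 * κ) + 1) * (2 * (2 * C0 * κ + 2 * C0 ^ 2) + 2)) *
        (S.D 0 j : ℝ) ^ 2 * (S.vol J₁ J₂ I : ℝ) ^ 2 := by
  have hC0 := one_le_C0
  have hκ1 : 1 ≤ 2 * C0 * κ := by nlinarith
  have hD1 := S.one_le_D 0 j
  have hm : 0 < S.D 0 j := by exact_mod_cast (by linarith : (0 : ℝ) < S.D 0 j)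
  set H := S.U k J₁ ×ˢ I ×ˢ S.U i J₂ with hH
  set M : Mat × ι × Mat → Mat := fun h => h.1 * p h.2.1 * h.2.2.transpose with hM
  have hb : ∀ g ∈ S.U j k, ∀ h ∈ H, ∀ w ∈ S.U 0 i,
      (L : ℝ) ≤ 2 * C0 * κ * (S.D 0 j * ((g * M h * w.transpose) 1 1 : ℤ)) ∧
      (S.D 0 j : ℝ) * ((g * M h * w.transpose) 1 1 : ℤ) ≤ 2 * C0 * κ * L := by
    intro g hg h hh w hw
    rw [hH, Finset.mem_product, Finset.mem_product] at hh
    have e : g * M h * w.transpose = g * h.1 * p h.2.1 * (w * h.2.2).transpose := by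
      simp only [hM, Matrix.transpose_mul, Matrix.mul_assoc]
    rw [e]
    refine hG.bounds_of_split hκ (hjk.trans hk) ?_ hh.2.1 ?_
    · rw [← S.U_mul hjk hk]; exact Finset.mul_mem_mul hg hh.1
    · rw [← S.U_mul (Nat.zero_le i) hi]; exact Finset.mul_mem_mul hw hh.2.2
  have key := S.bilinear_bound_U ({t ∈ Finset.range L | ∃ a q, InClass L K Q t a q})
    (S.U j k ×ˢ H ×ˢ S.U 0 i) (fun v => v.1 * M v.2.1 * v.2.2.transpose) j hL
    (M := (2 * (2 * C0 * κ) + 1) * (2 * (2 * C0 * κ + 2 * C0 ^ 2) + 2) * H.card) (by positivity) (by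
      intro t ht v hv A hA
      rw [Finset.mem_filter] at ht
      refine count_class (S := S) (κ := 2 * C0 * κ) H M ?_ hjk (by omega) hm hK hQ hκ1 hmKQ hDK hW
        (fun g hg h hh w hw => (hb g hg h hh w hw).1) (fun g hg h hh w hw => (hb g hg h hh w hw).2)
        ht.2 hv A ?_
      · intro h hh
        rw [hH, Finset.mem_product, Finset.mem_product] at hh
        exact ((Blocks.adm hh.1).mul (hG.adm _ hh.2.1)).mul (Blocks.adm hh.2.2).transpose
      · intro y hy
        obtain ⟨h1, h2⟩ := hA y hy
        rw [Finset.mem_filter, Finset.mem_range] at h1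
        exact ⟨h1, h2⟩)
  have e1 : ∀ t, S.expSum J₁ J₂ I p L t = ∑ u ∈ S.U 0 j, ∑ v ∈ S.U j k ×ˢ H ×ˢ S.U 0 i,
      ex (t * ((u * (v.1 * M v.2.1 * v.2.2.transpose)) 1 1 : ℤ) / L) :=
    fun t => expSum_split I p hjk hk hi
  simp_rw [e1]
  have hs : (S.vol J₁ J₂ I : ℝ) = (S.U 0 j).card * (S.U j k).card * (S.U 0 i).card * H.card := by
    rw [vol, S.card_U (Nat.zero_le j) (hjk.trans hk), S.card_U hjk hk,
      S.card_U (Nat.zero_le i) hi, hH, Finset.card_product, Finset.card_product]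
    push_cast; ring
  have hVc : ((S.U j k ×ˢ H ×ˢ S.U 0 i).card : ℝ) = (S.U j k).card * (H.card * (S.U 0 i).card) := by
    rw [Finset.card_product, Finset.card_product]; push_cast; ring
  rw [hVc] at key
  refine (mul_le_mul_of_nonneg_right key (by positivity)).trans (le_of_eq ?_)
  rw [hs]
  ring

end Blocks

namespace Blocks

variable {S : Blocks}

lemma weight_le {B K Q E m x y : ℝ} (hB : 1 ≤ B) (hK : 1 ≤ K) (hQ : 1 ≤ Q) (hm : 1 ≤ m)
    (hx : 1 ≤ x) (hy : 1 ≤ y) (hE : E = (K * Q) ^ (1 / 100 : ℝ)) (h1 : m ≤ B * (K * Q ^ 2) * E)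
    (h2 : Real.sqrt K ≤ B * x * E) (h3 : Real.sqrt Q ≤ B * y * E) :
    m ^ 2 ≤ m ^ (41 / 25 : ℝ) * x ^ (41 / 25 : ℝ) * y ^ (41 / 25 : ℝ) *
      (B ^ 4 * (K * Q) ^ (-(1 / 20) : ℝ)) := by
  have hK0 : 0 < K := by linarith
  have hQ0 : 0 < Q := by linarith
  have hE1 : 0 < E := by rw [hE]; positivity
  have a1 : m ^ (9 / 25 : ℝ) ≤ (B * (K * Q ^ 2) * E) ^ (9 / 25 : ℝ) := by gcongr
  have a2 : (Real.sqrt K) ^ (41 / 25 : ℝ) ≤ (B * x * E) ^ (41 / 25 : ℝ) := by gcongr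
  have a3 : (Real.sqrt Q) ^ (41 / 25 : ℝ) ≤ (B * y * E) ^ (41 / 25 : ℝ) := by gcongr
  have e2 : ∀ z : ℝ, 0 ≤ z → (Real.sqrt z) ^ (41 / 25 : ℝ) = z ^ (41 / 50 : ℝ) := by
    intro z hz
    rw [Real.sqrt_eq_rpow, ← Real.rpow_mul hz]; norm_num
  rw [e2 K hK0.le, Real.mul_rpow (by positivity) hE1.le, Real.mul_rpow (by positivity)
    (by positivity)] at a2
  rw [e2 Q hQ0.le, Real.mul_rpow (by positivity) hE1.le, Real.mul_rpow (by positivity)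
    (by positivity)] at a3
  rw [Real.mul_rpow (by positivity) hE1.le, Real.mul_rpow (by positivity)
    (by positivity), Real.mul_rpow (by positivity) (by positivity), ← Real.rpow_natCast Q 2,
    ← Real.rpow_mul hQ0.le] at a1
  have e4 : m ^ 2 = m ^ (41 / 25 : ℝ) * m ^ (9 / 25 : ℝ) := by
    rw [← Real.rpow_natCast, ← Real.rpow_add (by linarith)]; norm_num
  have hEp : ∀ s : ℝ, E ^ s = K ^ (s / 100) * Q ^ (s / 100) := by
    intro s
    rw [hE, ← Real.rpow_mul (by positivity), Real.mul_rpow hK0.le hQ0.le]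
    congr 2 <;> ring
  set b := B ^ (9 / 25 : ℝ) * B ^ (41 / 25 : ℝ) * B ^ (41 / 25 : ℝ) with hb
  have hbB : b ≤ B ^ 4 := by
    rw [hb, ← Real.rpow_add (by linarith), ← Real.rpow_add (by linarith), ← Real.rpow_natCast B 4]
    apply Real.rpow_le_rpow_of_exponent_le hB
    norm_num
  have hprod : m ^ (9 / 25 : ℝ) * (K ^ (41 / 50 : ℝ) * Q ^ (41 / 50 : ℝ)) ≤
      x ^ (41 / 25 : ℝ) * y ^ (41 / 25 : ℝ) * (b * (K ^ (9 / 25 + 91 / 2500 : ℝ) *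
        Q ^ (18 / 25 + 91 / 2500 : ℝ))) := by
    calc _ ≤ (B ^ (9 / 25 : ℝ) * (K ^ (9 / 25 : ℝ) * Q ^ (((2 : ℕ) : ℝ) * (9 / 25))) *
          E ^ (9 / 25 : ℝ)) * ((B ^ (41 / 25 : ℝ) * x ^ (41 / 25 : ℝ) * E ^ (41 / 25 : ℝ)) *
            (B ^ (41 / 25 : ℝ) * y ^ (41 / 25 : ℝ) * E ^ (41 / 25 : ℝ))) := by gcongr
      _ = x ^ (41 / 25 : ℝ) * y ^ (41 / 25 : ℝ) * (b * ((K ^ (9 / 25 : ℝ) *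
          Q ^ (((2 : ℕ) : ℝ) * (9 / 25))) * (E ^ (9 / 25 : ℝ) * E ^ (41 / 25 : ℝ) *
            E ^ (41 / 25 : ℝ)))) := by rw [hb]; ring
      _ = _ := by
        have hE3 : E ^ (9 / 25 : ℝ) * E ^ (41 / 25 : ℝ) * E ^ (41 / 25 : ℝ) =
            K ^ (91 / 2500 : ℝ) * Q ^ (91 / 2500 : ℝ) := by
          rw [← Real.rpow_add hE1, ← Real.rpow_add hE1, hEp]; norm_num
        rw [hE3, show ((2 : ℕ) : ℝ) * (9 / 25) = 18 / 25 by norm_num, Real.rpow_add hK0,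
          Real.rpow_add hQ0]
        ring
  have hKQ : 0 < K ^ (41 / 50 : ℝ) * Q ^ (41 / 50 : ℝ) := by positivity
  have hfin : b * (K ^ (9 / 25 + 91 / 2500 : ℝ) * Q ^ (18 / 25 + 91 / 2500 : ℝ)) ≤
      B ^ 4 * (K * Q) ^ (-(1 / 20) : ℝ) * (K ^ (41 / 50 : ℝ) * Q ^ (41 / 50 : ℝ)) := by
    rw [mul_assoc (B ^ 4), Real.mul_rpow hK0.le hQ0.le]
    have : K ^ (-(1 / 20) : ℝ) * Q ^ (-(1 / 20) : ℝ) * (K ^ (41 / 50 : ℝ) * Q ^ (41 / 50 : ℝ)) =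
        K ^ (-(1 / 20) + 41 / 50 : ℝ) * Q ^ (-(1 / 20) + 41 / 50 : ℝ) := by
      rw [Real.rpow_add hK0, Real.rpow_add hQ0]; ring
    rw [this]
    gcongr ?_ * (?_ * ?_)
    · exact Real.rpow_le_rpow_of_exponent_le hK (by norm_num)
    · exact Real.rpow_le_rpow_of_exponent_le hQ (by norm_num)
  have hxy : m ^ (9 / 25 : ℝ) ≤ x ^ (41 / 25 : ℝ) * y ^ (41 / 25 : ℝ) *
      (B ^ 4 * (K * Q) ^ (-(1 / 20) : ℝ)) := by
    refine le_of_mul_le_mul_right (hprod.trans ?_) hKQ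
    rw [mul_assoc (x ^ (41 / 25 : ℝ) * y ^ (41 / 25 : ℝ)) _ (K ^ (41 / 50 : ℝ) * _)]
    exact mul_le_mul_of_nonneg_left hfin (by positivity)
  calc m ^ 2 = m ^ (41 / 25 : ℝ) * m ^ (9 / 25 : ℝ) := e4
    _ ≤ m ^ (41 / 25 : ℝ) * (x ^ (41 / 25 : ℝ) * y ^ (41 / 25 : ℝ) *
        (B ^ 4 * (K * Q) ^ (-(1 / 20) : ℝ))) := mul_le_mul_of_nonneg_left hxy (by positivity)
    _ = _ := by ring

variable (S)

lemma exists_split {c : ℝ} (hc : 1 ≤ c) : ∃ B : ℝ, 1 ≤ B ∧ ∀ (J₁ J₂ : ℕ) (K Q : ℝ), 1 ≤ K → 1 ≤ Q →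
    B * ((K * Q) ^ 2 * (K * Q) ^ (1 / 100 : ℝ)) ≤ S.D 0 J₁ → B * Real.sqrt Q ≤ S.D 0 J₂ →
    ∃ j k i, j ≤ k ∧ k ≤ J₁ ∧ i ≤ J₂ ∧ c * K * Q ^ 2 ≤ S.D 0 j ∧ (S.D j k : ℝ) ^ 2 ≤ K ∧
      (i = 0 ∨ (S.D 0 i : ℝ) ^ 2 < Q) ∧ (S.D 0 j : ℝ) ≤ B * (K * Q ^ 2) * (K * Q) ^ (1 / 100 : ℝ) ∧
      Real.sqrt K ≤ B * S.D j k * (K * Q) ^ (1 / 100 : ℝ) ∧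
      Real.sqrt Q ≤ B * S.D 0 i * (K * Q) ^ (1 / 100 : ℝ) := by
  obtain ⟨C, hC, hgrow⟩ := S.exists_growth (show (0 : ℝ) < 1 / 300 by norm_num)
  set B1 := C * c ^ 2 with hB1
  have hB1' : 1 ≤ B1 := by rw [hB1]; nlinarith
  have hcB : c ≤ B1 := by rw [hB1]; nlinarith
  refine ⟨3 * C * B1, by nlinarith, ?_⟩
  intro J₁ J₂ K Q hK hQ hJ₁ hJ₂
  set R := K * Q with hR
  set E := R ^ (1 / 100 : ℝ) with hE
  have hR1 : 1 ≤ R := by rw [hR]; nlinarith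
  have hE1 : 1 ≤ E := Real.one_le_rpow hR1 (by norm_num)
  have hER : E ≤ R := by
    calc E ≤ R ^ (1 : ℝ) := Real.rpow_le_rpow_of_exponent_le hR1 (by norm_num)
      _ = R := Real.rpow_one R
  have hB1B : 3 * B1 ≤ 3 * C * B1 := by nlinarith
  have hCB : 2 * C ≤ 3 * C * B1 := by nlinarith
  have hsK1 : 1 ≤ Real.sqrt K := Real.one_le_sqrt.2 hK
  have hsK : Real.sqrt K ≤ K := by
    exact Real.sqrt_le_iff.2 ⟨by linarith, le_self_pow₀ hK (by norm_num)⟩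
  set T := c * (K * Q ^ 2) with hT
  have hKQ2 : 1 ≤ K * Q ^ 2 := one_le_mul_of_one_le_of_one_le hK (one_le_pow₀ hQ)
  have hX0 : 0 < B1 * (R ^ 2 * E) := by positivity
  have hXJ : 3 * (B1 * (R ^ 2 * E)) ≤ S.D 0 J₁ := by
    refine le_trans ?_ hJ₁
    rw [← mul_assoc]
    exact mul_le_mul_of_nonneg_right hB1B (by positivity)
  have hKQ2R : K * Q ^ 2 * Real.sqrt K ≤ R ^ 2 := by
    calc K * Q ^ 2 * Real.sqrt K ≤ K * Q ^ 2 * K := by gcongr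
      _ = R ^ 2 := by rw [hR]; ring
  have hKQ2R' : K * Q ^ 2 ≤ R ^ 2 := le_trans (le_mul_of_one_le_right (by linarith) hsK1) hKQ2R
  have hT1 : 1 ≤ T := one_le_mul_of_one_le_of_one_le hc hKQ2
  obtain ⟨k0, -, hk1, hk2⟩ := S.exists_scale 0 hT1
  have hm : (S.D 0 (k0 + 1) : ℝ) ≤ B1 * (K * Q ^ 2) * E := by
    have hTe : T ^ (1 / 300 : ℝ) ≤ c * E := by
      calc T ^ (1 / 300 : ℝ) ≤ (c * R ^ 2) ^ (1 / 300 : ℝ) := by rw [hT]; gcongr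
        _ = c ^ (1 / 300 : ℝ) * R ^ (2 / 300 : ℝ) := by
          rw [Real.mul_rpow (by linarith) (by positivity), ← Real.rpow_natCast R 2,
            ← Real.rpow_mul (by linarith)]; norm_num
        _ ≤ c * E := by
          gcongr
          · calc c ^ (1 / 300 : ℝ) ≤ c ^ (1 : ℝ) :=
                Real.rpow_le_rpow_of_exponent_le hc (by norm_num)
              _ = c := Real.rpow_one c
          · exact Real.rpow_le_rpow_of_exponent_le hR1 (by norm_num)
    calc (S.D 0 (k0 + 1) : ℝ) ≤ C * (S.D 0 k0 * (S.D 0 k0 : ℝ) ^ (1 / 300 : ℝ)) :=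
          hgrow 0 k0 (Nat.zero_le _)
      _ ≤ C * (T * T ^ (1 / 300 : ℝ)) := by gcongr
      _ ≤ C * (T * (c * E)) := by gcongr
      _ = _ := by rw [hT, hB1]; ring
  have hJ1 : k0 + 1 ≤ J₁ := by
    by_contra hlt
    have h1 := S.D_mono (Nat.zero_le J₁) (show J₁ ≤ k0 by omega)
    have h2 : T ≤ B1 * (R ^ 2 * E) := by
      rw [hT]
      calc c * (K * Q ^ 2) ≤ B1 * R ^ 2 := by gcongr
        _ = B1 * (R ^ 2 * 1) := by ring
        _ ≤ _ := by gcongr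
    linarith
  obtain ⟨k, hjk, hk3, hk4⟩ := S.exists_scale (k0 + 1) hsK1
  have hDm := S.one_le_D 0 (k0 + 1)
  have hkJ : k ≤ J₁ := by
    by_contra hlt
    have h1 := S.D_mono hJ1 (show J₁ ≤ k by omega)
    have h2 := S.D_le_mul (Nat.zero_le _) hJ1
    have h3 : (S.D 0 J₁ : ℝ) ≤ 2 * (B1 * (R ^ 2 * E)) := by
      calc (S.D 0 J₁ : ℝ) ≤ 2 * (S.D 0 (k0 + 1) * S.D (k0 + 1) J₁) := h2
        _ ≤ 2 * (B1 * (K * Q ^ 2) * E * Real.sqrt K) := by gcongr; linarith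
        _ = 2 * (B1 * (K * Q ^ 2 * Real.sqrt K * E)) := by ring
        _ ≤ _ := by gcongr
    linarith
  have hsx : Real.sqrt K ≤ 2 * C * B1 * S.D (k0 + 1) k * E := by
    have h0k : (S.D 0 k : ℝ) ≤ 2 * B1 * R ^ 3 := by
      calc (S.D 0 k : ℝ) ≤ 2 * (S.D 0 (k0 + 1) * S.D (k0 + 1) k) :=
            S.D_le_mul (Nat.zero_le _) hjk
        _ ≤ 2 * (B1 * (K * Q ^ 2) * E * Real.sqrt K) := by gcongr
        _ = 2 * B1 * (K * Q ^ 2 * Real.sqrt K * E) := by ring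
        _ ≤ 2 * B1 * (R ^ 2 * R) := by gcongr
        _ = _ := by ring
    have h1 : (S.D 0 k : ℝ) ^ (1 / 300 : ℝ) ≤ 2 * B1 * E := by
      calc (S.D 0 k : ℝ) ^ (1 / 300 : ℝ) ≤ (2 * B1 * R ^ 3) ^ (1 / 300 : ℝ) := by gcongr
        _ = (2 * B1) ^ (1 / 300 : ℝ) * E := by
          rw [Real.mul_rpow (by linarith) (by positivity), ← Real.rpow_natCast R 3,
            ← Real.rpow_mul (by linarith), hE]; norm_num
        _ ≤ _ := by
          gcongr
          calc (2 * B1) ^ (1 / 300 : ℝ) ≤ (2 * B1) ^ (1 : ℝ) :=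
                Real.rpow_le_rpow_of_exponent_le (by linarith) (by norm_num)
            _ = _ := Real.rpow_one _
    calc Real.sqrt K ≤ S.D (k0 + 1) (k + 1) := hk4.le
      _ ≤ C * (S.D (k0 + 1) k * (S.D 0 k : ℝ) ^ (1 / 300 : ℝ)) := hgrow _ _ hjk
      _ ≤ C * (S.D (k0 + 1) k * (2 * B1 * E)) := by gcongr
      _ = _ := by ring
  have hQ0 : (0 : ℝ) ≤ Q := by linarith
  have hQR : Q ≤ R := by rw [hR]; nlinarith
  obtain ⟨i, hi, hi2, hi3⟩ : ∃ i, i ≤ J₂ ∧ (i = 0 ∨ (S.D 0 i : ℝ) ^ 2 < Q) ∧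
      Real.sqrt Q ≤ 2 * C * S.D 0 i * E := by
    by_cases hQ4 : Real.sqrt Q / 2 < 1
    · refine ⟨0, Nat.zero_le _, Or.inl rfl, ?_⟩
      rw [D_self]
      push_cast
      have h1 : 1 ≤ C * E := one_le_mul_of_one_le_of_one_le hC hE1
      linarith
    · obtain ⟨i, -, h1, h2⟩ := S.exists_scale 0 (not_lt.1 hQ4)
      refine ⟨i, ?_, Or.inr ?_, ?_⟩
      · by_contra hlt
        have h3 := S.D_mono (Nat.zero_le J₂) (show J₂ ≤ i by omega)
        have h4 : 1 * Real.sqrt Q ≤ 3 * C * B1 * Real.sqrt Q :=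
          mul_le_mul_of_nonneg_right (by linarith) (Real.sqrt_nonneg Q)
        linarith
      · have h3 := S.one_le_D 0 i
        have h4 : (S.D 0 i : ℝ) ^ 2 ≤ (Real.sqrt Q / 2) ^ 2 := by gcongr
        rw [div_pow, Real.sq_sqrt hQ0] at h4
        linarith
      · have h3 : (S.D 0 i : ℝ) ≤ R := by
          have h4 : Real.sqrt Q ≤ Q := Real.sqrt_le_iff.2 ⟨hQ0, le_self_pow₀ hQ (by norm_num)⟩
          linarith
        have h5 : (S.D 0 i : ℝ) ^ (1 / 300 : ℝ) ≤ E := by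
          calc (S.D 0 i : ℝ) ^ (1 / 300 : ℝ) ≤ R ^ (1 / 300 : ℝ) := by gcongr
            _ ≤ _ := Real.rpow_le_rpow_of_exponent_le hR1 (by norm_num)
        have h6 : Real.sqrt Q / 2 ≤ C * (S.D 0 i * E) := by
          calc Real.sqrt Q / 2 ≤ S.D 0 (i + 1) := h2.le
            _ ≤ C * (S.D 0 i * (S.D 0 i : ℝ) ^ (1 / 300 : ℝ)) := hgrow _ _ (Nat.zero_le _)
            _ ≤ _ := by gcongr
        linarith
  refine ⟨k0 + 1, k, i, hjk, hkJ, hi, ?_, ?_, hi2, ?_, ?_, ?_⟩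
  · rw [mul_assoc]; exact hk2.le
  · refine (pow_le_pow_left₀ (by positivity) hk3 2).trans ?_
    rw [Real.sq_sqrt (by linarith)]
  · refine hm.trans ?_
    gcongr
    linarith
  · refine hsx.trans ?_
    gcongr
    linarith
  · refine hi3.trans ?_
    gcongr

open Classical in
lemma sum_inClass_le {κ : ℝ} (hκ : 1 ≤ κ) : ∃ C : ℝ, 1 ≤ C ∧
    ∀ {ι : Type} (J₁ J₂ L : ℕ) (I : Finset ι) (p : ι → Mat) (K Q : ℝ), S.Good J₁ J₂ I p κ L →
    1 ≤ K → 1 ≤ Q → C * ((K * Q) ^ 2 * (K * Q) ^ (1 / 100 : ℝ)) ≤ S.D 0 J₁ →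
    C * Real.sqrt Q ≤ S.D 0 J₂ → C * ((K * Q) ^ 2 * (K * Q) ^ (1 / 100 : ℝ)) ≤ L →
    ∑ t ∈ Finset.range L with ∃ a q, InClass L K Q t a q, ‖S.expSum J₁ J₂ I p L t‖ ^ 2 ≤
      C * (K * Q) ^ (-(1 / 20) : ℝ) * (S.vol J₁ J₂ I : ℝ) ^ 2 := by
  have hC0 := one_le_C0
  have hc : 1 ≤ 20 * (2 * C0 * κ) := by nlinarith
  obtain ⟨B, hB, hsplit⟩ := S.exists_split hc
  set A := 2304 * ((2 * (2 * C0 * κ) + 1) * (2 * (2 * C0 * κ + 2 * C0 ^ 2) + 2)) with hA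
  have hA0 : 0 ≤ A := by positivity
  have hB4 : B ≤ B ^ 4 := by
    calc B = B ^ 1 := (pow_one B).symm
      _ ≤ B ^ 4 := pow_le_pow_right₀ hB (by norm_num)
  have hBC : 6 * B ≤ A * B ^ 4 + 6 * B ^ 4 := by nlinarith
  refine ⟨A * B ^ 4 + 6 * B ^ 4, by linarith, ?_⟩
  intro ι J₁ J₂ L I p K Q hG hK hQ h1 h2 h3
  have hR1 : 1 ≤ K * Q := by nlinarith
  have hR0 : 0 < (K * Q) ^ 2 * (K * Q) ^ (1 / 100 : ℝ) := by positivity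
  obtain ⟨j, k, i, hjk, hk, hi, s1, s2, s3, s4, s5, s6⟩ := hsplit J₁ J₂ K Q hK hQ
    (by nlinarith) (by nlinarith [Real.sqrt_nonneg Q])
  have hL : 6 * S.D 0 j ≤ L := by
    have : (6 : ℝ) * S.D 0 j ≤ L := by
      calc (6 : ℝ) * S.D 0 j ≤ 6 * (B * (K * Q ^ 2) * (K * Q) ^ (1 / 100 : ℝ)) := by gcongr
        _ ≤ 6 * (B * (K * Q) ^ 2 * (K * Q) ^ (1 / 100 : ℝ)) := by
          gcongr 6 * (B * ?_ * _)
          rw [mul_pow]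
          gcongr
          nlinarith
        _ = 6 * B * ((K * Q) ^ 2 * (K * Q) ^ (1 / 100 : ℝ)) := by ring
        _ ≤ _ := (mul_le_mul_of_nonneg_right hBC hR0.le).trans h3
    exact_mod_cast this
  have key := sum_class_le hG hκ hjk hk hi hL hK hQ s1 s2 s3
  have hw := weight_le hB hK hQ (S.one_le_D 0 j) (S.one_le_D j k) (S.one_le_D 0 i) rfl s4 s5 s6
  have c1 := S.rpow_D_le_card (Nat.zero_le j)
  have c2 := S.rpow_D_le_card hjk
  have c3 := S.rpow_D_le_card (Nat.zero_le i)
  set W : ℝ := (S.U 0 j).card * (S.U j k).card * (S.U 0 i).card with hW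
  have hW0 : 0 < W := by
    have := (S.U_nonempty 0 j).card_pos
    have := (S.U_nonempty j k).card_pos
    have := (S.U_nonempty 0 i).card_pos
    rw [hW]; positivity
  have hD : (S.D 0 j : ℝ) ^ 2 ≤ W * (B ^ 4 * (K * Q) ^ (-(1 / 20) : ℝ)) := by
    refine hw.trans ?_
    rw [hW]
    gcongr
  refine le_of_mul_le_mul_right (key.trans ?_) hW0
  calc A * (S.D 0 j : ℝ) ^ 2 * (S.vol J₁ J₂ I : ℝ) ^ 2
      ≤ A * (W * (B ^ 4 * (K * Q) ^ (-(1 / 20) : ℝ))) * (S.vol J₁ J₂ I : ℝ) ^ 2 := by gcongr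
    _ = A * B ^ 4 * ((K * Q) ^ (-(1 / 20) : ℝ) * (S.vol J₁ J₂ I : ℝ) ^ 2 * W) := by ring
    _ ≤ (A * B ^ 4 + 6 * B ^ 4) * ((K * Q) ^ (-(1 / 20) : ℝ) * (S.vol J₁ J₂ I : ℝ) ^ 2 * W) := by
      gcongr
      linarith
    _ = _ := by ring

end Blocks

lemma card_le_mul_card_image {α β : Type*} [DecidableEq β] (s : Finset α) (f : α → β) {c : ℝ}
    (h : ∀ b ∈ s.image f, (({x ∈ s | f x = b} : Finset α).card : ℝ) ≤ c) :
    (s.card : ℝ) ≤ c * (s.image f).card := by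
  rw [Finset.card_eq_sum_card_image f s]
  push_cast
  calc _ ≤ ∑ b ∈ s.image f, c := Finset.sum_le_sum h
    _ = _ := by rw [Finset.sum_const, nsmul_eq_mul]; ring

lemma card_near_zero {θ η W : ℝ} {a q : ℤ} (cop : IsCoprime a q) (hq : 0 < q)
    (hθ : |θ - a / q| ≤ 1 / (q : ℝ) ^ 2) (hη : 0 ≤ η) (hW : 0 ≤ W) (T : Finset ℤ)
    (hT : ∀ w ∈ T, |(w : ℝ)| ≤ W ∧ ∃ z : ℤ, |θ * w - z| ≤ η) :
    (T.card : ℝ) ≤ (4 * q * η + 2) * (4 * W / q + 2) := by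
  classical
  have hq' : (0 : ℝ) < q := by exact_mod_cast hq
  choose! z hz using fun w hw => (hT w hw).2
  have h1 : ∀ b ∈ T.image (fun w : ℤ => ⌊2 * (w : ℝ) / q⌋),
      (({w ∈ T | ⌊2 * (w : ℝ) / q⌋ = b} : Finset ℤ).card : ℝ) ≤ 4 * q * η + 2 := by
    intro b _
    have key := card_spaced ({w ∈ T | ⌊2 * (w : ℝ) / q⌋ = b} : Finset ℤ)
      (fun w : ℤ => θ * w - z w) (δ := 1 / (2 * q)) (ρ := 2 * q * η) (c := 0) (by positivity)
      (by positivity) ?_ ?_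
    · linarith
    · intro w hw w' hw' hne
      rw [Finset.mem_filter] at hw hw'
      have hlt : |2 * (w : ℝ) / q - 2 * w' / q| < 1 :=
        Int.abs_sub_lt_one_of_floor_eq_floor (hw.2.trans hw'.2.symm)
      have hlt' : 2 * |(w : ℝ) - w'| < q := by
        rw [← sub_div, ← mul_sub, abs_div, abs_mul, abs_of_pos hq', div_lt_one hq'] at hlt
        simpa using hlt
      have hnz : a * (w - w') - q * (z w - z w') ≠ 0 := by
        intro h0
        have hd : q ∣ w - w' := cop.symm.dvd_of_dvd_mul_left ⟨z w - z w', by linarith⟩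
        have := Int.eq_zero_of_abs_lt_dvd hd (by
          have : (|w - w'| : ℝ) < q := by
            have := abs_nonneg ((w : ℝ) - w')
            linarith
          exact_mod_cast this)
        omega
      have hge : (1 : ℝ) ≤ |(a : ℝ) * (w - w') - q * (z w - z w')| := by
        exact_mod_cast Int.one_le_abs hnz
      have e : θ * w - z w - (θ * w' - z w') =
          ((a : ℝ) * (w - w') - q * (z w - z w')) / q + (θ - a / q) * (w - w') := by
        field_simp; ring
      have h3 : |(θ - a / q) * ((w : ℝ) - w')| ≤ 1 / (2 * q) := by
        rw [abs_mul]
        calc _ ≤ 1 / (q : ℝ) ^ 2 * (q / 2) := by gcongr; linarith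
          _ = _ := by field_simp
      have h4 : 1 / (q : ℝ) ≤ |((a : ℝ) * (w - w') - q * (z w - z w')) / q| := by
        rw [abs_div, abs_of_pos hq']; gcongr
      have h5 : 1 / (q : ℝ) = 1 / (2 * q) + 1 / (2 * q) := by field_simp; norm_num
      rw [e]
      have := abs_sub_abs_le_abs_add (((a : ℝ) * (w - w') - q * (z w - z w')) / q)
        ((θ - a / q) * ((w : ℝ) - w'))
      linarith
    · intro w hw
      rw [sub_zero]
      refine (hz w (Finset.mem_filter.1 hw).1).trans (le_of_eq ?_)
      field_simp
  refine (card_le_mul_card_image T _ h1).trans ?_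
  gcongr
  have hsub : T.image (fun w : ℤ => ⌊2 * (w : ℝ) / q⌋) ⊆
      Finset.Icc ⌊-(2 * W / q)⌋ ⌊2 * W / q⌋ := by
    intro b hb
    obtain ⟨w, hw, rfl⟩ := Finset.mem_image.1 hb
    obtain ⟨h2, h3⟩ := abs_le.1 (hT w hw).1
    rw [Finset.mem_Icc]
    constructor
    · apply Int.floor_le_floor; rw [← neg_div]; gcongr; linarith
    · apply Int.floor_le_floor; gcongr
  have hle : ⌊-(2 * W / q)⌋ ≤ ⌊2 * W / q⌋ + 1 := by
    have : ⌊-(2 * W / q)⌋ ≤ ⌊2 * W / q⌋ := Int.floor_le_floor (by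
      have : 0 ≤ 2 * W / q := by positivity
      linarith)
    omega
  have hc : ((Finset.Icc ⌊-(2 * W / q)⌋ ⌊2 * W / q⌋).card : ℝ) = ⌊2 * W / q⌋ + 1 - ⌊-(2 * W / q)⌋ := by
    rw [Int.card_Icc]
    have := Int.toNat_of_nonneg (sub_nonneg.2 hle)
    exact_mod_cast this
  calc ((T.image (fun w : ℤ => ⌊2 * (w : ℝ) / q⌋)).card : ℝ)
      ≤ (Finset.Icc ⌊-(2 * W / q)⌋ ⌊2 * W / q⌋).card := by exact_mod_cast Finset.card_le_card hsub
    _ = ⌊2 * W / q⌋ + 1 - ⌊-(2 * W / q)⌋ := hc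
    _ ≤ 4 * W / q + 2 := by
      have f1 := Int.floor_le (2 * W / q)
      have f2 := Int.lt_floor_add_one (-(2 * W / q))
      have : 4 * W / q = 2 * (2 * W / q) := by ring
      linarith

/-- Solutions of a fixed determinant equation in a box. -/
lemma card_wedge_eq {v₀ v₁ w : ℤ} (cop : IsCoprime v₀ v₁) (hv : 0 < v₁) {κ Y : ℝ} (hκ : 0 ≤ κ)
    (hY : Y ≤ κ * v₁) (s : Finset (ℤ × ℤ))
    (hs : ∀ x ∈ s, v₀ * x.2 - v₁ * x.1 = w ∧ 0 ≤ x.2 ∧ (x.2 : ℝ) ≤ Y) :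
    (s.card : ℝ) ≤ 2 * κ + 2 := by
  have hv' : (0 : ℝ) < v₁ := by exact_mod_cast hv
  apply card_spaced s (fun x => (x.2 : ℝ)) (δ := v₁) (c := 0) hv' hκ
  · intro x hx y hy hne
    have e : v₀ * (x.2 - y.2) = v₁ * (x.1 - y.1) := by linarith [(hs x hx).1, (hs y hy).1]
    have hd : v₁ ∣ x.2 - y.2 := cop.symm.dvd_of_dvd_mul_left ⟨_, e⟩
    have hnz : x.2 - y.2 ≠ 0 := by
      intro h0
      rw [h0, mul_zero] at e
      rcases mul_eq_zero.1 e.symm with h1 | h1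
      · omega
      · exact hne (Prod.ext (by omega) (by omega))
    have := Int.le_of_dvd (abs_pos.2 hnz) ((dvd_abs _ _).2 hd)
    exact_mod_cast this
  · intro x hx
    have h0 : (0 : ℝ) ≤ x.2 := by exact_mod_cast (hs x hx).2.1
    rw [sub_zero, abs_of_nonneg h0]
    exact (hs x hx).2.2.trans hY

namespace Blocks

variable {S : Blocks}

lemma col_snd_inj {J₂ : ℕ} {P y y' : Mat} (hP : Adm P) (hy : y ∈ S.U 0 J₂) (hy' : y' ∈ S.U 0 J₂)
    (h0 : (P * y.transpose) 0 1 = (P * y'.transpose) 0 1)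
    (h1 : (P * y.transpose) 1 1 = (P * y'.transpose) 1 1) : y = y' := by
  have hd : P.det ≠ 0 := by rcases hP.det with h | h <;> rw [h] <;> norm_num
  simp only [Matrix.mul_apply, Fin.sum_univ_two, Matrix.transpose_apply] at h0 h1
  rw [Matrix.det_fin_two] at hd
  refine row_inj (S.U_subset _ _ hy) (S.U_subset _ _ hy') ?_ ?_
  · apply mul_left_cancel₀ hd
    linear_combination P 1 1 * h0 - P 0 1 * h1
  · apply mul_left_cancel₀ hd
    linear_combination P 0 0 * h1 - P 1 0 * h0

lemma count_middle {ι : Type*} {J₂ L m : ℕ} {I : Finset ι} {p : ι → Mat} {κ : ℝ}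
    (hadm : ∀ h ∈ I, Adm (p h)) (hκ : 1 ≤ κ) (hL : 0 < L) (hm : 0 < m)
    (hb : ∀ h ∈ I, ∀ y ∈ S.U 0 J₂, (L : ℝ) ≤ κ * (m * ((p h * y.transpose) 1 1 : ℤ)) ∧
      (m : ℝ) * ((p h * y.transpose) 1 1 : ℤ) ≤ κ * L)
    (hmL : κ * L ≤ (m : ℝ) ^ 2) {t : ℕ} {a q : ℤ} (cop : IsCoprime a q) (hq : 0 < q)
    (ht : |(t : ℝ) / L - a / q| ≤ 1 / (q : ℝ) ^ 2) {v : ι × Mat} (hv : v ∈ I ×ˢ S.U 0 J₂)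
    (A : Finset (ℕ × ι × Mat)) (hA : ∀ y ∈ A, y.1 < L ∧ y.2 ∈ I ×ˢ S.U 0 J₂ ∧
      Near L m (t * (p v.1 * v.2.transpose) 0 1 - y.1 * (p y.2.1 * y.2.2.transpose) 0 1) ∧
      Near L m (t * (p v.1 * v.2.transpose) 1 1 - y.1 * (p y.2.1 * y.2.2.transpose) 1 1)) :
    (A.card : ℝ) ≤ (2 * κ + 1) * (I.card * ((2 * κ ^ 2 + 2) *
      ((4 * q * (κ * L / m ^ 2) + 2) * (4 * (κ * L / m) ^ 2 / q + 2)))) := by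
  classical
  set X : ι × Mat → Mat := fun v => p v.1 * v.2.transpose with hX
  have hmr : (0 : ℝ) < m := by exact_mod_cast hm
  have hLr : (0 : ℝ) < L := by exact_mod_cast hL
  have hXadm : ∀ v ∈ I ×ˢ S.U 0 J₂, Adm (X v) := by
    intro v hv
    rw [Finset.mem_product] at hv
    exact (hadm _ hv.1).mul (adm hv.2).transpose
  have hlo : ∀ v ∈ I ×ˢ S.U 0 J₂, (L : ℝ) ≤ κ * (m * (X v 1 1 : ℤ)) := by
    intro v hv
    rw [Finset.mem_product] at hv
    exact (hb _ hv.1 _ hv.2).1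
  have hhi : ∀ v ∈ I ×ˢ S.U 0 J₂, (X v 1 1 : ℝ) ≤ κ * L / m := by
    intro v hv
    rw [Finset.mem_product] at hv
    rw [le_div_iff₀ hmr, mul_comm]
    exact (hb _ hv.1 _ hv.2).2
  choose! r₀ z₀ e₀ b₀ using fun y hy => (hA y hy).2.2.1
  choose! r₁ z₁ e₁ b₁ using fun y hy => (hA y hy).2.2.2
  have b₀' : ∀ y ∈ A, |(r₀ y : ℝ)| * (6 * m) < L := fun y hy => by exact_mod_cast b₀ y hy
  have b₁' : ∀ y ∈ A, |(r₁ y : ℝ)| * (6 * m) < L := fun y hy => by exact_mod_cast b₁ y hy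
  set F : ι × Mat → ℤ × ℤ := fun v => (X v 0 1, X v 1 1) with hF
  set G : ℤ × ℤ → ℤ := fun x => X v 0 1 * x.2 - X v 1 1 * x.1 with hGdef
  have hAv := hXadm v hv
  have step1 : (A.card : ℝ) ≤ (2 * κ + 1) * (A.image Prod.snd).card := by
    refine card_le_mul_card_image A Prod.snd fun b hb' => ?_
    have hinj : Set.InjOn Prod.fst (({y ∈ A | y.2 = b} : Finset _) : Set (ℕ × ι × Mat)) := by
      intro x hx y hy hxy
      rw [Finset.coe_filter, Set.mem_ofPred_eq] at hx hy
      exact Prod.ext hxy (hx.2.trans hy.2.symm)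
    rw [← Finset.card_image_of_injOn hinj]
    apply card_close_mod (L := L) _ _ (by linarith)
    · intro t₁ h₁ t₂ h₂
      obtain ⟨y, hy, rfl⟩ := Finset.mem_image.1 h₁
      obtain ⟨z, hz, rfl⟩ := Finset.mem_image.1 h₂
      rw [Finset.mem_filter] at hy hz
      have hbV : b ∈ I ×ˢ S.U 0 J₂ := hy.2 ▸ (hA y hy.1).2.1
      have hAb := hXadm b hbV
      have ey₀ := e₀ y hy.1
      have ey₁ := e₁ y hy.1
      have ez₀ := e₀ z hz.1
      have ez₁ := e₁ z hz.1
      change t * X v 0 1 - y.1 * X y.2 0 1 = _ at ey₀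
      change t * X v 1 1 - y.1 * X y.2 1 1 = _ at ey₁
      change t * X v 0 1 - z.1 * X z.2 0 1 = _ at ez₀
      change t * X v 1 1 - z.1 * X z.2 1 1 = _ at ez₁
      rw [hy.2] at ey₀ ey₁
      rw [hz.2] at ez₀ ez₁
      set x₀ := X b 0 1
      set x₁ := X b 1 1
      have hx1 : (0 : ℝ) < x₁ := by exact_mod_cast hAb.d_pos
      have hx0 : (0 : ℝ) ≤ x₀ := by exact_mod_cast hAb.bounds.2.1
      have hx01 : (x₀ : ℝ) ≤ x₁ := by exact_mod_cast hAb.bounds.2.2.2.1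
      have hx1hi : (x₁ : ℝ) ≤ κ * L / m := hhi b hbV
      have hwedge : (z₀ z - z₀ y) * x₁ - (z₁ z - z₁ y) * x₀ = 0 := by
        have e : L * ((z₀ z - z₀ y) * x₁ - (z₁ z - z₁ y) * x₀) =
            (r₀ y - r₀ z) * x₁ - (r₁ y - r₁ z) * x₀ := by
          linear_combination x₁ * (ey₀ - ez₀) - x₀ * (ey₁ - ez₁)
        by_contra hne
        have h1 : (1 : ℝ) ≤ |(((z₀ z - z₀ y) * x₁ - (z₁ z - z₁ y) * x₀ : ℤ) : ℝ)| := by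
          exact_mod_cast Int.one_le_abs hne
        have eR : (L : ℝ) * (((z₀ z - z₀ y) * x₁ - (z₁ z - z₁ y) * x₀ : ℤ) : ℝ) =
            (r₀ y - r₀ z) * x₁ - (r₁ y - r₁ z) * x₀ := by exact_mod_cast e
        have h2 : |((r₀ y : ℝ) - r₀ z) * x₁ - (r₁ y - r₁ z) * x₀| ≤
            (|(r₀ y : ℝ)| + |(r₀ z : ℝ)|) * x₁ + (|(r₁ y : ℝ)| + |(r₁ z : ℝ)|) * x₁ := by
          refine (abs_sub _ _).trans ?_
          rw [abs_mul, abs_mul, abs_of_pos hx1, abs_of_nonneg hx0]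
          gcongr <;> exact abs_sub _ _
        rw [← eR, abs_mul, abs_of_pos hLr] at h2
        have h3 : (L : ℝ) * (6 * m) < 4 * L * x₁ := by
          calc (L : ℝ) * (6 * m) ≤ L * |(((z₀ z - z₀ y) * x₁ - (z₁ z - z₁ y) * x₀ : ℤ) : ℝ)| *
                (6 * m) := by
                gcongr
                exact le_mul_of_one_le_right hLr.le h1
            _ ≤ ((|(r₀ y : ℝ)| + |(r₀ z : ℝ)|) * x₁ + (|(r₁ y : ℝ)| + |(r₁ z : ℝ)|) * x₁) *
                (6 * m) := by gcongr
            _ = (|(r₀ y : ℝ)| * (6 * m) + |(r₀ z : ℝ)| * (6 * m) + |(r₁ y : ℝ)| * (6 * m) +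
                |(r₁ z : ℝ)| * (6 * m)) * x₁ := by ring
            _ < (L + L + L + L) * x₁ := by
              gcongr
              · exact b₀' y hy.1
              · exact b₀' z hz.1
              · exact b₁' y hy.1
              · exact b₁' z hz.1
            _ = _ := by ring
        have h4 : (6 : ℝ) * m < 4 * x₁ := by
          refine lt_of_mul_lt_mul_left ?_ hLr.le
          linarith
        have h5 : κ * L / m ≤ m := by rw [div_le_iff₀ hmr, ← sq]; exact hmL
        linarith
      obtain ⟨c, hc⟩ : x₁ ∣ z₁ z - z₁ y :=
        hAb.coprime_col.symm.dvd_of_dvd_mul_right ⟨z₀ z - z₀ y, by linarith⟩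
      refine ⟨c, ?_⟩
      have e : ((y.1 : ℤ) - z.1 - c * L) * x₁ = r₁ z - r₁ y := by
        linear_combination ez₁ - ey₁ + L * hc
      have eR : ((y.1 : ℝ) - z.1 - c * L) * x₁ = r₁ z - r₁ y := by exact_mod_cast e
      have h1 : |(y.1 : ℝ) - z.1 - c * L| * x₁ ≤ |(r₁ z : ℝ)| + |(r₁ y : ℝ)| := by
        have e' : |(y.1 : ℝ) - z.1 - c * L| * x₁ = |((y.1 : ℝ) - z.1 - c * L) * x₁| := by
          rw [abs_mul, abs_of_pos hx1]
        rw [e', eR]; exact abs_sub _ _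
      have h2 : |(y.1 : ℝ) - z.1 - c * L| * (m * x₁) ≤ κ * (m * x₁) := by
        have h3 := b₁' y hy.1
        have h4 := b₁' z hz.1
        have h5 : (|(y.1 : ℝ) - z.1 - c * L| * x₁) * m ≤ (|(r₁ z : ℝ)| + |(r₁ y : ℝ)|) * m := by
          gcongr
        have h6 : (L : ℝ) ≤ κ * (m * x₁) := hlo b hbV
        nlinarith
      exact le_of_mul_le_mul_right h2 (by positivity)
    · intro t₁ h₁
      obtain ⟨y, hy, rfl⟩ := Finset.mem_image.1 h₁
      exact (hA y (Finset.mem_filter.1 hy).1).1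
  set B := A.image Prod.snd with hB
  have hBV : ∀ b ∈ B, b ∈ I ×ˢ S.U 0 J₂ := by
    intro b hb
    obtain ⟨y, hy, rfl⟩ := Finset.mem_image.1 hb
    exact (hA y hy).2.1
  have step2 : (B.card : ℝ) ≤ I.card * (B.image F).card := by
    refine card_le_mul_card_image B F fun x _ => ?_
    have : ({b ∈ B | F b = x} : Finset _).card ≤ I.card := by
      refine Finset.card_le_card_of_injOn Prod.fst ?_ ?_
      · intro b hb
        rw [Finset.coe_filter, Set.mem_ofPred_eq] at hb
        exact (Finset.mem_product.1 (hBV b hb.1)).1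
      · rintro ⟨h, y⟩ hy ⟨h', y'⟩ hy' hhy
        rw [Finset.coe_filter, Set.mem_ofPred_eq] at hy hy'
        obtain ⟨hy, ey⟩ := hy
        obtain ⟨hy', ey'⟩ := hy'
        simp only at hhy
        subst hhy
        have m1 := Finset.mem_product.1 (hBV _ hy)
        have m2 := Finset.mem_product.1 (hBV _ hy')
        have e := ey.trans ey'.symm
        simp only [hF, Prod.mk.injEq] at e
        have e2 : y = y' := col_snd_inj (hadm _ m1.1) m1.2 m2.2 e.1 e.2
        rw [e2]
    exact_mod_cast this
  have step3 : ((B.image F).card : ℝ) ≤ (2 * κ ^ 2 + 2) * ((B.image F).image G).card := by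
    refine card_le_mul_card_image _ G fun w _ => ?_
    refine card_wedge_eq (w := w) (Y := κ * L / m) hAv.coprime_col hAv.d_pos (sq_nonneg κ) ?_ _ ?_
    · rw [div_le_iff₀ hmr]
      calc κ * L ≤ κ * (κ * (m * (X v 1 1 : ℤ))) := by gcongr; exact hlo v hv
        _ = _ := by ring
    · intro x hx
      obtain ⟨hx, hw⟩ := Finset.mem_filter.1 hx
      obtain ⟨b, hb, rfl⟩ := Finset.mem_image.1 hx
      exact ⟨hw, (hXadm b (hBV b hb)).d_pos.le, hhi b (hBV b hb)⟩
  have step4 : ((((B.image F).image G).card : ℕ) : ℝ) ≤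
      (4 * q * (κ * L / m ^ 2) + 2) * (4 * (κ * L / m) ^ 2 / q + 2) := by
    refine card_near_zero cop hq ht (by positivity) (by positivity) _ ?_
    intro w hw
    obtain ⟨x, hx, rfl⟩ := Finset.mem_image.1 hw
    obtain ⟨b, hb, rfl⟩ := Finset.mem_image.1 hx
    have hbV := hBV b hb
    obtain ⟨y, hy, rfl⟩ := Finset.mem_image.1 hb
    have hAb := hXadm _ hbV
    have hx1hi := hhi _ hbV
    have hv1hi := hhi _ hv
    have ey₀ := e₀ y hy
    have ey₁ := e₁ y hy
    change t * X v 0 1 - y.1 * X y.2 0 1 = _ at ey₀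
    change t * X v 1 1 - y.1 * X y.2 1 1 = _ at ey₁
    have hx1 : (0 : ℝ) < X y.2 1 1 := by exact_mod_cast hAb.d_pos
    have hx0 : (0 : ℝ) ≤ X y.2 0 1 := by exact_mod_cast hAb.bounds.2.1
    have hx01 : (X y.2 0 1 : ℝ) ≤ X y.2 1 1 := by exact_mod_cast hAb.bounds.2.2.2.1
    have hv1 : (0 : ℝ) < X v 1 1 := by exact_mod_cast hAv.d_pos
    have hv0 : (0 : ℝ) ≤ X v 0 1 := by exact_mod_cast hAv.bounds.2.1
    have hv01 : (X v 0 1 : ℝ) ≤ X v 1 1 := by exact_mod_cast hAv.bounds.2.2.2.1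
    simp only [hGdef, hF]
    set x₀ := X y.2 0 1
    set x₁ := X y.2 1 1
    set v₀ := X v 0 1
    set v₁ := X v 1 1
    constructor
    · push_cast
      have h1 : (v₀ : ℝ) * x₁ ≤ κ * L / m * (κ * L / m) := by gcongr; linarith
      have h2 : (v₁ : ℝ) * x₀ ≤ κ * L / m * (κ * L / m) := by gcongr; linarith
      have h3 : (0 : ℝ) ≤ v₀ * x₁ := by positivity
      have h4 : (0 : ℝ) ≤ v₁ * x₀ := by positivity
      rw [abs_le, sq]
      constructor <;> linarith
    · refine ⟨z₀ y * x₁ - z₁ y * x₀, ?_⟩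
      have e : t * (v₀ * x₁ - v₁ * x₀) - L * (z₀ y * x₁ - z₁ y * x₀) =
          r₀ y * x₁ - r₁ y * x₀ := by
        linear_combination x₁ * ey₀ - x₀ * ey₁
      have eR : (t : ℝ) / L * ((v₀ * x₁ - v₁ * x₀ : ℤ) : ℝ) - ((z₀ y * x₁ - z₁ y * x₀ : ℤ) : ℝ) =
          (r₀ y * x₁ - r₁ y * x₀) / L := by
        have : (t : ℝ) * ((v₀ * x₁ - v₁ * x₀ : ℤ) : ℝ) - L * ((z₀ y * x₁ - z₁ y * x₀ : ℤ) : ℝ) =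
          r₀ y * x₁ - r₁ y * x₀ := by exact_mod_cast e
        rw [← this]
        field_simp
      rw [eR, abs_div, abs_of_pos hLr, div_le_div_iff₀ hLr (by positivity)]
      have h1 : |(r₀ y : ℝ) * x₁ - r₁ y * x₀| ≤ |(r₀ y : ℝ)| * x₁ + |(r₁ y : ℝ)| * x₁ := by
        refine (abs_sub _ _).trans ?_
        rw [abs_mul, abs_mul, abs_of_pos hx1, abs_of_nonneg hx0]
        gcongr
      have h2 : |(r₀ y : ℝ) * x₁ - r₁ y * x₀| * m ≤ L * x₁ := by
        have h3 := b₀' y hy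
        have h4 := b₁' y hy
        have h5 : (|(r₀ y : ℝ)| * m + |(r₁ y : ℝ)| * m) * x₁ ≤ L * x₁ := by gcongr; linarith
        calc _ ≤ (|(r₀ y : ℝ)| * x₁ + |(r₁ y : ℝ)| * x₁) * m := by gcongr
          _ = (|(r₀ y : ℝ)| * m + |(r₁ y : ℝ)| * m) * x₁ := by ring
          _ ≤ _ := h5
      have h3 : (x₁ : ℝ) * m ≤ κ * L := (le_div_iff₀ hmr).1 hx1hi
      calc _ = |(r₀ y : ℝ) * x₁ - r₁ y * x₀| * m * m := by ring
        _ ≤ L * x₁ * m := by gcongr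
        _ = L * (x₁ * m) := by ring
        _ ≤ L * (κ * L) := by gcongr
        _ = _ := by ring
  calc (A.card : ℝ) ≤ (2 * κ + 1) * B.card := step1
    _ ≤ (2 * κ + 1) * (I.card * ((2 * κ ^ 2 + 2) *
        ((4 * q * (κ * L / m ^ 2) + 2) * (4 * (κ * L / m) ^ 2 / q + 2)))) := by
      refine mul_le_mul_of_nonneg_left (step2.trans ?_) (by linarith)
      refine mul_le_mul_of_nonneg_left (step3.trans ?_) (by positivity)
      exact mul_le_mul_of_nonneg_left step4 (by positivity)

end Blocks

/-- `t / L` has a Dirichlet approximation `a / q` with `q ∈ [Q₁, Q₂]`. -/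
def InMiddle (L : ℕ) (Q₁ Q₂ : ℝ) (t : ℕ) (a q : ℤ) : Prop :=
  IsCoprime a q ∧ Q₁ ≤ q ∧ q ≤ Q₂ ∧ |(t : ℝ) / L - a / q| ≤ 1 / (q : ℝ) ^ 2

namespace Blocks

variable {S : Blocks}

open Classical in
lemma sum_middle_le {ι : Type*} {J₁ J₂ L : ℕ} {I : Finset ι} {p : ι → Mat} {κ Q₁ Q₂ : ℝ}
    (hG : S.Good J₁ J₂ I p κ L) (hκ : 1 ≤ κ) (hL0 : 0 < L) (hL : 6 * S.D 0 J₁ ≤ L)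
    (hmL : 2 * C0 * κ * L ≤ (S.D 0 J₁ : ℝ) ^ 2) (hQ₁ : 0 < Q₁) (hQ₂ : 0 ≤ Q₂) :
    (∑ t ∈ Finset.range L with ∃ a q, InMiddle L Q₁ Q₂ t a q, ‖S.expSum J₁ J₂ I p L t‖ ^ 2) *
      ((S.U 0 J₁).card * (S.U 0 J₂).card) ≤
      2304 * ((2 * (2 * C0 * κ) + 1) * (2 * (2 * C0 * κ) ^ 2 + 2)) * ((S.D 0 J₁ : ℝ) ^ 2 *
        (16 * (2 * C0 * κ * L / (S.D 0 J₁ : ℝ) ^ 2) * (2 * C0 * κ * L / S.D 0 J₁) ^ 2 +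
          8 * Q₂ * (2 * C0 * κ * L / (S.D 0 J₁ : ℝ) ^ 2) +
          8 * (2 * C0 * κ * L / S.D 0 J₁) ^ 2 / Q₁ + 4)) * (S.vol J₁ J₂ I : ℝ) ^ 2 := by
  have hC0 := one_le_C0
  have hκ1 : 1 ≤ 2 * C0 * κ := by nlinarith
  have hD1 := S.one_le_D 0 J₁
  have hm0 : (0 : ℝ) < S.D 0 J₁ := by linarith
  have hm : 0 < S.D 0 J₁ := by exact_mod_cast hm0
  set κ' := 2 * C0 * κ with hκ'
  have hLr : (0 : ℝ) < L := by exact_mod_cast hL0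
  set M : ℝ := (2 * κ' + 1) * (I.card * ((2 * κ' ^ 2 + 2) *
      (16 * (κ' * L / (S.D 0 J₁ : ℝ) ^ 2) * (κ' * L / S.D 0 J₁) ^ 2 +
          8 * Q₂ * (κ' * L / (S.D 0 J₁ : ℝ) ^ 2) + 8 * (κ' * L / S.D 0 J₁) ^ 2 / Q₁ + 4))) with hM
  have hM0 : 0 ≤ M := by positivity
  have hone : (1 : Mat) ∈ S.U J₁ J₁ := by rw [U_self]; exact Finset.mem_one.2 rfl
  set P := {t ∈ Finset.range L | ∃ a q, InMiddle L Q₁ Q₂ t a q} with hP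
  have key := S.bilinear_bound_U P (I ×ˢ S.U 0 J₂) (fun v => p v.1 * v.2.transpose) J₁ hL hM0 (by
    intro t ht v hv A hA
    rw [hP, Finset.mem_filter, Finset.mem_range] at ht
    obtain ⟨-, a, q, cop, h1, h2, h3⟩ := ht
    have hq : (0 : ℝ) < q := hQ₁.trans_le h1
    refine (count_middle (κ := κ') (fun h hh => hG.adm h hh) hκ1 hL0 hm ?_ hmL cop
      (by exact_mod_cast hq) h3 hv A ?_).trans ?_
    · intro h hh y hy
      have := hG.bounds_of_split hκ le_rfl hone hh hy
      rwa [one_mul] at this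
    · intro y hy
      obtain ⟨h4, h5, h6⟩ := hA y hy
      rw [hP, Finset.mem_filter, Finset.mem_range] at h4
      exact ⟨h4.1, h5, h6⟩
    · rw [hM]
      have e : ∀ x y : ℝ, (4 * q * x + 2) * (4 * y / q + 2) =
          16 * x * y + 8 * q * x + 8 * y / q + 4 := by
        intro x y
        field_simp
        ring
      rw [e]
      gcongr)
  have e : ∀ t, S.expSum J₁ J₂ I p L t = ∑ u ∈ S.U 0 J₁, ∑ v ∈ I ×ˢ S.U 0 J₂,
      ex (t * ((u * (p v.1 * v.2.transpose)) 1 1 : ℤ) / L) := by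
    intro t
    rw [expSum]
    refine Finset.sum_congr rfl fun u _ => ?_
    rw [Finset.sum_product]
    simp only [Matrix.mul_assoc]
  simp only [e]
  refine (mul_le_mul_of_nonneg_right key (by positivity)).trans (le_of_eq ?_)
  rw [Finset.card_product, vol, hM]
  push_cast
  ring

end Blocks

lemma exists_forall_le_rpow (B : ℝ) {c : ℝ} (hc : 0 < c) :
    ∃ N : ℕ, ∀ L : ℕ, N ≤ L → B ≤ (L : ℝ) ^ c := by
  have h := ((tendsto_rpow_atTop hc).comp tendsto_natCast_atTop_atTop).eventually_ge_atTop B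
  exact Filter.eventually_atTop.1 h

namespace Blocks

variable (S : Blocks)

/-- The scales used in the circle method. -/
structure Scales (J₁ J₂ L : ℕ) : Prop where
  lo₁ : (L : ℝ) ^ (0.7735 : ℝ) ≤ S.D 0 J₁
  hi₁ : S.D 0 J₁ ≤ (L : ℝ) ^ (0.7755 : ℝ)
  lo₂ : (L : ℝ) ^ (0.2187 : ℝ) ≤ S.D 0 J₂

variable {S}

lemma middle_weight_le {J₁ J₂ L : ℕ} {κ : ℝ} (hκ : 1 ≤ κ) (hL : 1 ≤ L) (h : S.Scales J₁ J₂ L) :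
    (S.D 0 J₁ : ℝ) ^ 2 *
        (16 * (κ * L / (S.D 0 J₁ : ℝ) ^ 2) * (κ * L / S.D 0 J₁) ^ 2 +
          8 * (L : ℝ) ^ (0.62 : ℝ) * (κ * L / (S.D 0 J₁ : ℝ) ^ 2) +
          8 * (κ * L / S.D 0 J₁) ^ 2 / (L : ℝ) ^ (0.38 : ℝ) + 4) ≤
      36 * κ ^ 3 * (L : ℝ) ^ (-0.006 : ℝ) * ((S.U 0 J₁).card * (S.U 0 J₂).card) := by
  obtain ⟨h1, h2, h3⟩ := h
  have hX : (1 : ℝ) ≤ L := by exact_mod_cast hL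
  set X : ℝ := (L : ℝ)
  have hX0 : 0 < X := by linarith
  set m : ℝ := (S.D 0 J₁ : ℝ) with hm
  have hm1 : 1 ≤ m := S.one_le_D 0 J₁
  have hm0 : 0 < m := by linarith
  have c1 : m ^ (41 / 25 : ℝ) ≤ (S.U 0 J₁).card := S.rpow_D_le_card (Nat.zero_le J₁)
  have c2 := S.rpow_D_le_card (Nat.zero_le J₂)
  have hκ3 : κ ≤ κ ^ 3 := le_self_pow₀ hκ (by norm_num)
  have hκ23 : κ ^ 2 ≤ κ ^ 3 := pow_le_pow_right₀ hκ (by norm_num)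
  have hκ13 : 1 ≤ κ ^ 3 := one_le_pow₀ hκ
  have hmul : ∀ x y : ℝ, X ^ x * X ^ y = X ^ (x + y) := fun x y => (Real.rpow_add hX0 x y).symm
  have hmono : ∀ {x y : ℝ}, x ≤ y → X ^ x ≤ X ^ y := fun h =>
    Real.rpow_le_rpow_of_exponent_le hX h
  have hm2 : X ^ (1.547 : ℝ) ≤ m ^ 2 := by
    calc X ^ (1.547 : ℝ) = (X ^ (0.7735 : ℝ)) ^ 2 := by
          rw [← Real.rpow_natCast, ← Real.rpow_mul hX0.le]; norm_num
      _ ≤ _ := by gcongr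
  have hA : κ * X / m ^ 2 ≤ κ * X ^ (-0.547 : ℝ) := by
    rw [div_le_iff₀ (by positivity)]
    calc κ * X = κ * X ^ (-0.547 : ℝ) * X ^ (1.547 : ℝ) := by
          rw [mul_assoc, hmul]; norm_num
      _ ≤ _ := by gcongr
  have hB : (κ * X / m) ^ 2 ≤ κ ^ 2 * X ^ (0.453 : ℝ) := by
    calc (κ * X / m) ^ 2 = κ * X * (κ * X / m ^ 2) := by field_simp
      _ ≤ κ * X * (κ * X ^ (-0.547 : ℝ)) := by gcongr
      _ = κ ^ 2 * (X ^ (1 : ℝ) * X ^ (-0.547 : ℝ)) := by rw [Real.rpow_one]; ring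
      _ = _ := by rw [hmul]; norm_num
  have t1 : 16 * (κ * X / m ^ 2) * (κ * X / m) ^ 2 ≤ 16 * κ ^ 3 * X ^ (0.073 : ℝ) := by
    calc _ ≤ 16 * (κ * X ^ (-0.547 : ℝ)) * (κ ^ 2 * X ^ (0.453 : ℝ)) := by gcongr
      _ = 16 * κ ^ 3 * (X ^ (-0.547 : ℝ) * X ^ (0.453 : ℝ)) := by ring
      _ ≤ _ := by
        rw [hmul]
        exact mul_le_mul_of_nonneg_left (hmono (by norm_num)) (by positivity)
  have t2 : 8 * X ^ (0.62 : ℝ) * (κ * X / m ^ 2) ≤ 8 * κ ^ 3 * X ^ (0.073 : ℝ) := by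
    calc _ ≤ 8 * X ^ (0.62 : ℝ) * (κ * X ^ (-0.547 : ℝ)) := by gcongr
      _ = 8 * κ * (X ^ (0.62 : ℝ) * X ^ (-0.547 : ℝ)) := by ring
      _ = 8 * κ * X ^ (0.073 : ℝ) := by rw [hmul]; norm_num
      _ ≤ _ := by gcongr
  have t3 : 8 * (κ * X / m) ^ 2 / X ^ (0.38 : ℝ) ≤ 8 * κ ^ 3 * X ^ (0.073 : ℝ) := by
    rw [div_le_iff₀ (by positivity)]
    calc _ ≤ 8 * (κ ^ 2 * X ^ (0.453 : ℝ)) := by gcongr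
      _ = 8 * κ ^ 2 * (X ^ (0.073 : ℝ) * X ^ (0.38 : ℝ)) := by rw [hmul]; norm_num; ring
      _ ≤ 8 * κ ^ 3 * (X ^ (0.073 : ℝ) * X ^ (0.38 : ℝ)) := by gcongr
      _ = _ := by ring
  have t4 : (4 : ℝ) ≤ 4 * κ ^ 3 * X ^ (0.073 : ℝ) := by
    have := Real.one_le_rpow hX (show (0 : ℝ) ≤ 0.073 by norm_num)
    nlinarith
  have s1 : m ^ 2 ≤ (S.U 0 J₁).card * X ^ (0.27918 : ℝ) := by
    calc m ^ 2 = m ^ (41 / 25 : ℝ) * m ^ (0.36 : ℝ) := by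
          rw [← Real.rpow_add hm0, ← Real.rpow_natCast]; norm_num
      _ ≤ (S.U 0 J₁).card * (X ^ (0.7755 : ℝ)) ^ (0.36 : ℝ) := by gcongr
      _ = _ := by rw [← Real.rpow_mul hX0.le]; norm_num
  have s2 : X ^ (0.358668 : ℝ) ≤ (S.U 0 J₂).card := by
    calc X ^ (0.358668 : ℝ) = (X ^ (0.2187 : ℝ)) ^ (41 / 25 : ℝ) := by
          rw [← Real.rpow_mul hX0.le]; norm_num
      _ ≤ (S.D 0 J₂ : ℝ) ^ (41 / 25 : ℝ) := by gcongr
      _ ≤ _ := c2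
  calc _ ≤ (S.U 0 J₁).card * X ^ (0.27918 : ℝ) * (36 * κ ^ 3 * X ^ (0.073 : ℝ)) := by
        gcongr
        linarith
    _ = 36 * κ ^ 3 * ((S.U 0 J₁).card * (X ^ (0.27918 : ℝ) * X ^ (0.073 : ℝ))) := by ring
    _ ≤ 36 * κ ^ 3 * ((S.U 0 J₁).card * (X ^ (-0.006 : ℝ) * X ^ (0.358668 : ℝ))) := by
      rw [hmul, hmul]
      gcongr _ * (_ * ?_)
      exact hmono (by norm_num)
    _ ≤ 36 * κ ^ 3 * ((S.U 0 J₁).card * (X ^ (-0.006 : ℝ) * (S.U 0 J₂).card)) := by gcongr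
    _ = _ := by ring

variable (S)

open Classical in
lemma sum_middle_rpow_le {κ : ℝ} (hκ : 1 ≤ κ) : ∃ C : ℝ, 1 ≤ C ∧ ∃ N : ℕ,
    ∀ {ι : Type} (J₁ J₂ L : ℕ) (I : Finset ι) (p : ι → Mat), N ≤ L → S.Good J₁ J₂ I p κ L →
    S.Scales J₁ J₂ L →
    ∑ t ∈ Finset.range L with
      ∃ a q, InMiddle L ((L : ℝ) ^ (0.38 : ℝ)) ((L : ℝ) ^ (0.62 : ℝ)) t a q,
        ‖S.expSum J₁ J₂ I p L t‖ ^ 2 ≤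
      C * (L : ℝ) ^ (-0.006 : ℝ) * (S.vol J₁ J₂ I : ℝ) ^ 2 := by
  have hC0 := one_le_C0
  set κ' := 2 * C0 * κ with hκ'
  have hκ1 : 1 ≤ κ' := by nlinarith
  obtain ⟨N₁, hN₁⟩ := exists_forall_le_rpow 6 (show (0 : ℝ) < 0.2245 by norm_num)
  obtain ⟨N₂, hN₂⟩ := exists_forall_le_rpow κ' (show (0 : ℝ) < 0.547 by norm_num)
  set A := 2304 * ((2 * κ' + 1) * (2 * κ' ^ 2 + 2)) with hA
  have hA1 : 1 ≤ A := by
    have : (1 : ℝ) ≤ (2 * κ' + 1) * (2 * κ' ^ 2 + 2) :=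
      one_le_mul_of_one_le_of_one_le (by linarith) (by nlinarith)
    linarith
  refine ⟨A * (36 * κ' ^ 3), one_le_mul_of_one_le_of_one_le hA1
    (by nlinarith [one_le_pow₀ (n := 3) hκ1]), max 1 (max N₁ N₂), ?_⟩
  intro ι J₁ J₂ L I p hL hG hS
  have hL1 : 1 ≤ L := (le_max_left _ _).trans hL
  have hX : (1 : ℝ) ≤ L := by exact_mod_cast hL1
  have hX0 : (0 : ℝ) < L := by linarith
  have b1 := hN₁ L (by omega)
  have b2 := hN₂ L (by omega)
  have hW : (0 : ℝ) < (S.U 0 J₁).card * (S.U 0 J₂).card := by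
    have := (S.U_nonempty 0 J₁).card_pos
    have := (S.U_nonempty 0 J₂).card_pos
    positivity
  have h6 : 6 * S.D 0 J₁ ≤ L := by
    have : (6 : ℝ) * S.D 0 J₁ ≤ L := by
      calc (6 : ℝ) * S.D 0 J₁ ≤ (L : ℝ) ^ (0.2245 : ℝ) * (L : ℝ) ^ (0.7755 : ℝ) :=
            mul_le_mul b1 hS.hi₁ (by positivity) (by positivity)
        _ = L := by rw [← Real.rpow_add hX0]; norm_num
    exact_mod_cast this
  have hm : κ' * L ≤ (S.D 0 J₁ : ℝ) ^ 2 := by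
    calc κ' * L ≤ (L : ℝ) ^ (0.547 : ℝ) * (L : ℝ) ^ (1 : ℝ) := by
          rw [Real.rpow_one]; gcongr
      _ = ((L : ℝ) ^ (0.7735 : ℝ)) ^ 2 := by
          rw [← Real.rpow_natCast, ← Real.rpow_mul hX0.le, ← Real.rpow_add hX0]; norm_num
      _ ≤ _ := by have := hS.lo₁; gcongr
  have key := sum_middle_le hG hκ (by omega) h6 hm (Q₁ := (L : ℝ) ^ (0.38 : ℝ))
    (Q₂ := (L : ℝ) ^ (0.62 : ℝ)) (by positivity) (by positivity)
  refine le_of_mul_le_mul_right (key.trans ?_) hW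
  calc _ ≤ A * (36 * κ' ^ 3 * (L : ℝ) ^ (-0.006 : ℝ) * ((S.U 0 J₁).card * (S.U 0 J₂).card)) *
        (S.vol J₁ J₂ I : ℝ) ^ 2 := by
        refine mul_le_mul_of_nonneg_right ?_ (by positivity)
        exact mul_le_mul_of_nonneg_left (middle_weight_le hκ1 hL1 hS) (by positivity)
    _ = _ := by ring

end Blocks

/-- `t / L` lies within `Q₀ / L` of a fraction with denominator at most `Q₀`. -/
def Major (L : ℕ) (Q₀ : ℝ) (t : ℕ) : Prop :=
  ∃ a q : ℤ, 1 ≤ q ∧ q ≤ Q₀ ∧ |(q * t - a * L : ℝ)| ≤ Q₀ * q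

lemma exists_two_pow_le {x : ℝ} (hx : 1 ≤ x) : ∃ n : ℕ, (2 : ℝ) ^ n ≤ x ∧ x < 2 * 2 ^ n := by
  obtain ⟨n, h1, h2⟩ := exists_nat_pow_near hx (show (1 : ℝ) < 2 by norm_num)
  exact ⟨n, h1, by rw [pow_succ] at h2; linarith⟩

lemma exists_inClass {L t : ℕ} {Q₀ : ℝ} (hL : 1 ≤ L) (hQ₀ : 2 ≤ Q₀) (ht : ¬ Major L Q₀ t) :
    (∃ a q, InMiddle L ((L : ℝ) ^ (0.38 : ℝ)) ((L : ℝ) ^ (0.62 : ℝ)) t a q) ∨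
      ∃ i j : ℕ, Q₀ / 2 < 2 ^ i * 2 ^ j ∧ (2 : ℝ) ^ i * 2 ^ j ≤ (L : ℝ) ^ (0.38 : ℝ) ∧
        ∃ a q, InClass L (2 ^ i) (2 ^ j) t a q := by
  have hX : (1 : ℝ) ≤ L := by exact_mod_cast hL
  have hX0 : (0 : ℝ) < L := by linarith
  set n := ⌊(L : ℝ) ^ (0.62 : ℝ)⌋₊ with hn
  have hn0 : 0 < n := Nat.floor_pos.2 (Real.one_le_rpow hX (by norm_num))
  have hn1 : (n : ℝ) ≤ (L : ℝ) ^ (0.62 : ℝ) := Nat.floor_le (by positivity)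
  have hn2 : (L : ℝ) ^ (0.62 : ℝ) < n + 1 := Nat.lt_floor_add_one _
  obtain ⟨r, hr1, hr2⟩ := Real.exists_rat_abs_sub_le_and_den_le ((t : ℝ) / L) hn0
  set q : ℤ := (r.den : ℤ) with hq
  set a : ℤ := r.num with ha
  have cop : IsCoprime a q := by
    rw [Int.isCoprime_iff_nat_coprime]
    simpa [ha, hq] using r.reduced
  have hq1 : (1 : ℝ) ≤ q := by
    rw [hq]; exact_mod_cast r.den_pos
  have hq0 : (0 : ℝ) < q := by linarith
  have hqn : (q : ℝ) ≤ n := by rw [hq]; exact_mod_cast hr2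
  have hrr : (r : ℝ) = a / q := by
    rw [ha, hq]; exact_mod_cast (Rat.num_div_den r).symm
  have hden : ((r.den : ℕ) : ℝ) = q := by rw [hq]; norm_cast
  rw [hrr, hden] at hr1
  have hb : |(q * t - a * L : ℝ)| ≤ (L : ℝ) ^ (0.38 : ℝ) := by
    have e : (q * t - a * L : ℝ) = q * L * ((t : ℝ) / L - a / q) := by field_simp
    rw [e, abs_mul, abs_of_pos (by positivity)]
    calc (q : ℝ) * L * |(t : ℝ) / L - a / q| ≤ q * L * (1 / ((n + 1) * q)) := by gcongr
      _ = L / (n + 1) := by field_simp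
      _ ≤ L / (L : ℝ) ^ (0.62 : ℝ) := by gcongr
      _ = (L : ℝ) ^ (1 : ℝ) / (L : ℝ) ^ (0.62 : ℝ) := by rw [Real.rpow_one]
      _ = _ := by rw [← Real.rpow_sub hX0]; norm_num
  by_cases hmid : (L : ℝ) ^ (0.38 : ℝ) ≤ q
  · refine Or.inl ⟨a, q, cop, hmid, hqn.trans hn1, hr1.trans ?_⟩
    rw [sq]
    gcongr
    linarith
  · refine Or.inr ?_
    have hmaj : Q₀ < q ∨ Q₀ * q < |(q * t - a * L : ℝ)| := by
      by_contra! hcon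
      exact ht ⟨a, q, by exact_mod_cast hq1, hcon⟩
    push Not at hmid
    obtain ⟨j, hj1, hj2⟩ := exists_two_pow_le hq1
    by_cases hsmall : |(q * t - a * L : ℝ)| < 2 * q
    · refine ⟨0, j, ?_, ?_, a, q, cop, hj1, hj2, ?_, Or.inl (pow_zero _)⟩
      · rcases hmaj with h | h
        · rw [pow_zero]; linarith
        · nlinarith
      · rw [pow_zero]; linarith
      · rw [pow_zero]; linarith
    · push Not at hsmall
      obtain ⟨i, hi1, hi2⟩ := exists_two_pow_le
        (show 1 ≤ |(q * t - a * L : ℝ)| / q by rw [le_div_iff₀ hq0]; linarith)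
      rw [le_div_iff₀ hq0] at hi1
      rw [div_lt_iff₀ hq0] at hi2
      have p1 : (1 : ℝ) ≤ 2 ^ i := one_le_pow₀ (by norm_num)
      have p2 : (1 : ℝ) ≤ 2 ^ j := one_le_pow₀ (by norm_num)
      refine ⟨i, j, ?_, ?_, a, q, cop, hj1, hj2, hi2.le, Or.inr hi1⟩
      · rcases hmaj with h | h
        · nlinarith
        · have h1 : Q₀ < 2 * 2 ^ i := lt_of_mul_lt_mul_right (h.trans hi2) hq0.le
          nlinarith
      · calc (2 : ℝ) ^ i * 2 ^ j ≤ 2 ^ i * q := by gcongr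
          _ ≤ _ := hi1
          _ ≤ _ := hb

lemma sum_biUnion_le {α β : Type*} [DecidableEq α] [DecidableEq β] (s : Finset α) (P : α → Finset β) {f : β → ℝ}
    (hf : ∀ b, 0 ≤ f b) : ∑ b ∈ s.biUnion P, f b ≤ ∑ a ∈ s, ∑ b ∈ P a, f b := by
  induction s using Finset.induction_on with
  | empty => simp
  | insert a s ha ih =>
    rw [Finset.biUnion_insert, Finset.sum_insert ha]
    have h := Finset.sum_union_inter (s₁ := P a) (s₂ := s.biUnion P) (f := f)
    have h' : 0 ≤ ∑ b ∈ P a ∩ s.biUnion P, f b := Finset.sum_nonneg fun b _ => hf b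
    linarith

namespace Blocks

variable (S : Blocks)

open Classical in
lemma sum_minor_le {κ : ℝ} (hκ : 1 ≤ κ) : ∃ C : ℝ, 1 ≤ C ∧ ∀ Q₀ : ℝ, 2 ≤ Q₀ → ∃ N : ℕ,
    ∀ {ι : Type} (J₁ J₂ L : ℕ) (I : Finset ι) (p : ι → Mat), N ≤ L → S.Good J₁ J₂ I p κ L →
    S.Scales J₁ J₂ L →
    ∑ t ∈ Finset.range L with ¬ Major L Q₀ t, ‖S.expSum J₁ J₂ I p L t‖ ^ 2 ≤
      C * Q₀ ^ (-(1 / 40) : ℝ) * (S.vol J₁ J₂ I : ℝ) ^ 2 := by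
  obtain ⟨A, hA, N₁, hmid⟩ := S.sum_middle_rpow_le hκ
  obtain ⟨B, hB, hcls⟩ := S.sum_inClass_le hκ
  set ρ : ℝ := (2 : ℝ) ^ (-(1 / 40) : ℝ) with hρ
  have hρ0 : 0 < ρ := by positivity
  have hρ1 : ρ < 1 := Real.rpow_lt_one_of_one_lt_of_neg (by norm_num) (by norm_num)
  refine ⟨1 + B * (2 * ((1 - ρ)⁻¹ * (1 - ρ)⁻¹)), ?_, ?_⟩
  · have : 0 < (1 - ρ)⁻¹ := inv_pos.2 (by linarith)
    have : 0 ≤ B * (2 * ((1 - ρ)⁻¹ * (1 - ρ)⁻¹)) := by positivity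
    linarith
  intro Q₀ hQ₀
  obtain ⟨N₂, hN₂⟩ := exists_forall_le_rpow B (show (0 : ℝ) < 0.0097 by norm_num)
  obtain ⟨N₃, hN₃⟩ := exists_forall_le_rpow (A * Q₀ ^ (1 / 40 : ℝ))
    (show (0 : ℝ) < 0.006 by norm_num)
  refine ⟨max 1 (max N₁ (max N₂ N₃)), ?_⟩
  intro ι J₁ J₂ L I p hL hG hS
  have hL1 : 1 ≤ L := (le_max_left _ _).trans hL
  have hX : (1 : ℝ) ≤ L := by exact_mod_cast hL1
  have hX0 : (0 : ℝ) < L := by linarith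
  have b2 := hN₂ L (by omega)
  have b3 := hN₃ L (by omega)
  set X : ℝ := (L : ℝ) with hXdef
  have hmono : ∀ {x y : ℝ}, x ≤ y → X ^ x ≤ X ^ y := fun h =>
    Real.rpow_le_rpow_of_exponent_le hX h
  set f : ℕ → ℝ := fun t => ‖S.expSum J₁ J₂ I p L t‖ ^ 2 with hf
  have hf0 : ∀ t, 0 ≤ f t := fun t => by positivity
  set V : ℝ := (S.vol J₁ J₂ I : ℝ) ^ 2 with hV
  have hV0 : 0 ≤ V := by positivity
  set F := {x ∈ Finset.range L ×ˢ Finset.range L |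
    Q₀ / 2 < 2 ^ x.1 * 2 ^ x.2 ∧ (2 : ℝ) ^ x.1 * 2 ^ x.2 ≤ X ^ (0.38 : ℝ)} with hF
  set P : ℕ × ℕ → Finset ℕ := fun x =>
    {t ∈ Finset.range L | ∃ a q, InClass L (2 ^ x.1) (2 ^ x.2) t a q} with hP
  set P₀ := {t ∈ Finset.range L |
    ∃ a q, InMiddle L (X ^ (0.38 : ℝ)) (X ^ (0.62 : ℝ)) t a q} with hP₀
  have hsub : {t ∈ Finset.range L | ¬ Major L Q₀ t} ⊆ P₀ ∪ F.biUnion P := by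
    intro t ht
    obtain ⟨ht, hmaj⟩ := Finset.mem_filter.1 ht
    rcases exists_inClass hL1 hQ₀ hmaj with h | ⟨i, j, h1, h2, h3⟩
    · exact Finset.mem_union_left _ (Finset.mem_filter.2 ⟨ht, h⟩)
    · have p1 : (1 : ℝ) ≤ 2 ^ i := one_le_pow₀ (by norm_num)
      have p2 : (1 : ℝ) ≤ 2 ^ j := one_le_pow₀ (by norm_num)
      have hle : X ^ (0.38 : ℝ) ≤ X := by
        calc X ^ (0.38 : ℝ) ≤ X ^ (1 : ℝ) := hmono (by norm_num)
          _ = X := Real.rpow_one X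
      have q1 : (2 : ℝ) ^ i ≤ L := by nlinarith
      have q2 : (2 : ℝ) ^ j ≤ L := by nlinarith
      have r1 : i < L := (Nat.lt_two_pow_self).trans_le (by exact_mod_cast q1)
      have r2 : j < L := (Nat.lt_two_pow_self).trans_le (by exact_mod_cast q2)
      refine Finset.mem_union_right _ (Finset.mem_biUnion.2 ⟨(i, j), ?_, ?_⟩)
      · simp only [hF, Finset.mem_filter, Finset.mem_product, Finset.mem_range]
        exact ⟨⟨r1, r2⟩, h1, h2⟩
      · exact Finset.mem_filter.2 ⟨ht, h3⟩
  have hmid' : ∑ t ∈ P₀, f t ≤ Q₀ ^ (-(1 / 40) : ℝ) * V := by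
    refine (hmid J₁ J₂ L I p (by omega) hG hS).trans ?_
    refine mul_le_mul_of_nonneg_right ?_ hV0
    have e : (L : ℝ) ^ (-0.006 : ℝ) = (X ^ (0.006 : ℝ))⁻¹ := by
      rw [← Real.rpow_neg hX0.le]
    rw [e, ← div_eq_mul_inv, div_le_iff₀ (by positivity)]
    calc A = Q₀ ^ (-(1 / 40) : ℝ) * (A * Q₀ ^ (1 / 40 : ℝ)) := by
          rw [mul_left_comm, ← Real.rpow_add (by linarith)]; norm_num
      _ ≤ _ := by gcongr
  have hcls' : ∀ x ∈ F, ∑ t ∈ P x, f t ≤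
      B * (2 * Q₀ ^ (-(1 / 40) : ℝ)) * V * (ρ ^ x.1 * ρ ^ x.2) := by
    rintro ⟨i, j⟩ hx
    obtain ⟨-, h1, h2⟩ := Finset.mem_filter.1 hx
    simp only at h1 h2
    have p1 : (1 : ℝ) ≤ 2 ^ i := one_le_pow₀ (by norm_num)
    have p2 : (1 : ℝ) ≤ 2 ^ j := one_le_pow₀ (by norm_num)
    set R : ℝ := 2 ^ i * 2 ^ j with hR
    have hR0 : 0 < R := by positivity
    have hR2 : B * (R ^ 2 * R ^ (1 / 100 : ℝ)) ≤ X ^ (0.7735 : ℝ) := by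
      calc B * (R ^ 2 * R ^ (1 / 100 : ℝ)) ≤
          X ^ (0.0097 : ℝ) * ((X ^ (0.38 : ℝ)) ^ 2 * (X ^ (0.38 : ℝ)) ^ (1 / 100 : ℝ)) := by gcongr
        _ = X ^ (0.7735 : ℝ) := by
          rw [← Real.rpow_natCast, ← Real.rpow_mul hX0.le, ← Real.rpow_mul hX0.le,
            ← Real.rpow_add hX0, ← Real.rpow_add hX0]
          norm_num
    refine (hcls J₁ J₂ L I p (2 ^ i) (2 ^ j) hG p1 p2 (hR2.trans hS.lo₁) ?_ ?_).trans ?_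
    · refine le_trans ?_ hS.lo₂
      calc B * Real.sqrt (2 ^ j) ≤ X ^ (0.0097 : ℝ) * Real.sqrt (X ^ (0.38 : ℝ)) := by
            gcongr
            nlinarith
        _ = X ^ (0.0097 + 0.38 * (1 / 2) : ℝ) := by
            rw [Real.sqrt_eq_rpow, ← Real.rpow_mul hX0.le, ← Real.rpow_add hX0]
        _ ≤ _ := hmono (by norm_num)
    · refine hR2.trans ?_
      calc X ^ (0.7735 : ℝ) ≤ X ^ (1 : ℝ) := hmono (by norm_num)
        _ = X := Real.rpow_one X
    · have e1 : ρ ^ i * ρ ^ j = R ^ (-(1 / 40) : ℝ) := by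
        rw [hR, Real.mul_rpow (by positivity) (by positivity), hρ, ← Real.rpow_natCast,
          ← Real.rpow_natCast, ← Real.rpow_natCast, ← Real.rpow_natCast,
          ← Real.rpow_mul (by norm_num), ← Real.rpow_mul (by norm_num),
          ← Real.rpow_mul (by norm_num), ← Real.rpow_mul (by norm_num), mul_comm (i : ℝ),
          mul_comm (j : ℝ)]
      have e2 : R ^ (-(1 / 20) : ℝ) = R ^ (-(1 / 40) : ℝ) * R ^ (-(1 / 40) : ℝ) := by
        rw [← Real.rpow_add hR0]; norm_num
      have e3 : R ^ (-(1 / 40) : ℝ) ≤ 2 * Q₀ ^ (-(1 / 40) : ℝ) := by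
        calc R ^ (-(1 / 40) : ℝ) ≤ (Q₀ / 2) ^ (-(1 / 40) : ℝ) :=
              Real.rpow_le_rpow_of_nonpos (by linarith) h1.le (by norm_num)
          _ = 2 ^ (1 / 40 : ℝ) * Q₀ ^ (-(1 / 40) : ℝ) := by
              rw [Real.div_rpow (by linarith) (by norm_num), Real.rpow_neg (show (0 : ℝ) ≤ 2 by norm_num),
                div_inv_eq_mul, mul_comm]
          _ ≤ 2 ^ (1 : ℝ) * Q₀ ^ (-(1 / 40) : ℝ) := by
              gcongr
              · norm_num
              · norm_num
          _ = _ := by rw [Real.rpow_one]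
      simp only
      rw [e1, e2]
      calc B * (R ^ (-(1 / 40) : ℝ) * R ^ (-(1 / 40) : ℝ)) * V
          ≤ B * ((2 * Q₀ ^ (-(1 / 40) : ℝ)) * R ^ (-(1 / 40) : ℝ)) * V := by gcongr
        _ = _ := by ring
  have hgeo : ∑ x ∈ F, ρ ^ x.1 * ρ ^ x.2 ≤ (1 - ρ)⁻¹ * (1 - ρ)⁻¹ := by
    have h1 : ∑ i ∈ Finset.range L, ρ ^ i ≤ (1 - ρ)⁻¹ := by
      rw [inv_eq_one_div, le_div_iff₀' (by linarith), mul_neg_geom_sum]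
      linarith [pow_nonneg hρ0.le L]
    calc ∑ x ∈ F, ρ ^ x.1 * ρ ^ x.2 ≤
        ∑ x ∈ Finset.range L ×ˢ Finset.range L, ρ ^ x.1 * ρ ^ x.2 :=
          Finset.sum_le_sum_of_subset_of_nonneg (Finset.filter_subset _ _)
            fun _ _ _ => mul_nonneg (pow_nonneg hρ0.le _) (pow_nonneg hρ0.le _)
      _ = (∑ i ∈ Finset.range L, ρ ^ i) * ∑ i ∈ Finset.range L, ρ ^ i := by
          rw [Finset.sum_product, Finset.sum_mul_sum]
      _ ≤ _ := by gcongr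
  calc ∑ t ∈ Finset.range L with ¬ Major L Q₀ t, f t ≤ ∑ t ∈ P₀ ∪ F.biUnion P, f t :=
        Finset.sum_le_sum_of_subset_of_nonneg hsub fun t _ _ => hf0 t
    _ ≤ ∑ t ∈ P₀, f t + ∑ t ∈ F.biUnion P, f t := by
        rw [← Finset.sum_union_inter]
        exact le_add_of_nonneg_right (Finset.sum_nonneg fun t _ => hf0 t)
    _ ≤ ∑ t ∈ P₀, f t + ∑ x ∈ F, ∑ t ∈ P x, f t := by
        gcongr
        exact sum_biUnion_le F P hf0
    _ ≤ Q₀ ^ (-(1 / 40) : ℝ) * V +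
        ∑ x ∈ F, B * (2 * Q₀ ^ (-(1 / 40) : ℝ)) * V * (ρ ^ x.1 * ρ ^ x.2) :=
        add_le_add hmid' (Finset.sum_le_sum hcls')
    _ ≤ Q₀ ^ (-(1 / 40) : ℝ) * V +
        B * (2 * Q₀ ^ (-(1 / 40) : ℝ)) * V * ((1 - ρ)⁻¹ * (1 - ρ)⁻¹) := by
        rw [← Finset.mul_sum]
        gcongr
    _ = _ := by ring

end Blocks

/-- The dominant eigenvalue of `cfGen a`. -/
noncomputable def lam (a : ℕ) : ℝ := (a + Real.sqrt (a ^ 2 + 4)) / 2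

lemma lam_mul (a : ℕ) : lam a * (a - lam a) = -1 := by
  have := Real.sq_sqrt (show (0 : ℝ) ≤ (a : ℝ) ^ 2 + 4 by positivity)
  rw [lam]
  linear_combination -(1 / 4) * this

lemma one_lt_lam {a : ℕ} (ha : 1 ≤ a) : 1 < lam a := by
  have h1 : (1 : ℝ) ≤ a := by exact_mod_cast ha
  have h2 : 1 < Real.sqrt ((a : ℝ) ^ 2 + 4) := by
    rw [Real.lt_sqrt (by norm_num)]; nlinarith
  rw [lam]; linarith

lemma cfGen_pow_apply (a n : ℕ) (i j : Fin 2) :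
    ((cfGen a ^ n) i j : ℝ) * (1 + lam a ^ 2) =
      lam a ^ n * (![1, lam a] i * ![1, lam a] j) +
        (a - lam a) ^ n * (![lam a, -1] i * ![lam a, -1] j) := by
  have h := lam_mul a
  induction n generalizing i with
  | zero => fin_cases i <;> fin_cases j <;> simp <;> ring
  | succ n ih =>
    have ih0 := ih 0
    have ih1 := ih 1
    have m0 : ∀ M : Mat, (cfGen a * M) 0 j = M 1 j := fun M => by
      simp [cfGen, Matrix.mul_apply, Fin.sum_univ_two]
    have m1 : ∀ M : Mat, (cfGen a * M) 1 j = M 0 j + a * M 1 j := fun M => by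
      simp [cfGen, Matrix.mul_apply, Fin.sum_univ_two]
    rw [pow_succ', pow_succ (lam a), pow_succ (a - lam a)]
    simp only [Matrix.cons_val_zero, Matrix.cons_val_one, Matrix.cons_val_fin_one] at ih0 ih1
    fin_cases i
    · simp only [Fin.zero_eta, m0, Matrix.cons_val_zero]
      linear_combination ih1 - ((a - lam a) ^ n * ![lam a, -1] j) * h
    · simp only [Fin.mk_one, m1, Matrix.cons_val_one, Matrix.cons_val_fin_one]
      push_cast
      linear_combination ih0 + a * ih1 + (lam a ^ n * ![1, lam a] j) * h

lemma tendsto_cfGen_pow {a : ℕ} (ha : 1 ≤ a) (i j : Fin 2) :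
    Filter.Tendsto (fun n => ((cfGen a ^ n) i j : ℝ) / lam a ^ n) Filter.atTop
      (nhds (![1, lam a] i * ![1, lam a] j / (1 + lam a ^ 2))) := by
  have h1 := one_lt_lam ha
  have h2 := lam_mul a
  have h0 : 0 < lam a := by linarith
  have h3 : |(a - lam a) / lam a| < 1 := by
    rw [abs_lt, lt_div_iff₀ h0, div_lt_iff₀ h0]
    constructor <;> nlinarith
  have e : (fun n => ((cfGen a ^ n) i j : ℝ) / lam a ^ n) = fun n =>
      ![1, lam a] i * ![1, lam a] j / (1 + lam a ^ 2) +
        ((a - lam a) / lam a) ^ n * (![lam a, -1] i * ![lam a, -1] j / (1 + lam a ^ 2)) := by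
    funext n
    have h4 := cfGen_pow_apply a n i j
    have h5 : (1 + lam a ^ 2) ≠ 0 := by positivity
    rw [← eq_div_iff h5] at h4
    rw [h4, div_pow]
    field_simp
  rw [e]
  have h6 := (tendsto_pow_atTop_nhds_zero_of_abs_lt_one h3).mul_const
    (![lam a, -1] i * ![lam a, -1] j / (1 + lam a ^ 2))
  simpa using h6.const_add (![1, lam a] i * ![1, lam a] j / (1 + lam a ^ 2))

lemma exists_pow_ratio {a : ℕ} (ha : 1 ≤ a) {r : ℝ} (hr : 1 < r) : ∃ N : ℕ, ∀ n n' : ℕ,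
    N ≤ n → N ≤ n' → ∀ i j, ((cfGen a ^ n') i j : ℝ) * lam a ^ n ≤
      r * lam a ^ n' * (cfGen a ^ n) i j := by
  have h0 : 0 < lam a := by linarith [one_lt_lam ha]
  have hv : ∀ i, 0 < ![1, lam a] i := by
    intro i
    fin_cases i
    · simp
    · simpa using h0
  have hc : ∀ i j, 0 < ![1, lam a] i * ![1, lam a] j / (1 + lam a ^ 2) := fun i j =>
    div_pos (mul_pos (hv i) (hv j)) (by positivity)
  have key : ∀ i j, ∃ N : ℕ, ∀ n n' : ℕ, N ≤ n → N ≤ n' →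
      ((cfGen a ^ n') i j : ℝ) * lam a ^ n ≤ r * lam a ^ n' * (cfGen a ^ n) i j := by
    intro i j
    set c := ![1, lam a] i * ![1, lam a] j / (1 + lam a ^ 2) with hcdef
    have hc0 : 0 < c := hc i j
    have l1 : c * (2 / (1 + r)) < c := mul_lt_of_lt_one_right hc0
      (by rw [div_lt_one (by linarith)]; linarith)
    have l2 : c < r * (c * (2 / (1 + r))) := by
      have : 1 < r * (2 / (1 + r)) := by
        rw [mul_div_assoc', lt_div_iff₀ (by linarith)]; linarith
      nlinarith
    have ht := tendsto_cfGen_pow ha i j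
    obtain ⟨N, hN⟩ := Filter.eventually_atTop.1
      ((ht.eventually (lt_mem_nhds l1)).and (ht.eventually (gt_mem_nhds l2)))
    refine ⟨N, fun n n' hn hn' => ?_⟩
    have b1 := (hN n hn).1
    have b2 := (hN n' hn').2
    rw [lt_div_iff₀ (by positivity)] at b1
    rw [div_lt_iff₀ (by positivity)] at b2
    have p1 : 0 < lam a ^ n := by positivity
    have p2 : 0 < lam a ^ n' := by positivity
    calc ((cfGen a ^ n') i j : ℝ) * lam a ^ n ≤
        r * (c * (2 / (1 + r))) * lam a ^ n' * lam a ^ n := by gcongr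
      _ = r * lam a ^ n' * (c * (2 / (1 + r)) * lam a ^ n) := by ring
      _ ≤ _ := by gcongr
  choose N hN using key
  refine ⟨max (max (N 0 0) (N 0 1)) (max (N 1 0) (N 1 1)), fun n n' hn hn' i j => hN i j n n' ?_ ?_⟩
  · refine le_trans ?_ hn
    fin_cases i <;> fin_cases j <;> simp
  · refine le_trans ?_ hn'
    fin_cases i <;> fin_cases j <;> simp

lemma cfGen_pow_even_bounds {a : ℕ} (ha : 1 ≤ a) {n : ℕ} (hn : Even n) :
    lam a ^ n ≤ 2 * (cfGen a ^ n) 1 1 ∧ ((cfGen a ^ n) 1 1 : ℝ) ≤ lam a ^ n := by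
  have h1 := one_lt_lam ha
  have h2 := lam_mul a
  have h := cfGen_pow_apply a n 1 1
  simp only [Matrix.cons_val_one, Matrix.cons_val_fin_one] at h
  have p1 : 0 ≤ (a - lam a) ^ n := hn.pow_nonneg _
  have p2 : (a - lam a) ^ n ≤ lam a ^ n := by
    rw [← hn.pow_abs]
    refine pow_le_pow_left₀ (abs_nonneg _) ?_ _
    rw [abs_le]
    constructor <;> nlinarith
  have p3 : 0 ≤ lam a ^ n := by positivity
  have p4 : 1 ≤ lam a ^ 2 := one_le_pow₀ h1.le
  have p5 : 0 < 1 + lam a ^ 2 := by positivity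
  constructor
  · refine le_of_mul_le_mul_right ?_ p5
    nlinarith
  · refine le_of_mul_le_mul_right ?_ p5
    nlinarith

lemma lam_one_pow_ne_lam_two_pow (m n : ℕ) : lam 1 ^ (m + 1) ≠ lam 2 ^ (n + 1) := by
  intro h
  have e1 : lam 1 = Real.goldenRatio := by
    rw [lam, Real.goldenRatio]; norm_num
  have e2 : lam 2 = 1 + Real.sqrt 2 := by
    have : Real.sqrt (((2 : ℕ) : ℝ) ^ 2 + 4) = 2 * Real.sqrt 2 := by
      rw [show (((2 : ℕ) : ℝ) ^ 2 + 4) = 2 ^ 2 * 2 by norm_num, Real.sqrt_mul (by norm_num),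
        Real.sqrt_sq (by norm_num)]
    rw [lam, this]; push_cast; ring
  have s2 : Real.sqrt 2 ^ 2 = 2 := Real.sq_sqrt (by norm_num)
  have s5 : Real.sqrt 5 ^ 2 = 5 := Real.sq_sqrt (by norm_num)
  have hpow : ∀ n : ℕ, ∃ p q : ℤ, 0 < p ∧ 0 < q ∧
      (1 + Real.sqrt 2) ^ (n + 1) = p + q * Real.sqrt 2 := by
    intro n
    induction n with
    | zero => exact ⟨1, 1, by simp⟩
    | succ n ih =>
      obtain ⟨p, q, hp, hq, ih⟩ := ih
      refine ⟨p + 2 * q, p + q, by positivity, by positivity, ?_⟩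
      rw [pow_succ, ih]; push_cast
      linear_combination (q : ℝ) * s2
  obtain ⟨p, q, hp, hq, hpq⟩ := hpow n
  have hfib := Real.goldenRatio_mul_fib_succ_add_fib m
  have hF : 0 < Nat.fib (m + 1) := Nat.fib_pos.2 (by omega)
  rw [e1, e2, hpq, ← hfib, Real.goldenRatio] at h
  set u : ℤ := 2 * p - Nat.fib (m + 1) - 2 * Nat.fib m with hu
  obtain ⟨v, hv⟩ : ∃ v : ℤ, v = (Nat.fib (m + 1) : ℤ) := ⟨_, rfl⟩
  have hv0 : 0 < v := by rw [hv]; exact_mod_cast hF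
  have k1 : (u : ℝ) + 2 * q * Real.sqrt 2 = v * Real.sqrt 5 := by
    rw [hu, hv]; push_cast; linear_combination -2 * h
  have k2 : (u : ℝ) ^ 2 + 8 * q ^ 2 + 4 * q * u * Real.sqrt 2 = 5 * v ^ 2 := by
    have : ((u : ℝ) + 2 * q * Real.sqrt 2) ^ 2 = (v * Real.sqrt 5) ^ 2 := by rw [k1]
    linear_combination this - 4 * (q : ℝ) ^ 2 * s2 + (v : ℝ) ^ 2 * s5
  have u0 : u = 0 := by
    by_contra hne
    refine irrational_sqrt_two ⟨(5 * v ^ 2 - u ^ 2 - 8 * q ^ 2) / (4 * q * u), ?_⟩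
    have hq' : (q : ℝ) ≠ 0 := by exact_mod_cast hq.ne'
    have hu' : (u : ℝ) ≠ 0 := by exact_mod_cast hne
    push_cast
    field_simp
    linear_combination -k2
  rw [u0] at k2
  refine (irrational_sqrt_ofNat_iff (n := 10)).2 ?_ ⟨(5 * v) / (2 * q), ?_⟩
  · decide +kernel
  · have hq' : (0 : ℝ) < q := by exact_mod_cast hq
    have hv' : (0 : ℝ) < v := by exact_mod_cast hv0
    push_cast
    rw [eq_comm]
    change Real.sqrt 10 = _
    rw [Real.sqrt_eq_iff_mul_self_eq (by norm_num) (by positivity)]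
    push_cast at k2
    field_simp
    linear_combination 5 * k2

lemma exists_small_combination {o : ℕ} (ho : 0 < o) {ρ : ℝ} (hρ : 0 < ρ) : ∃ m n : ℤ,
    0 < m * (o * Real.log (lam 1)) + n * (o * Real.log (lam 2)) ∧
      m * (o * Real.log (lam 1)) + n * (o * Real.log (lam 2)) < ρ := by
  have h1 : 0 < Real.log (lam 1) := Real.log_pos (one_lt_lam le_rfl)
  have h2 : 0 < Real.log (lam 2) := Real.log_pos (one_lt_lam (by norm_num))
  have ho' : (0 : ℝ) < o := by exact_mod_cast ho
  have hirr : Irrational (o * Real.log (lam 1) / (o * Real.log (lam 2))) := by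
    rw [mul_div_mul_left _ _ ho'.ne']
    rintro ⟨x, hx⟩
    have hxpos : 0 < x := by
      have : (0 : ℝ) < x := by rw [hx]; positivity
      exact_mod_cast this
    have hnum : 0 < x.num := Rat.num_pos.2 hxpos
    obtain ⟨a, ha⟩ : ∃ a : ℕ, x.den = a + 1 := ⟨x.den - 1, by have := x.den_pos; omega⟩
    obtain ⟨b, hb⟩ : ∃ b : ℕ, x.num = (b + 1 : ℕ) := ⟨x.num.toNat - 1, by omega⟩
    refine lam_one_pow_ne_lam_two_pow a b ?_
    have p1 : 0 < lam 1 := by linarith [one_lt_lam (le_refl 1)]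
    have p2 : 0 < lam 2 := by linarith [one_lt_lam (show 1 ≤ 2 by norm_num)]
    refine Real.log_injOn_pos (Set.mem_Ioi.2 (by positivity)) (Set.mem_Ioi.2 (by positivity)) ?_
    rw [Real.log_pow, Real.log_pow]
    have hx2 : (x : ℝ) = (b + 1 : ℕ) / (a + 1 : ℕ) := by
      rw [Rat.cast_def, ha, hb, Int.cast_natCast]
    rw [hx2, div_eq_div_iff (by positivity) (by positivity)] at hx
    linarith
  obtain ⟨y, hy, hy1, hy2⟩ := (dense_addSubgroupClosure_pair_iff.2 hirr).exists_between hρ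
  obtain ⟨m, n, hmn⟩ := AddSubgroup.mem_closure_pair.1 hy
  refine ⟨m, n, ?_⟩
  simp only [zsmul_eq_mul] at hmn
  rw [hmn]
  exact ⟨hy1, hy2⟩

lemma exists_progression {l₁ l₂ : ℝ} (h₁ : 0 < l₁) {m n : ℤ}
    (hs : 0 < m * l₁ + n * l₂) (T A : ℕ) : ∃ τ₀ : ℝ, ∀ τ, τ₀ ≤ τ → ∃ α β : ℕ → ℕ, ∃ σ : ℝ,
      τ - (m * l₁ + n * l₂) < σ ∧ σ ≤ τ ∧ (∀ i < T, A ≤ α i ∧ A ≤ β i) ∧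
        ∀ i < T, α i * l₁ + β i * l₂ = σ + i * (m * l₁ + n * l₂) := by
  set s := m * l₁ + n * l₂ with hsdef
  set J : ℕ := ⌈l₁ / s⌉₊ + T + 1 with hJ
  refine ⟨(A + J * |m| : ℤ) * l₁ + (A + J * |n| : ℤ) * l₂, fun τ hτ => ?_⟩
  set τ₀ := ((A + J * |m| : ℤ) : ℝ) * l₁ + ((A + J * |n| : ℤ) : ℝ) * l₂ with hτ₀
  set k : ℕ := ⌊(τ - τ₀) / l₁⌋₊ with hk
  have k1 : k * l₁ ≤ τ - τ₀ := by
    rw [← le_div_iff₀ h₁]; exact Nat.floor_le (div_nonneg (by linarith) h₁.le)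
  have k2 : τ - τ₀ < (k + 1) * l₁ := by
    rw [← div_lt_iff₀ h₁]; exact Nat.lt_floor_add_one _
  set ρ := τ - τ₀ - k * l₁ with hρ
  set j : ℕ := ⌊ρ / s⌋₊ with hj
  have j1 : j * s ≤ ρ := by
    rw [← le_div_iff₀ hs]; exact Nat.floor_le (div_nonneg (by linarith) hs.le)
  have j2 : ρ < (j + 1) * s := by
    rw [← div_lt_iff₀ hs]; exact Nat.lt_floor_add_one _
  have j3 : j ≤ ⌈l₁ / s⌉₊ := by
    have : (j : ℝ) ≤ l₁ / s := by rw [le_div_iff₀ hs]; linarith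
    exact_mod_cast this.trans (Nat.le_ceil _)
  have hpos : ∀ (a : ℤ) (i : ℕ), i < T → (A : ℤ) ≤ A + J * |a| + (j + i) * a := by
    intro a i hi
    have : (j + i) * -a ≤ (J : ℤ) * |a| := by
      refine (mul_le_mul_of_nonneg_left (neg_le_abs a) (by positivity)).trans ?_
      refine mul_le_mul_of_nonneg_right ?_ (abs_nonneg a)
      rw [hJ]; push_cast; omega
    linarith
  refine ⟨fun i => (A + J * |m| + (j + i) * m + k : ℤ).toNat,
    fun i => (A + J * |n| + (j + i) * n : ℤ).toNat, τ₀ + k * l₁ + j * s, ?_, ?_, ?_, ?_⟩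
  · linarith
  · linarith
  · intro i hi
    have := hpos m i hi
    have := hpos n i hi
    dsimp only
    constructor <;> omega
  · intro i hi
    have e1 : (((A + J * |m| + (j + i) * m + k : ℤ).toNat : ℤ) : ℝ) =
        (A + J * |m| + (j + i) * m + k : ℤ) := by
      rw [Int.toNat_of_nonneg]; have := hpos m i hi; omega
    have e2 : (((A + J * |n| + (j + i) * n : ℤ).toNat : ℤ) : ℝ) =
        (A + J * |n| + (j + i) * n : ℤ) := by
      rw [Int.toNat_of_nonneg]; have := hpos n i hi; omega
    rw [Int.cast_natCast] at e1 e2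
    rw [e1, e2, hτ₀, hsdef]
    push_cast
    ring

lemma exists_powers {o : ℕ} (ho : 0 < o) (he : Even o) {s₀ : ℝ} (hs₀ : 0 < s₀) :
    ∃ s : ℝ, 0 < s ∧ s < s₀ ∧ ∀ T : ℕ, ∃ τ₀ : ℝ, ∀ τ, τ₀ ≤ τ → ∃ M : ℕ → Mat, ∃ σ : ℝ,
      τ - s < σ ∧ σ ≤ τ ∧ ∀ i < T,
        (∃ a b : ℕ, 1 ≤ a ∧ M i = cfGen 1 ^ (o * a) * cfGen 2 ^ (o * b)) ∧
        Real.exp (σ + i * s) ≤ 4 * (M i 1 1 : ℝ) ∧ (M i 1 1 : ℝ) ≤ 2 * Real.exp (σ + i * s) ∧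
        ∀ i' < T, ∀ k l, (M i' k l : ℝ) ≤ (1 + s) * Real.exp ((i' - i : ℝ) * s) * M i k l := by
  obtain ⟨m, n, h0, h1⟩ := exists_small_combination ho (lt_min hs₀ one_pos)
  set l₁ := (o : ℝ) * Real.log (lam 1) with hl₁
  set l₂ := (o : ℝ) * Real.log (lam 2) with hl₂
  have g1 := one_lt_lam (le_refl 1)
  have g2 := one_lt_lam (show 1 ≤ 2 by norm_num)
  have ho' : (0 : ℝ) < o := by exact_mod_cast ho
  have h₁ : 0 < l₁ := mul_pos ho' (Real.log_pos g1)
  set s := m * l₁ + n * l₂ with hsdef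
  have hs1 : s < 1 := h1.trans_le (min_le_right _ _)
  refine ⟨s, h0, h1.trans_le (min_le_left _ _), fun T => ?_⟩
  obtain ⟨N₁, hN₁⟩ := exists_pow_ratio (le_refl 1) (show 1 < 1 + s / 3 by linarith)
  obtain ⟨N₂, hN₂⟩ := exists_pow_ratio (show 1 ≤ 2 by norm_num) (show 1 < 1 + s / 3 by linarith)
  obtain ⟨τ₀, hτ₀⟩ := exists_progression (l₂ := l₂) h₁ h0 T (max (max N₁ N₂) 1)
  refine ⟨τ₀, fun τ hτ => ?_⟩
  obtain ⟨α, β, σ, hσ1, hσ2, hA, hσ⟩ := hτ₀ τ hτ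
  have L1 : ∀ a : ℕ, lam 1 ^ (o * a) = Real.exp (a * l₁) := by
    intro a
    rw [hl₁, ← Real.exp_log (show 0 < lam 1 by linarith), ← Real.exp_nat_mul, Real.exp_log
      (by linarith)]
    push_cast; ring_nf
  have L2 : ∀ a : ℕ, lam 2 ^ (o * a) = Real.exp (a * l₂) := by
    intro a
    rw [hl₂, ← Real.exp_log (show 0 < lam 2 by linarith), ← Real.exp_nat_mul, Real.exp_log
      (by linarith)]
    push_cast; ring_nf
  have adm1 : ∀ a, Adm (cfGen 1 ^ a) := fun a =>
    adm_of_mem_pow (Finset.pow_mem_pow (mem_gens.2 ⟨1, by norm_num, by norm_num, rfl⟩))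
  have adm2 : ∀ a, Adm (cfGen 2 ^ a) := fun a =>
    adm_of_mem_pow (Finset.pow_mem_pow (mem_gens.2 ⟨2, by norm_num, by norm_num, rfl⟩))
  have nn : ∀ {X : Mat}, Adm X → ∀ k l, (0 : ℝ) ≤ X k l := by
    intro X hX k l
    have := hX.bounds
    have h4 : 0 ≤ X k l := by fin_cases k <;> fin_cases l <;> simp <;> omega
    exact_mod_cast h4
  refine ⟨fun i => cfGen 1 ^ (o * α i) * cfGen 2 ^ (o * β i), σ, hσ1, hσ2, fun i hi => ?_⟩
  obtain ⟨hα, hβ⟩ := hA i hi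
  have hle : ∀ a, a ≤ o * a := fun a => Nat.le_mul_of_pos_left a ho
  obtain ⟨u1, u2⟩ := cfGen_pow_even_bounds (le_refl 1) (he.mul_right (α i))
  obtain ⟨v1, v2⟩ := cfGen_pow_even_bounds (show 1 ≤ 2 by norm_num) (he.mul_right (β i))
  have hexp : Real.exp (σ + i * s) = lam 1 ^ (o * α i) * lam 2 ^ (o * β i) := by
    rw [L1, L2, ← Real.exp_add, hσ i hi]
  have hd1 : (((cfGen 1 ^ (o * α i)) 1 1 : ℤ) : ℝ) * ((cfGen 2 ^ (o * β i)) 1 1 : ℤ) ≤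
      ((cfGen 1 ^ (o * α i) * cfGen 2 ^ (o * β i)) 1 1 : ℤ) := by
    exact_mod_cast (adm1 _).le_d_mul (adm2 _)
  have hd2 : (((cfGen 1 ^ (o * α i) * cfGen 2 ^ (o * β i)) 1 1 : ℤ) : ℝ) ≤
      2 * (((cfGen 1 ^ (o * α i)) 1 1 : ℤ) * ((cfGen 2 ^ (o * β i)) 1 1 : ℤ)) := by
    exact_mod_cast (adm1 _).d_mul_le (adm2 _)
  refine ⟨⟨α i, β i, le_trans (le_max_right _ _) hα, rfl⟩, ?_, ?_, fun i' hi' k l => ?_⟩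
  · rw [hexp]
    have := mul_le_mul u1 v1 (by positivity) (mul_nonneg zero_le_two (nn (adm1 _) 1 1))
    linarith
  · rw [hexp]
    have := mul_le_mul u2 v2 (nn (adm2 _) 1 1) (by positivity)
    linarith
  · obtain ⟨hα', hβ'⟩ := hA i' hi'
    have b1 := fun k l => hN₁ (o * α i) (o * α i')
      (((le_max_left _ _).trans (le_max_left _ _)).trans (hα.trans (hle _)))
      (((le_max_left _ _).trans (le_max_left _ _)).trans (hα'.trans (hle _))) k l
    have b2 := fun k l => hN₂ (o * β i) (o * β i')
      (((le_max_right _ _).trans (le_max_left _ _)).trans (hβ.trans (hle _)))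
      (((le_max_right _ _).trans (le_max_left _ _)).trans (hβ'.trans (hle _))) k l
    have c1 : ∀ k l, (((cfGen 1 ^ (o * α i')) k l : ℤ) : ℝ) ≤
        (1 + s / 3) * Real.exp ((α i' - α i : ℝ) * l₁) * ((cfGen 1 ^ (o * α i)) k l : ℤ) := by
      intro k l
      have := b1 k l
      rw [L1, L1] at this
      refine le_of_mul_le_mul_right (this.trans_eq ?_) (Real.exp_pos (α i * l₁))
      rw [sub_mul, Real.exp_sub]; field_simp
    have c2 : ∀ k l, (((cfGen 2 ^ (o * β i')) k l : ℤ) : ℝ) ≤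
        (1 + s / 3) * Real.exp ((β i' - β i : ℝ) * l₂) * ((cfGen 2 ^ (o * β i)) k l : ℤ) := by
      intro k l
      have := b2 k l
      rw [L2, L2] at this
      refine le_of_mul_le_mul_right (this.trans_eq ?_) (Real.exp_pos (β i * l₂))
      rw [sub_mul, Real.exp_sub]; field_simp
    have hee : Real.exp ((α i' - α i : ℝ) * l₁) * Real.exp ((β i' - β i : ℝ) * l₂) =
        Real.exp ((i' - i : ℝ) * s) := by
      rw [← Real.exp_add]
      congr 1
      linear_combination hσ i' hi' - hσ i hi
    simp only [Matrix.mul_apply]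
    push_cast
    rw [Finset.mul_sum]
    refine Finset.sum_le_sum fun x _ => ?_
    refine (mul_le_mul (c1 k x) (c2 x l) (nn (adm2 _) x l)
      (mul_nonneg (by positivity) (nn (adm1 _) k x))).trans ?_
    calc _ = (1 + s / 3) ^ 2 * (Real.exp ((α i' - α i : ℝ) * l₁) *
          Real.exp ((β i' - β i : ℝ) * l₂)) *
          (((cfGen 1 ^ (o * α i)) k x : ℤ) * ((cfGen 2 ^ (o * β i)) x l : ℤ)) := by ring
      _ ≤ _ := by
        rw [hee]
        refine mul_le_mul_of_nonneg_right ?_ (mul_nonneg (nn (adm1 _) k x) (nn (adm2 _) x l))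
        refine mul_le_mul_of_nonneg_right ?_ (Real.exp_pos _).le
        nlinarith

/-- Reduction of integer matrices modulo `q`. -/
def red (q : ℕ) : Mat →+* Matrix (Fin 2) (Fin 2) (ZMod q) := (Int.castRingHom (ZMod q)).mapMatrix

@[simp] lemma red_apply (q : ℕ) (M : Mat) (i j : Fin 2) : red q M i j = (M i j : ZMod q) := rfl

open Classical in
/-- The residues modulo `q` of words of even length. -/
noncomputable def words (q : ℕ) [NeZero q] : Finset (Matrix (Fin 2) (Fin 2) (ZMod q)) :=
  Finset.univ.filter fun g => ∃ k, ∃ z ∈ gens ^ (2 * k), red q z = g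

section

variable {q : ℕ} [NeZero q]

lemma mem_words {g : Matrix (Fin 2) (Fin 2) (ZMod q)} :
    g ∈ words q ↔ ∃ k, ∃ z ∈ gens ^ (2 * k), red q z = g := by
  simp [words]

lemma red_mem_words {k : ℕ} {z : Mat} (hz : z ∈ gens ^ (2 * k)) : red q z ∈ words q :=
  mem_words.2 ⟨k, z, hz, rfl⟩

lemma one_mem_words : (1 : Matrix (Fin 2) (Fin 2) (ZMod q)) ∈ words q :=
  mem_words.2 ⟨0, 1, by simp, by simp⟩

lemma mul_mem_words {g h : Matrix (Fin 2) (Fin 2) (ZMod q)} (hg : g ∈ words q)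
    (hh : h ∈ words q) : g * h ∈ words q := by
  obtain ⟨k, z, hz, rfl⟩ := mem_words.1 hg
  obtain ⟨l, w, hw, rfl⟩ := mem_words.1 hh
  refine mem_words.2 ⟨k + l, z * w, ?_, map_mul _ _ _⟩
  rw [mul_add, pow_add]
  exact Finset.mul_mem_mul hz hw

lemma inv_mem_words {g h : Matrix (Fin 2) (Fin 2) (ZMod q)} (hg : g ∈ words q)
    (hgh : g * h = 1) : h ∈ words q := by
  have hpow : ∀ n : ℕ, g ^ n ∈ words q := by
    intro n
    induction n with
    | zero => rw [pow_zero]; exact one_mem_words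
    | succ n ih => rw [pow_succ]; exact mul_mem_words ih hg
  set u : (Matrix (Fin 2) (Fin 2) (ZMod q))ˣ := ⟨g, h, hgh, mul_eq_one_comm.1 hgh⟩
  have h1 : u ^ (orderOf u - 1) * u = 1 := by
    rw [← pow_succ, Nat.sub_add_cancel (orderOf_pos u), pow_orderOf_eq_one]
  have h2 : u⁻¹ = u ^ (orderOf u - 1) := (eq_inv_of_mul_eq_one_left h1).symm
  have h3 : h = g ^ (orderOf u - 1) := by
    have := congrArg Units.val h2
    simpa [u] using this
  rw [h3]
  exact hpow _

lemma exists_inv_of_mem_words {g : Matrix (Fin 2) (Fin 2) (ZMod q)} (hg : g ∈ words q) :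
    ∃ h ∈ words q, g * h = 1 ∧ h * g = 1 := by
  obtain ⟨k, z, hz, rfl⟩ := mem_words.1 hg
  have hd : z.det = 1 := by rw [det_of_mem_pow hz, pow_mul]; simp
  have h1 : red q z * red q z.adjugate = 1 := by
    rw [← map_mul, Matrix.mul_adjugate, hd, one_smul, map_one]
  exact ⟨_, inv_mem_words hg h1, h1, mul_eq_one_comm.1 h1⟩

lemma red_SL2_mem_words (g : Matrix.SpecialLinearGroup (Fin 2) ℤ) : red q g ∈ words q := by
  have hw : ∀ a b : ℕ, 1 ≤ a → a ≤ 5 → 1 ≤ b → b ≤ 5 → red q (cfGen a * cfGen b) ∈ words q := by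
    intro a b ha ha' hb hb'
    refine red_mem_words (k := 1) ?_
    rw [mul_one, pow_two]
    exact Finset.mul_mem_mul (mem_gens.2 ⟨a, ha, ha', rfl⟩) (mem_gens.2 ⟨b, hb, hb', rfl⟩)
  have h11 := hw 1 1 (by norm_num) (by norm_num) (by norm_num) (by norm_num)
  have h12 := hw 1 2 (by norm_num) (by norm_num) (by norm_num) (by norm_num)
  have h21 := hw 2 1 (by norm_num) (by norm_num) (by norm_num) (by norm_num)
  obtain ⟨v, hv, hv1, hv2⟩ := exists_inv_of_mem_words h11
  have hT : red q !![1, 1; 0, 1] ∈ words q := by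
    have : red q (cfGen 1 * cfGen 1) * red q !![1, 1; 0, 1] = red q (cfGen 1 * cfGen 2) := by
      rw [← map_mul]; congr 1; decide
    have e : red q !![1, 1; 0, 1] = v * red q (cfGen 1 * cfGen 2) := by
      rw [← this, ← mul_assoc, hv2, one_mul]
    rw [e]; exact mul_mem_words hv h12
  have hL : red q !![1, 0; 1, 1] ∈ words q := by
    have : red q !![1, 0; 1, 1] * red q (cfGen 1 * cfGen 1) = red q (cfGen 2 * cfGen 1) := by
      rw [← map_mul]; congr 1; decide
    have e : red q !![1, 0; 1, 1] = red q (cfGen 2 * cfGen 1) * v := by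
      rw [← this, mul_assoc, hv1, mul_one]
    rw [e]; exact mul_mem_words h21 hv
  have hT' : red q !![1, -1; 0, 1] ∈ words q := by
    refine inv_mem_words hT ?_
    rw [← map_mul, ← map_one (red q)]; congr 1; decide
  have hS : red q !![0, -1; 1, 0] ∈ words q := by
    have : red q !![0, -1; 1, 0] = red q !![1, -1; 0, 1] * red q !![1, 0; 1, 1] *
        red q !![1, -1; 0, 1] := by
      rw [← map_mul, ← map_mul]; congr 1; decide
    rw [this]
    exact mul_mem_words (mul_mem_words hT' hL) hT'
  have hg : g ∈ Subgroup.closure {ModularGroup.S, ModularGroup.T} := by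
    simp [SpecialLinearGroup.SL2Z_generators]
  induction hg using Subgroup.closure_induction with
  | one => simpa using one_mem_words
  | mem g hg =>
    rcases hg with rfl | rfl
    · exact hS
    · exact hT
  | mul g h _ _ ihg ihh =>
    rw [Matrix.SpecialLinearGroup.coe_mul, map_mul]; exact mul_mem_words ihg ihh
  | inv g _ ih =>
    refine inv_mem_words ih ?_
    rw [← map_mul, ← Matrix.SpecialLinearGroup.coe_mul]; simp

lemma card_filter_words_mul {x y : Matrix (Fin 2) (Fin 2) (ZMod q)} (hx : x ∈ words q)
    (hy : y ∈ words q) (e : ZMod q) :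
    ((words q).filter fun g => (x * g * y) 1 1 = e).card =
      ((words q).filter fun g => g 1 1 = e).card := by
  obtain ⟨x', hx', -, hxl⟩ := exists_inv_of_mem_words hx
  obtain ⟨y', hy', hyr, -⟩ := exists_inv_of_mem_words hy
  have hinj : Function.Injective fun g => x * g * y := by
    intro g h hgh
    have : x' * (x * g * y) * y' = x' * (x * h * y) * y' := by
      simp only at hgh; rw [hgh]
    rwa [show x' * (x * g * y) * y' = (x' * x) * g * (y * y') by simp only [mul_assoc],
      show x' * (x * h * y) * y' = (x' * x) * h * (y * y') by simp only [mul_assoc],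
      hxl, hyr, one_mul, one_mul, mul_one, mul_one] at this
  have himg : (words q).image (fun g => x * g * y) = words q := by
    refine Finset.eq_of_subset_of_card_le ?_ (Finset.card_image_of_injective _ hinj).ge
    intro g hg
    obtain ⟨h, hh, rfl⟩ := Finset.mem_image.1 hg
    exact mul_mem_words (mul_mem_words hx hh) hy
  conv_rhs => rw [← himg]
  rw [Finset.filter_image, Finset.card_image_of_injective _ hinj]

lemma card_row_le (w : ZMod q × ZMod q) :
    ((words q).filter fun g => (g 1 0, g 1 1) = w).card ≤
      ((words q).filter fun g => (g 1 0, g 1 1) = (0, 1)).card := by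
  rcases ((words q).filter fun g => (g 1 0, g 1 1) = w).eq_empty_or_nonempty with h | ⟨g₀, hg₀⟩
  · rw [h]; simp
  obtain ⟨h1, h2⟩ := Finset.mem_filter.1 hg₀
  obtain ⟨g', hg', hr, -⟩ := exists_inv_of_mem_words h1
  refine Finset.card_le_card_of_injOn (· * g') ?_ ?_
  · intro g hg
    obtain ⟨k1, k2⟩ := Finset.mem_filter.1 hg
    refine Finset.mem_filter.2 ⟨mul_mem_words k1 hg', ?_⟩
    obtain ⟨e1, e2⟩ := Prod.mk.inj (k2.trans h2.symm)
    have r : ∀ j, (g * g') 1 j = (g₀ * g') 1 j := by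
      intro j; simp only [Matrix.mul_apply, Fin.sum_univ_two, e1, e2]
    simp only [r, hr]
    simp
  · intro g _ h _ hgh
    have : g * g' * g₀ = h * g' * g₀ := by simp only at hgh; rw [hgh]
    rwa [mul_assoc, mul_assoc, mul_eq_one_comm.1 hr, mul_one, mul_one] at this

lemma le_card_row {w : ZMod q × ZMod q} {g₀ : Matrix (Fin 2) (Fin 2) (ZMod q)}
    (h₀ : g₀ ∈ words q) (hw : (g₀ 1 0, g₀ 1 1) = w) :
    ((words q).filter fun g => (g 1 0, g 1 1) = (0, 1)).card ≤
      ((words q).filter fun g => (g 1 0, g 1 1) = w).card := by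
  obtain ⟨g', hg', hr, -⟩ := exists_inv_of_mem_words h₀
  refine Finset.card_le_card_of_injOn (· * g₀) ?_ ?_
  · intro g hg
    obtain ⟨k1, k2⟩ := Finset.mem_filter.1 hg
    refine Finset.mem_filter.2 ⟨mul_mem_words k1 h₀, ?_⟩
    obtain ⟨e1, e2⟩ := Prod.mk.inj k2
    simp [Matrix.mul_apply, Fin.sum_univ_two, e1, e2, ← hw]
  · intro g _ h _ hgh
    have : g * g₀ * g' = h * g₀ * g' := by simp only at hgh; rw [hgh]
    rwa [mul_assoc, mul_assoc, hr, mul_one, mul_one] at this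

lemma card_filter_coprime_range (k e : ℕ) :
    ((Finset.range (k * e)).filter fun n => Nat.Coprime e n).card = k * Nat.totient e := by
  induction k with
  | zero => simp
  | succ k ih =>
    rw [Finset.range_eq_Ico, ← Finset.Ico_union_Ico_eq_Ico (Nat.zero_le (k * e))
      (Nat.mul_le_mul_right e k.le_succ), Finset.filter_union, Finset.card_union_of_disjoint
      (Finset.disjoint_filter_filter (Finset.Ico_disjoint_Ico_consecutive _ _ _)),
      ← Finset.range_eq_Ico, ih, Nat.succ_mul, Nat.filter_coprime_Ico_eq_totient, Nat.succ_mul]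

lemma totient_le_card_residues (q : ℕ) [NeZero q] (e : ℕ) :
    q * Nat.totient e ≤
      (((Finset.range (q * e)).filter fun n => Nat.Coprime e n).image
        fun n : ℕ => (n : ZMod q)).card * e := by
  rw [← card_filter_coprime_range q e]
  refine (Finset.card_le_mul_card_image (f := fun n : ℕ => (n : ZMod q)) _ e ?_).trans_eq
    (mul_comm _ _)
  intro b _
  refine (Finset.card_le_card_of_injOn (t := Finset.range e) (· / q) ?_ ?_).trans_eq
    (Finset.card_range e)
  · intro n hn
    simp only [Finset.coe_filter, Finset.mem_filter, Finset.mem_range, Set.mem_ofPred_eq] at hn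
    simpa using Nat.div_lt_of_lt_mul hn.1.1
  · intro n hn n' hn' h
    simp only [Finset.coe_filter, Finset.mem_filter, Finset.mem_range, Set.mem_ofPred_eq] at hn hn'
    have hmod : n % q = n' % q := (ZMod.natCast_eq_natCast_iff' _ _ _).1 (hn.2.trans hn'.2.symm)
    simp only at h
    rw [← Nat.div_add_mod n q, ← Nat.div_add_mod n' q, h, hmod]

lemma card_words_mul_totient_le (e : ℕ) :
    (words q).card * Nat.totient e ≤
      e * q * ((words q).filter fun g => g 1 1 = (e : ZMod q)).card := by
  classical
  set n₀ := ((words q).filter fun g => (g 1 0, g 1 1) = (0, 1)).card with hn₀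
  have hq : 0 < q := NeZero.pos q
  have h1 : (words q).card ≤ q * q * n₀ := by
    have := Finset.card_le_mul_card_image_of_maps_to (s := words q)
      (t := (Finset.univ : Finset (ZMod q × ZMod q))) (f := fun g => (g 1 0, g 1 1))
      (fun _ _ => Finset.mem_univ _) n₀ (fun w _ => card_row_le w)
    rw [Finset.card_univ, Fintype.card_prod, ZMod.card] at this
    linarith
  set R := ((Finset.range (q * e)).filter fun n => Nat.Coprime e n).image
    fun n : ℕ => (n : ZMod q) with hR
  have h2 : R.card * n₀ ≤ ((words q).filter fun g => g 1 1 = (e : ZMod q)).card := by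
    have := Finset.mul_card_image_le_card_of_maps_to
      (s := (words q).filter fun g => g 1 1 = (e : ZMod q) ∧ g 1 0 ∈ R) (t := R)
      (f := fun g => g 1 0) (fun g hg => (Finset.mem_filter.1 hg).2.2) n₀ ?_
    · rw [mul_comm]
      exact this.trans (Finset.card_le_card fun g hg =>
        Finset.mem_filter.2 ⟨(Finset.mem_filter.1 hg).1, (Finset.mem_filter.1 hg).2.1⟩)
    · intro b hb
      obtain ⟨n, hn, rfl⟩ := Finset.mem_image.1 hb
      have hcop : IsCoprime (n : ℤ) e := by
        rw [Nat.isCoprime_iff_coprime]; exact (Finset.mem_filter.1 hn).2.symm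
      obtain ⟨g, hg0, hg1⟩ := hcop.exists_SL2_row 1
      refine (le_card_row (w := ((n : ZMod q), (e : ZMod q))) (red_SL2_mem_words g)
        (by simp [hg0, hg1])).trans (Finset.card_le_card ?_)
      intro h hh
      obtain ⟨k1, k2⟩ := Finset.mem_filter.1 hh
      obtain ⟨e1, e2⟩ := Prod.mk.inj k2
      simp only [Finset.mem_filter]
      exact ⟨⟨k1, e2, by rw [e1]; exact hb⟩, e1⟩
  have h3 := totient_le_card_residues q e
  refine Nat.le_of_mul_le_mul_left ?_ hq
  calc q * ((words q).card * Nat.totient e) = (words q).card * (q * Nat.totient e) := by ring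
    _ ≤ (q * q * n₀) * (R.card * e) := by gcongr
    _ = q * (e * q * (R.card * n₀)) := by ring
    _ ≤ _ := by gcongr

end

lemma exists_crossing {d : ℕ → ℝ} {s δ N C e : ℝ} {T : ℕ} (hs : 0 < s) (hs1 : s < 1)
    (hδ : -s < δ) (hδ' : δ ≤ 0) (hN : 0 < N) (hC : 1 ≤ C)
    (hT : Real.log (128 * C) / s + 3 ≤ T)
    (hu : ∀ i < T, d i ≤ N * Real.exp (δ + i * s))
    (hl : ∀ i < T, N * Real.exp (δ + i * s) ≤ 64 * C * d i)
    (hr : ∀ i, i + 1 < T → d (i + 1) ≤ (1 + s) * Real.exp s * d i)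
    (he : N ≤ e) (he' : e < 2 * N) : ∃ i < T, e ≤ d i ∧ d i < e + 10 * s * N := by
  have hlog : 0 ≤ Real.log (128 * C) := Real.log_nonneg (by linarith)
  have hT3 : 3 ≤ T := by
    have : (3 : ℝ) ≤ T := le_trans (by have := div_nonneg hlog hs.le; linarith) hT
    exact_mod_cast this
  have hlast : e ≤ d (T - 1) := by
    have h1 := hl (T - 1) (by omega)
    have h2 : Real.log (128 * C) ≤ δ + (T - 1 : ℕ) * s := by
      rw [Nat.cast_sub (by omega)]
      have : Real.log (128 * C) ≤ (T - 3) * s := by rw [← div_le_iff₀ hs]; linarith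
      push_cast; linarith
    have h3 := Real.exp_le_exp.2 h2
    rw [Real.exp_log (by linarith)] at h3
    have h4 : 64 * C * (2 * N) ≤ 64 * C * d (T - 1) := by
      refine le_trans ?_ h1
      rw [show 64 * C * (2 * N) = N * (128 * C) by ring]
      gcongr
    have := le_of_mul_le_mul_left h4 (by linarith)
    linarith
  classical
  have hex : ∃ i, i < T ∧ e ≤ d i := ⟨T - 1, by omega, hlast⟩
  obtain ⟨h1, h2⟩ := Nat.find_spec hex
  refine ⟨Nat.find hex, h1, h2, ?_⟩
  rcases Nat.eq_zero_or_pos (Nat.find hex) with h0 | h0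
  · rw [h0] at h1 ⊢
    have h3 := hu 0 h1
    have h4 : Real.exp (δ + (0 : ℕ) * s) ≤ 1 := Real.exp_le_one_iff.2 (by simpa using hδ')
    have : N * Real.exp (δ + (0 : ℕ) * s) ≤ N * 1 := by gcongr
    have : 0 < s * N := mul_pos hs hN
    linarith
  · obtain ⟨i, hi⟩ : ∃ i, Nat.find hex = i + 1 := ⟨Nat.find hex - 1, by omega⟩
    rw [hi] at h1 ⊢
    have h3 : d i < e := by
      have := Nat.find_min hex (m := i) (by omega)
      simp only [not_and, not_le] at this
      exact this (by omega)
    have h4 : Real.exp s ≤ 1 + 2 * s := by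
      have := Real.abs_exp_sub_one_le (x := s) (by rw [abs_of_pos hs]; exact hs1.le)
      rw [abs_of_pos hs] at this
      linarith [le_abs_self (Real.exp s - 1)]
    have he0 : 0 < e := hN.trans_le he
    have hd0 : 0 ≤ d i := by
      have h5 : 0 ≤ 64 * C * d i := le_trans (by positivity) (hl i (by omega))
      exact nonneg_of_mul_nonneg_right h5 (by positivity)
    calc d (i + 1) ≤ (1 + s) * Real.exp s * d i := hr i h1
      _ ≤ (1 + s) * (1 + 2 * s) * e := by gcongr
      _ ≤ (1 + 5 * s) * e := by
        refine mul_le_mul_of_nonneg_right ?_ he0.le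
        nlinarith
      _ < _ := by nlinarith

lemma Adm.cast_nonneg {X : Mat} (hX : Adm X) (k l : Fin 2) : (0 : ℝ) ≤ X k l := by
  have := hX.bounds
  have h4 : 0 ≤ X k l := by fin_cases k <;> fin_cases l <;> simp <;> omega
  exact_mod_cast h4

lemma entry_le_of_entry_le {X X' Y Z : Mat} {c : ℝ} (hY : Adm Y) (hZ : Adm Z)
    (h : ∀ k l, (X' k l : ℝ) ≤ c * X k l) (k l : Fin 2) :
    ((Y * X' * Z) k l : ℝ) ≤ c * ((Y * X * Z) k l : ℤ) := by
  have h1 : ∀ k l, ((Y * X') k l : ℝ) ≤ c * ((Y * X) k l : ℤ) := by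
    intro k l
    simp only [Matrix.mul_apply]
    push_cast
    rw [Finset.mul_sum]
    refine Finset.sum_le_sum fun x _ => ?_
    rw [mul_left_comm]
    exact mul_le_mul_of_nonneg_left (h x l) (hY.cast_nonneg k x)
  rw [Matrix.mul_apply, Matrix.mul_apply]
  push_cast
  rw [Finset.mul_sum]
  refine Finset.sum_le_sum fun x _ => ?_
  rw [← mul_assoc]
  exact mul_le_mul_of_nonneg_right (h1 k x) (hZ.cast_nonneg x l)

lemma exists_even_period (q : ℕ) [NeZero q] : ∃ o : ℕ, 0 < o ∧ Even o ∧
    ∀ a : ℕ, red q (cfGen a ^ o) = 1 := by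
  refine ⟨2 * Nat.card (Matrix (Fin 2) (Fin 2) (ZMod q))ˣ, ?_, even_two_mul _, fun a => ?_⟩
  · have : 0 < Nat.card (Matrix (Fin 2) (Fin 2) (ZMod q))ˣ := Nat.card_pos
    omega
  · have h1 : red q (cfGen a) * red q !![-(a : ℤ), 1; 1, 0] = 1 := by
      rw [← map_mul, ← map_one (red q)]
      congr 1
      ext i j
      fin_cases i <;> fin_cases j <;> simp [cfGen, Matrix.mul_apply, Fin.sum_univ_two]
    set u : (Matrix (Fin 2) (Fin 2) (ZMod q))ˣ := ⟨_, _, h1, mul_eq_one_comm.1 h1⟩ with hu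
    have h2 : u ^ Nat.card (Matrix (Fin 2) (Fin 2) (ZMod q))ˣ = 1 := pow_card_eq_one'
    have h3 := congrArg Units.val h2
    rw [Units.val_pow_eq_pow_val, Units.val_one] at h3
    rw [map_pow, mul_comm, pow_mul, show red q (cfGen a) = u.val from rfl, h3, one_pow]

namespace Blocks

variable (S : Blocks)

lemma exists_scales : ∃ L₀ : ℕ, ∀ L ≥ L₀, ∃ J₁ J₂ : ℕ, S.Scales J₁ J₂ L ∧
    (S.D 0 J₁ * S.D 0 J₂ : ℝ) ≤ (L : ℝ) ^ (0.995 : ℝ) := by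
  obtain ⟨C, hC, hg⟩ := S.exists_growth (ε := 0.001) (by norm_num)
  obtain ⟨L₀, hL₀⟩ := exists_forall_le_rpow C (c := 0.0001) (by norm_num)
  refine ⟨max L₀ 1, fun L hL => ?_⟩
  have hL1 : (1 : ℝ) ≤ L := by exact_mod_cast le_trans (le_max_right _ _) hL
  have hL0 : (0 : ℝ) < L := by linarith
  have hCL := hL₀ L (le_trans (le_max_left _ _) hL)
  have key : ∀ {b b' : ℝ}, 0 ≤ b → b' + 0.0001 + 0.001 * b ≤ b → ∃ J,
      (L : ℝ) ^ b' ≤ S.D 0 J ∧ (S.D 0 J : ℝ) ≤ (L : ℝ) ^ b := by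
    intro b b' hb hbb
    obtain ⟨J, -, h1, h2⟩ := S.exists_scale 0 (T := (L : ℝ) ^ b) (Real.one_le_rpow hL1 hb)
    refine ⟨J, ?_, h1⟩
    have hD := S.one_le_D 0 J
    have h3 := h2.le.trans (hg 0 J (Nat.zero_le _))
    have h4 : (S.D 0 J : ℝ) ^ (0.001 : ℝ) ≤ (L : ℝ) ^ (0.001 * b) := by
      rw [mul_comm, Real.rpow_mul hL0.le]
      exact Real.rpow_le_rpow (by linarith) h1 (by norm_num)
    have h5 : (L : ℝ) ^ b ≤ (L : ℝ) ^ (0.0001 : ℝ) * (S.D 0 J * (L : ℝ) ^ (0.001 * b)) :=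
      h3.trans (by gcongr)
    have h6 : (L : ℝ) ^ (b' + 0.0001 + 0.001 * b) ≤ (L : ℝ) ^ b :=
      Real.rpow_le_rpow_of_exponent_le hL1 hbb
    rw [Real.rpow_add hL0, Real.rpow_add hL0] at h6
    have p1 : 0 < (L : ℝ) ^ (0.0001 : ℝ) := by positivity
    have p2 : 0 < (L : ℝ) ^ (0.001 * b) := by positivity
    refine le_of_mul_le_mul_right (a := (L : ℝ) ^ (0.0001 : ℝ) * (L : ℝ) ^ (0.001 * b)) ?_
      (by positivity)
    calc _ = (L : ℝ) ^ b' * (L : ℝ) ^ (0.0001 : ℝ) * (L : ℝ) ^ (0.001 * b) := by ring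
      _ ≤ _ := h6.trans h5
      _ = _ := by ring
  obtain ⟨J₁, a1, a2⟩ := key (b := 0.775) (b' := 0.7735) (by norm_num) (by norm_num)
  obtain ⟨J₂, b1, b2⟩ := key (b := 0.22) (b' := 0.2187) (by norm_num) (by norm_num)
  refine ⟨J₁, J₂, ⟨a1, a2.trans (Real.rpow_le_rpow_of_exponent_le hL1 (by norm_num)), b1⟩, ?_⟩
  rw [show (0.995 : ℝ) = 0.775 + 0.22 by norm_num, Real.rpow_add hL0]
  exact mul_le_mul a2 b2 (by positivity) (by positivity)

end Blocks

namespace Blocks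

variable (S : Blocks)

/-- The ratio between the largest and the smallest sizes in a ladder. -/
noncomputable def B0 : ℝ := 128 * C0 ^ 2 * Real.exp 3

lemma one_le_B0 : 1 ≤ B0 := by
  have h1 := one_le_pow₀ one_le_C0 (n := 2)
  have h2 : (1 : ℝ) ≤ Real.exp 3 := Real.one_le_exp (by norm_num)
  rw [B0]
  nlinarith

lemma exists_ladder (q : ℕ) [NeZero q] {η₀ : ℝ} (hη₀ : 0 < η₀) : ∃ η : ℝ, 0 < η ∧ η ≤ η₀ ∧
    ∃ T : ℕ, 0 < T ∧ T * η ≤ 10 * (Real.log (128 * C0 ^ 2) + 4) ∧ ∀ g ∈ words q, ∃ Z : ℝ, 0 ≤ Z ∧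
      ∀ (J₁ J₂ : ℕ) (N : ℝ), 0 < N → Z * (S.D 0 J₁ * S.D 0 J₂) ≤ N → ∃ p : ℕ → Mat,
        (∀ i < T, red q (p i) = g ∧ ∃ k, k ≠ 0 ∧ p i ∈ gens ^ (2 * k)) ∧
        ∀ x ∈ S.U 0 J₁, ∀ y ∈ S.U 0 J₂,
          (∀ i < T, N ≤ B0 * ((x * p i * y.transpose) 1 1 : ℤ) ∧
            (((x * p i * y.transpose) 1 1 : ℤ) : ℝ) ≤ B0 * N) ∧
          ∀ e : ℝ, N ≤ e → e < 2 * N → ∃ i < T, e ≤ ((x * p i * y.transpose) 1 1 : ℤ) ∧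
            (((x * p i * y.transpose) 1 1 : ℤ) : ℝ) < e + η * N := by
  obtain ⟨o, ho, hoe, hoq⟩ := exists_even_period q
  obtain ⟨s, hs, hs', hpow⟩ := exists_powers ho hoe (s₀ := min 1 (η₀ / 10))
    (lt_min one_pos (by positivity))
  have hs1 : s < 1 := hs'.trans_le (min_le_left _ _)
  have hsη : s < η₀ / 10 := hs'.trans_le (min_le_right _ _)
  have hC1 : 1 ≤ C0 ^ 2 := one_le_pow₀ one_le_C0
  have hW : 0 ≤ Real.log (128 * C0 ^ 2) := Real.log_nonneg (by linarith)
  set W := Real.log (128 * C0 ^ 2) with hWdef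
  have heW : Real.exp W = 128 * C0 ^ 2 := Real.exp_log (by linarith)
  set T : ℕ := ⌈W / s⌉₊ + 3 with hT
  have hT1 : W / s + 3 ≤ T := by
    rw [hT]; push_cast; linarith [Nat.le_ceil (W / s)]
  have hT2 : T * s ≤ W + 4 * s := by
    have : (⌈W / s⌉₊ : ℝ) < W / s + 1 := Nat.ceil_lt_add_one (div_nonneg hW hs.le)
    rw [hT]; push_cast
    have h2 : W / s * s = W := div_mul_cancel₀ _ hs.ne'
    nlinarith
  refine ⟨10 * s, by positivity, by linarith, T, by omega, by linarith, fun g hg => ?_⟩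
  obtain ⟨τ₀, hτ₀⟩ := hpow T
  obtain ⟨k, z, hz, hzg⟩ := mem_words.1 hg
  have az : Adm z := adm_of_mem_pow hz
  have hz0 : (0 : ℝ) < z 1 1 := by exact_mod_cast az.d_pos
  refine ⟨16 * z 1 1 * Real.exp τ₀, by positivity, fun J₁ J₂ N hN hZ => ?_⟩
  have hD₁ : (0 : ℝ) < S.D 0 J₁ := by linarith [S.one_le_D 0 J₁]
  have hD₂ : (0 : ℝ) < S.D 0 J₂ := by linarith [S.one_le_D 0 J₂]
  set R : ℝ := 16 * z 1 1 * (S.D 0 J₁ * S.D 0 J₂) with hR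
  have hR0 : 0 < R := by positivity
  obtain ⟨M, σ, hσ1, hσ2, hM⟩ := hτ₀ (Real.log (N / R)) (by
    rw [Real.le_log_iff_exp_le (by positivity), le_div_iff₀ hR0, hR]
    linarith)
  set τ := Real.log (N / R) with hτ
  have heτ : R * Real.exp τ = N := by
    rw [hτ, Real.exp_log (by positivity)]; field_simp
  have hexp : ∀ i : ℕ, R * Real.exp (σ + i * s) = N * Real.exp (σ - τ + i * s) := by
    intro i
    rw [show σ + i * s = τ + (σ - τ + i * s) by ring, Real.exp_add τ, ← mul_assoc, heτ]
  have hmem : ∀ i < T, ∃ k, k ≠ 0 ∧ M i * z ∈ gens ^ (2 * k) ∧ Adm (M i) := by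
    intro i hi
    obtain ⟨⟨a, b, ha, hab⟩, -⟩ := hM i hi
    obtain ⟨o', ho'⟩ := hoe.two_dvd
    have h1 : M i ∈ gens ^ (o * a + o * b) := by
      rw [hab, pow_add]
      exact Finset.mul_mem_mul
        (Finset.pow_mem_pow (mem_gens.2 ⟨1, by norm_num, by norm_num, rfl⟩))
        (Finset.pow_mem_pow (mem_gens.2 ⟨2, by norm_num, by norm_num, rfl⟩))
    refine ⟨o' * a + o' * b + k, ?_, ?_, adm_of_mem_pow h1⟩
    · have : 0 < o' * a := Nat.mul_pos (by omega) ha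
      omega
    · rw [show 2 * (o' * a + o' * b + k) = (o * a + o * b) + 2 * k by rw [ho']; ring, pow_add]
      exact Finset.mul_mem_mul h1 hz
  refine ⟨fun i => M i * z, fun i hi => ⟨?_, ?_⟩, fun x hx y hy => ?_⟩
  · obtain ⟨⟨a, b, -, hab⟩, -⟩ := hM i hi
    rw [map_mul, hzg, hab, map_mul, pow_mul, pow_mul, map_pow _ (cfGen 1 ^ o),
      map_pow _ (cfGen 2 ^ o), hoq, hoq]
    simp
  · obtain ⟨k, hk, h, -⟩ := hmem i hi
    exact ⟨k, hk, h⟩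
  have ax : Adm x := adm hx
  have ay : Adm y.transpose := (adm hy).transpose
  have hx1 : (x 1 1 : ℝ) ≤ S.D 0 J₁ := d_le_D' hx
  have hx2 : (S.D 0 J₁ : ℝ) ≤ C0 * x 1 1 := D_le_C0 S (Nat.zero_le _) hx
  have hy1 : (y 1 1 : ℝ) ≤ S.D 0 J₂ := d_le_D' hy
  have hy2 : (S.D 0 J₂ : ℝ) ≤ C0 * y 1 1 := D_le_C0 S (Nat.zero_le _) hy
  have hx0 : (0 : ℝ) ≤ x 1 1 := ax.cast_nonneg 1 1
  have hy0 : (0 : ℝ) ≤ y 1 1 := (adm hy).cast_nonneg 1 1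
  have hup : ∀ i < T, (((x * (M i * z) * y.transpose) 1 1 : ℤ) : ℝ) ≤
      N * Real.exp (σ - τ + i * s) := by
    intro i hi
    obtain ⟨-, -, -, am⟩ := hmem i hi
    obtain ⟨-, -, h2, -⟩ := hM i hi
    have e1 : (((x * (M i * z) * y.transpose) 1 1 : ℤ) : ℝ) ≤
        2 * (((x * (M i * z)) 1 1 : ℤ) * y 1 1) := by
      exact_mod_cast (ax.mul (am.mul az)).d_mul_le ay
    have e2 : (((x * (M i * z)) 1 1 : ℤ) : ℝ) ≤ 2 * (x 1 1 * ((M i * z) 1 1 : ℤ)) := by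
      exact_mod_cast ax.d_mul_le (am.mul az)
    have e3 : (((M i * z) 1 1 : ℤ) : ℝ) ≤ 2 * (M i 1 1 * z 1 1) := by
      exact_mod_cast am.d_mul_le az
    rw [← hexp, hR]
    calc _ ≤ 2 * ((2 * (x 1 1 * (2 * ((2 * Real.exp (σ + i * s)) * z 1 1)))) * y 1 1) := by
          refine e1.trans ?_
          gcongr
          refine e2.trans ?_
          gcongr
          refine e3.trans ?_
          gcongr
      _ = 16 * z 1 1 * (x 1 1 * y 1 1) * Real.exp (σ + i * s) := by ring
      _ ≤ _ := by gcongr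
  have hlo : ∀ i < T, N * Real.exp (σ - τ + i * s) ≤
      64 * C0 ^ 2 * ((x * (M i * z) * y.transpose) 1 1 : ℤ) := by
    intro i hi
    obtain ⟨-, -, -, am⟩ := hmem i hi
    obtain ⟨-, h1, -, -⟩ := hM i hi
    have e1 : ((x * (M i * z)) 1 1 : ℤ) * (y 1 1 : ℝ) ≤
        ((x * (M i * z) * y.transpose) 1 1 : ℤ) := by
      exact_mod_cast (ax.mul (am.mul az)).le_d_mul ay
    have e2 : x 1 1 * ((M i * z) 1 1 : ℤ) ≤ (((x * (M i * z)) 1 1 : ℤ) : ℝ) := by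
      exact_mod_cast ax.le_d_mul (am.mul az)
    have e3 : (M i 1 1 * z 1 1 : ℝ) ≤ ((M i * z) 1 1 : ℤ) := by
      exact_mod_cast am.le_d_mul az
    have hC0 : 0 ≤ C0 := zero_le_one.trans one_le_C0
    have hm0 : (0 : ℝ) ≤ M i 1 1 := am.cast_nonneg 1 1
    rw [← hexp, hR]
    calc 16 * z 1 1 * (S.D 0 J₁ * S.D 0 J₂ : ℝ) * Real.exp (σ + i * s) ≤
          16 * z 1 1 * ((C0 * x 1 1) * (C0 * y 1 1)) * (4 * M i 1 1) := by gcongr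
      _ = 64 * C0 ^ 2 * ((x 1 1 * (M i 1 1 * z 1 1)) * y 1 1) := by ring
      _ ≤ _ := by
        gcongr
        refine le_trans ?_ e1
        gcongr
        refine le_trans ?_ e2
        gcongr
  refine ⟨fun i hi => ⟨?_, ?_⟩, fun e he he' => ?_⟩
  · have h1 := hlo i hi
    have h2 : N * Real.exp (-1) ≤ N * Real.exp (σ - τ + i * s) := by
      gcongr
      have : 0 ≤ i * s := by positivity
      linarith
    have h3 : Real.exp (-1) * Real.exp 3 = Real.exp 2 := by rw [← Real.exp_add]; norm_num
    have h4 : (1 : ℝ) ≤ Real.exp 2 := Real.one_le_exp (by norm_num)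
    have h5 : 0 < Real.exp 3 := Real.exp_pos 3
    have h6 := mul_le_mul_of_nonneg_right (h2.trans h1) h5.le
    rw [mul_assoc, h3] at h6
    have h7 : (0 : ℝ) ≤ ((x * (M i * z) * y.transpose) 1 1 : ℤ) := by
      have h8 : 0 ≤ 64 * C0 ^ 2 * (((x * (M i * z) * y.transpose) 1 1 : ℤ) : ℝ) :=
        le_trans (by positivity) h1
      exact nonneg_of_mul_nonneg_right h8 (by positivity)
    have h9 : 0 ≤ 64 * C0 ^ 2 * (((x * (M i * z) * y.transpose) 1 1 : ℤ) : ℝ) * Real.exp 3 := by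
      positivity
    rw [B0]
    nlinarith
  · refine (hup i hi).trans ?_
    rw [mul_comm, B0, ← heW, ← Real.exp_add]
    refine mul_le_mul_of_nonneg_right (Real.exp_le_exp.2 ?_) hN.le
    have : (i : ℝ) ≤ T - 1 := by
      have : (i : ℝ) + 1 ≤ T := by exact_mod_cast hi
      linarith
    have : i * s ≤ (T - 1) * s := by gcongr
    linarith
  · refine exists_crossing (d := fun i => (((x * (M i * z) * y.transpose) 1 1 : ℤ) : ℝ)) hs hs1
      (by linarith) (by linarith) hN hC1 hT1 hup hlo (fun i hi => ?_) he he'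
    obtain ⟨-, -, -, h⟩ := hM i (by omega)
    have h1 := entry_le_of_entry_le ax (az.mul ay) (h (i + 1) hi) 1 1
    simp only [← mul_assoc] at h1 ⊢
    refine h1.trans_eq ?_
    push_cast
    rw [show ((i : ℝ) + 1 - i) * s = s by ring]

theorem exists_pattern : ∃ κ : ℝ, 1 ≤ κ ∧ ∃ K : ℕ, 4 ≤ K ∧ ∃ C : ℝ, 1 ≤ C ∧
    ∀ (q : ℕ) [NeZero q] (η₀ : ℝ), 0 < η₀ → ∃ η : ℝ, 0 < η ∧ η ≤ η₀ ∧
      ∃ T : ℕ, 0 < T ∧ T * η ≤ C ∧ ∃ N₀ : ℕ, ∀ N ≥ N₀, ∃ J₁ J₂ : ℕ,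
        ∃ p : ℕ × Matrix (Fin 2) (Fin 2) (ZMod q) → Mat,
          S.Good J₁ J₂ (Finset.range T ×ˢ words q) p κ (K * N) ∧ S.Scales J₁ J₂ (K * N) ∧
          (∀ h ∈ Finset.range T ×ˢ words q,
            red q (p h) = h.2 ∧ ∃ k, k ≠ 0 ∧ p h ∈ gens ^ (2 * k)) ∧
          ∀ x ∈ S.U 0 J₁, ∀ y ∈ S.U 0 J₂,
            (∀ h ∈ Finset.range T ×ˢ words q, (x * p h * y.transpose) 1 1 < (K * N : ℕ)) ∧
            ∀ g ∈ words q, ∀ e : ℕ, N ≤ e → e < 2 * N → ∃ i < T,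
              (e : ℤ) ≤ (x * p (i, g) * y.transpose) 1 1 ∧
              (((x * p (i, g) * y.transpose) 1 1 : ℤ) : ℝ) < e + η * N := by
  have hB := one_le_B0
  set K : ℕ := ⌈B0⌉₊ + 4 with hK
  have hKB : B0 + 4 ≤ K := by rw [hK]; push_cast; linarith [Nat.le_ceil B0]
  have hW : 0 ≤ Real.log (128 * C0 ^ 2) :=
    Real.log_nonneg (by linarith [one_le_pow₀ one_le_C0 (n := 2)])
  refine ⟨K * B0, by nlinarith, K, by omega, 10 * (Real.log (128 * C0 ^ 2) + 4), by linarith, ?_⟩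
  intro q _ η₀ hη₀
  obtain ⟨η, h1, h2, T, hT, hTη, hlad⟩ := S.exists_ladder q hη₀
  refine ⟨η, h1, h2, T, hT, hTη, ?_⟩
  choose! Z hZ0 hZ using hlad
  set Y : ℝ := ∑ g ∈ words q, Z g with hY
  have hZY : ∀ g ∈ words q, Z g ≤ Y := fun g hg => Finset.single_le_sum hZ0 hg
  obtain ⟨L₀, hL₀⟩ := S.exists_scales
  obtain ⟨L₁, hL₁⟩ := exists_forall_le_rpow (Y * K) (c := 0.005) (by norm_num)
  refine ⟨max (max L₀ L₁) 1, fun N hN => ?_⟩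
  have hN1 : 1 ≤ N := (le_max_right _ _).trans hN
  have hNK : N ≤ K * N := Nat.le_mul_of_pos_left N (by omega)
  have hNL₀ : L₀ ≤ K * N := ((le_max_left _ _).trans (le_max_left _ _)).trans (hN.trans hNK)
  have hNL₁ : L₁ ≤ K * N := ((le_max_right _ _).trans (le_max_left _ _)).trans (hN.trans hNK)
  obtain ⟨J₁, J₂, hsc, hD⟩ := hL₀ _ hNL₀
  have hN0 : (0 : ℝ) < N := by exact_mod_cast hN1
  have hKpos : (0 : ℝ) < K := by linarith
  have hY0 : 0 ≤ Y := Finset.sum_nonneg hZ0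
  have hbig : Y * (S.D 0 J₁ * S.D 0 J₂ : ℝ) ≤ N := by
    refine le_of_mul_le_mul_left ?_ hKpos
    have hL0 : (0 : ℝ) < ((K * N : ℕ) : ℝ) := by push_cast; positivity
    calc (K : ℝ) * (Y * (S.D 0 J₁ * S.D 0 J₂)) = (Y * K) * (S.D 0 J₁ * S.D 0 J₂) := by ring
      _ ≤ ((K * N : ℕ) : ℝ) ^ (0.005 : ℝ) * ((K * N : ℕ) : ℝ) ^ (0.995 : ℝ) :=
        mul_le_mul (hL₁ _ hNL₁) hD (by positivity) (by positivity)
      _ = K * N := by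
        rw [← Real.rpow_add hL0]; norm_num
  have hladder := fun g (hg : g ∈ words q) => hZ g hg J₁ J₂ N hN0
    (le_trans (mul_le_mul_of_nonneg_right (hZY g hg) (by positivity)) hbig)
  choose! P hP1 hP2 using hladder
  have hL : ((K * N : ℕ) : ℝ) = K * N := by push_cast; ring
  refine ⟨J₁, J₂, fun h => P h.2 h.1, ⟨?_, ?_, ?_⟩, hsc, ?_, fun x hx y hy => ⟨?_, ?_⟩⟩
  · intro h hh
    obtain ⟨hi, hg⟩ := Finset.mem_product.1 hh
    obtain ⟨-, k, -, hk⟩ := hP1 h.2 hg h.1 (Finset.mem_range.1 hi)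
    exact adm_of_mem_pow hk
  · intro x hx h hh y hy
    obtain ⟨hi, hg⟩ := Finset.mem_product.1 hh
    have := ((hP2 h.2 hg x hx y hy).1 h.1 (Finset.mem_range.1 hi)).1
    rw [hL, mul_assoc]
    gcongr
  · intro x hx h hh y hy
    obtain ⟨hi, hg⟩ := Finset.mem_product.1 hh
    refine ((hP2 h.2 hg x hx y hy).1 h.1 (Finset.mem_range.1 hi)).2.trans ?_
    rw [hL, show (K : ℝ) * B0 * (K * N) = (K * K) * (B0 * N) by ring]
    refine le_mul_of_one_le_left (by positivity) ?_
    nlinarith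
  · intro h hh
    obtain ⟨hi, hg⟩ := Finset.mem_product.1 hh
    exact hP1 h.2 hg h.1 (Finset.mem_range.1 hi)
  · intro h hh
    obtain ⟨hi, hg⟩ := Finset.mem_product.1 hh
    have h3 := ((hP2 h.2 hg x hx y hy).1 h.1 (Finset.mem_range.1 hi)).2
    have h4 : (((x * P h.2 h.1 * y.transpose) 1 1 : ℤ) : ℝ) < ((K * N : ℕ) : ℝ) := by
      rw [hL]
      refine h3.trans_lt ?_
      gcongr
      linarith
    exact_mod_cast h4
  · intro g hg e he he'
    obtain ⟨i, hi, h3, h4⟩ := (hP2 g hg x hx y hy).2 e (by exact_mod_cast he)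
      (by exact_mod_cast he')
    exact ⟨i, hi, by exact_mod_cast h3, h4⟩

end Blocks

lemma norm_one_sub_ex_le (x : ℝ) : ‖1 - ex x‖ ≤ 2 * Real.pi * |x| := by
  have h := Real.norm_exp_I_mul_ofReal_sub_one_le (x := 2 * Real.pi * x)
  rw [norm_sub_rev]
  have : ex x = Complex.exp (Complex.I * ((2 * Real.pi * x : ℝ) : ℂ)) := by
    rw [ex]; push_cast; ring_nf
  rw [this]
  refine h.trans ?_
  rw [Real.norm_eq_abs, abs_mul, abs_of_pos Real.two_pi_pos]

/-- The average of an additive character modulo `L` over the first `H` multiples of `-q`. -/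
noncomputable def apAvg (L q H t : ℕ) : ℂ :=
  (1 / H : ℂ) * ∑ i ∈ Finset.range H, ex (-(t * (q * i) / L))

lemma norm_one_sub_apAvg_le {L q H t : ℕ} (hH : 0 < H) {δ : ℝ}
    (h : ∀ i < H, ‖1 - ex (-(t * (q * i) / L))‖ ≤ δ) : ‖1 - apAvg L q H t‖ ≤ δ := by
  have hH' : (H : ℂ) ≠ 0 := by exact_mod_cast hH.ne'
  have : 1 - apAvg L q H t =
      (1 / H : ℂ) * ∑ i ∈ Finset.range H, (1 - ex (-(t * (q * i) / L))) := by
    rw [apAvg, Finset.sum_sub_distrib, mul_sub]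
    simp [hH']
  rw [this, norm_mul]
  have h1 : ‖∑ i ∈ Finset.range H, (1 - ex (-(t * (q * i) / L)))‖ ≤ H * δ := by
    refine (norm_sum_le_of_le _ fun i hi => h i (Finset.mem_range.1 hi)).trans ?_
    simp
  have hH'' : (0 : ℝ) < H := by exact_mod_cast hH
  rw [norm_div, norm_one, Complex.norm_natCast, div_mul_eq_mul_div, one_mul, div_le_iff₀ hH'']
  linarith

lemma norm_one_sub_apAvg_le_two {L q H t : ℕ} (hH : 0 < H) : ‖1 - apAvg L q H t‖ ≤ 2 :=
  norm_one_sub_apAvg_le hH fun i _ => (norm_sub_le _ _).trans (by rw [norm_ex, norm_one]; norm_num)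

open Finset in
lemma sum_norm_sq_sum_ex {L : ℕ} (hL : 0 < L) {E : Finset ℕ} (hE : ∀ e ∈ E, e < L) :
    ∑ t ∈ range L, ‖∑ e ∈ E, ex (-(t * e / L))‖ ^ 2 = L * E.card := by
  have h1 : ∀ t ∈ range L, ((‖∑ e ∈ E, ex (-(t * e / L))‖ ^ 2 : ℝ) : ℂ) =
      ∑ e ∈ E, ∑ e' ∈ E, ex (t * ((e' - e : ℤ)) / L) := by
    intro t _
    rw [Complex.ofReal_pow, ← Complex.mul_conj', map_sum, Finset.sum_mul_sum]
    refine sum_congr rfl fun e _ => sum_congr rfl fun e' _ => ?_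
    rw [conj_ex, ← ex_add]
    congr 1
    push_cast
    ring
  have h2 : ((∑ t ∈ range L, ‖∑ e ∈ E, ex (-(t * e / L))‖ ^ 2 : ℝ) : ℂ) = L * E.card := by
    rw [Complex.ofReal_sum, sum_congr rfl h1, sum_comm]
    have : ∀ e ∈ E, ∑ t ∈ range L, ∑ e' ∈ E, ex (t * ((e' - e : ℤ)) / L) = L := by
      intro e he
      rw [sum_comm, sum_eq_single_of_mem e he]
      · have := sum_ex hL 0
        simpa using this
      · intro e' he' hne
        have := sum_ex hL (e' - e : ℤ)
        rw [if_neg] at this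
        · exact_mod_cast this
        · intro hd
          have h3 := Int.eq_zero_of_abs_lt_dvd hd (by
            have := hE e he
            have := hE e' he'
            rw [abs_lt]; omega)
          omega
    rw [sum_congr rfl this]
    simp [mul_comm]
  exact_mod_cast h2

open Finset in
lemma sq_mul_le_of_abs_mul_le {ι : Type*} {T : Finset ι} {f s k : ι → ℝ} {W H L Y : ℝ}
    (hL : 0 < L) (hf : ∑ t ∈ T, f t ^ 2 = L * Y) (hW : |W| * L ≤ H * ∑ t ∈ T, f t * (s t * k t)) :
    W ^ 2 * L ≤ H ^ 2 * Y * ∑ t ∈ T, s t ^ 2 * k t ^ 2 := by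
  have hCS := sum_mul_sq_le_sq_mul_sq T f (fun t => s t * k t)
  rw [hf] at hCS
  simp only [mul_pow] at hCS
  refine le_of_mul_le_mul_right ?_ hL
  calc W ^ 2 * L * L = (|W| * L) ^ 2 := by rw [mul_pow, sq_abs]; ring
    _ ≤ (H * ∑ t ∈ T, f t * (s t * k t)) ^ 2 := pow_le_pow_left₀ (by positivity) hW 2
    _ = H ^ 2 * (∑ t ∈ T, f t * (s t * k t)) ^ 2 := mul_pow _ _ _
    _ ≤ H ^ 2 * (L * Y * ∑ t ∈ T, s t ^ 2 * k t ^ 2) := by gcongr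
    _ = _ := by ring

open Finset in
/-- If the values `d ω` avoid `E`, then the number of pairs `(ω, e)` for which `d ω` lies in a short
progression starting at `e` is controlled by the exponential sum of `d`. -/
lemma sq_card_le {α : Type*} {Ω : Finset α} {d : α → ℤ} {E : Finset ℕ} {L q H : ℕ} (hH : 0 < H)
    (hd : ∀ ω ∈ Ω, 0 ≤ d ω ∧ d ω < L) (hE : ∀ e ∈ E, ∀ i < H, e + q * i < L)
    (hdE : ∀ ω ∈ Ω, ∀ e ∈ E, d ω ≠ e) :
    (∑ ω ∈ Ω, ∑ e ∈ E, (((range H).filter fun i : ℕ => d ω = e + q * i).card : ℝ)) ^ 2 * L ≤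
      H ^ 2 * E.card *
        ∑ t ∈ range L, ‖∑ ω ∈ Ω, ex (t * d ω / L)‖ ^ 2 * ‖1 - apAvg L q H t‖ ^ 2 := by
  rcases E.eq_empty_or_nonempty with rfl | ⟨e₀, he₀⟩
  · simp
  have hL : 0 < L := by have := hE e₀ he₀ 0 hH; omega
  have hLR : (0 : ℝ) < L := by exact_mod_cast hL
  have hLC : (L : ℂ) ≠ 0 := by exact_mod_cast hL.ne'
  have hHC : (H : ℂ) ≠ 0 := by exact_mod_cast hH.ne'
  have key : ∀ ω ∈ Ω, ∀ e ∈ E, ∀ i < H,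
      (if d ω = e + q * i then (1 : ℂ) else 0) * L =
        ∑ t ∈ range L, ex (t * d ω / L) * ex (-(t * e / L)) * ex (-(t * (q * i) / L)) := by
    intro ω hω e he i hi
    have h1 := sum_ex hL (d ω - (e + q * i))
    have h2 : (L : ℤ) ∣ d ω - (e + q * i) ↔ d ω = e + q * i := by
      constructor
      · intro h
        have := Int.eq_zero_of_abs_lt_dvd h (by
          have h3 := hE e he i hi
          have h4 := hd ω hω
          zify at h3
          have : (0 : ℤ) ≤ e + q * i := by positivity
          rw [abs_lt]; constructor <;> linarith)
        linarith
      · intro h; rw [h]; simp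
    simp only [h2] at h1
    rw [ite_mul, one_mul, zero_mul, ← h1]
    refine sum_congr rfl fun t _ => ?_
    rw [← ex_add, ← ex_add]
    congr 1
    push_cast
    ring
  have key0 : ∀ ω ∈ Ω, ∀ e ∈ E, ∑ t ∈ range L, ex (t * d ω / L) * ex (-(t * e / L)) = 0 := by
    intro ω hω e he
    have := key ω hω e he 0 hH
    simp only [Nat.cast_zero, mul_zero, zero_div, neg_zero, ex_zero, mul_one, add_zero,
      if_neg (hdE ω hω e he), zero_mul] at this
    exact this.symm
  set W : ℝ := ∑ ω ∈ Ω, ∑ e ∈ E, (((range H).filter fun i : ℕ => d ω = e + q * i).card : ℝ) with hW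
  set s : ℕ → ℂ := fun t => ∑ ω ∈ Ω, ex (t * d ω / L) with hs
  set f : ℕ → ℂ := fun t => ∑ e ∈ E, ex (-(t * e / L)) with hf
  have hW1 : (W : ℂ) * L = ∑ t ∈ range L, s t * f t * (H * apAvg L q H t) := by
    have : ∀ t ∈ range L, s t * f t * (H * apAvg L q H t) = ∑ ω ∈ Ω, ∑ e ∈ E, ∑ i ∈ range H,
        ex (t * d ω / L) * ex (-(t * e / L)) * ex (-(t * (q * i) / L)) := by
      intro t _
      have h5 : (H : ℂ) * apAvg L q H t = ∑ i ∈ range H, ex (-(t * (q * i) / L)) := by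
        rw [apAvg]; field_simp
      rw [h5]
      simp only [hs, hf, sum_mul, mul_sum]
      rw [sum_comm, sum_congr rfl fun e _ => sum_comm, sum_comm]
    rw [sum_congr rfl this, sum_comm, hW, Complex.ofReal_sum, sum_mul]
    refine sum_congr rfl fun ω hω => ?_
    rw [sum_comm, Complex.ofReal_sum, sum_mul]
    refine sum_congr rfl fun e he => ?_
    rw [sum_comm, card_filter]
    push_cast
    rw [sum_mul]
    refine sum_congr rfl fun i hi => ?_
    rw [← key ω hω e he i (mem_range.1 hi)]
    split_ifs <;> simp
  have hW2 : ∑ t ∈ range L, s t * f t = 0 := by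
    simp only [hs, hf, sum_mul_sum]
    rw [sum_comm]
    refine sum_eq_zero fun ω hω => ?_
    rw [sum_comm]
    exact sum_eq_zero fun e he => key0 ω hω e he
  have hW3 : (W : ℂ) * L = -(H * ∑ t ∈ range L, f t * (s t * (1 - apAvg L q H t))) := by
    have : ∑ t ∈ range L, f t * (s t * (1 - apAvg L q H t)) =
        ∑ t ∈ range L, s t * f t - ∑ t ∈ range L, s t * f t * apAvg L q H t := by
      rw [← sum_sub_distrib]
      exact sum_congr rfl fun t _ => by ring
    rw [this, hW2, hW1, zero_sub, mul_neg, neg_neg, mul_sum]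
    exact sum_congr rfl fun t _ => by ring
  have hW4 : |W| * L ≤ H * ∑ t ∈ range L, ‖f t‖ * (‖s t‖ * ‖1 - apAvg L q H t‖) := by
    have h6 := congrArg norm hW3
    rw [norm_neg, norm_mul, norm_mul, Complex.norm_real, Complex.norm_natCast,
      Complex.norm_natCast, Real.norm_eq_abs] at h6
    rw [h6]
    refine mul_le_mul_of_nonneg_left ((norm_sum_le _ _).trans (le_of_eq ?_)) (by positivity)
    simp only [norm_mul]
  exact sq_mul_le_of_abs_mul_le hLR
    (sum_norm_sq_sum_ex hL fun e he => by have := hE e he 0 hH; omega) hW4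

open Finset Classical in
lemma card_major_le {L M : ℕ} (hM : M ≤ L) :
    ((range L).filter (Major L M)).card ≤
      (Icc (-(2 * M : ℤ)) (2 * M) ×ˢ Icc (1 : ℤ) M ×ˢ Icc (-(M * M : ℤ)) (M * M)).card := by
  have h : ∀ t ∈ (range L).filter (Major L M), ∃ v : ℤ × ℤ × ℤ,
      v ∈ Icc (-(2 * M : ℤ)) (2 * M) ×ˢ Icc (1 : ℤ) M ×ˢ Icc (-(M * M : ℤ)) (M * M) ∧
        v.2.1 * t = v.1 * L + v.2.2 := by
    intro t ht
    obtain ⟨ht, a, q, h1, h2, h3⟩ := mem_filter.1 ht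
    have htL : (t : ℤ) < L := by exact_mod_cast mem_range.1 ht
    have h2' : q ≤ M := by exact_mod_cast h2
    have h3' : |q * t - a * L| ≤ M * q := by exact_mod_cast h3
    obtain ⟨h4, h5⟩ := abs_le.1 h3'
    have hML : (M : ℤ) ≤ L := by exact_mod_cast hM
    have hMq : (M : ℤ) * q ≤ M * M := by nlinarith
    have ht0 : (0 : ℤ) ≤ t := by positivity
    have hL0 : (0 : ℤ) < L := by omega
    refine ⟨(a, q, q * t - a * L), ?_, by ring⟩
    simp only [mem_product, mem_Icc]
    refine ⟨⟨?_, ?_⟩, ⟨h1, h2'⟩, ⟨by linarith, by linarith⟩⟩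
    · by_contra! hc
      nlinarith
    · by_contra! hc
      nlinarith
  choose! v hv hv' using h
  refine card_le_card_of_injOn v (fun t ht => hv t ht) ?_
  intro t ht t' ht' e
  have h1 := hv' t ht
  have h2 := hv' t' ht'
  have h3 := hv t ht
  simp only [mem_product, mem_Icc] at h3
  rw [e] at h1 h3
  rw [← h2] at h1
  have := mul_left_cancel₀ (by omega) h1
  exact_mod_cast this

lemma Major.norm_one_sub_apAvg_le {L M H t : ℕ} (h : Major L M t) (hH : 0 < H) (hL : 0 < L) :
    ‖1 - apAvg L M.factorial H t‖ ≤ 2 * Real.pi * (M * (M.factorial * H) / L) := by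
  obtain ⟨a, q, h1, h2, h3⟩ := h
  have h2' : q ≤ M := by exact_mod_cast h2
  have hLR : (0 : ℝ) < L := by exact_mod_cast hL
  lift q to ℕ using by omega
  obtain ⟨m, hm⟩ := Nat.dvd_factorial (show 0 < q by omega) (show q ≤ M by omega)
  refine _root_.norm_one_sub_apAvg_le hH fun i hi => ?_
  have h4 : ex (-(t * (M.factorial * i) / L)) = ex (-((q * t - a * L) * (m * i) / L)) := by
    have : (-(t * (M.factorial * i) / L) : ℝ) =
        -((q * t - a * L) * (m * i) / L) + ((-(a * (m * i)) : ℤ) : ℝ) := by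
      rw [hm]
      push_cast
      field_simp
      ring
    rw [this, ex_add, ex_int, mul_one]
  rw [h4]
  refine (norm_one_sub_ex_le _).trans ?_
  refine mul_le_mul_of_nonneg_left ?_ Real.two_pi_pos.le
  push_cast at h3
  rw [abs_neg, abs_div, abs_mul, abs_of_pos hLR, abs_of_nonneg (show (0 : ℝ) ≤ m * i by positivity),
    hm]
  refine div_le_div_of_nonneg_right ?_ hLR.le
  have hiH : (i : ℝ) ≤ H := by exact_mod_cast hi.le
  calc |(q * t - a * L : ℝ)| * (m * i) ≤ (M * q) * (m * H) := by gcongr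
    _ = M * ((q * m : ℕ) * H) := by push_cast; ring

namespace Blocks
variable {S : Blocks}

open Finset in
lemma words_card_le_sum {q : ℕ} [NeZero q] {T N J₁ J₂ H e : ℕ} {η c : ℝ}
    {p : ℕ × Matrix (Fin 2) (Fin 2) (ZMod q) → Mat} {x y : Mat}
    (hx : x ∈ S.U 0 J₁) (hy : y ∈ S.U 0 J₂) (he : 0 < e) (hc : c * e ≤ e.totient)
    (hp : ∀ h ∈ range T ×ˢ words q, red q (p h) = h.2) (hH : η * N ≤ q * H)
    (h : ∀ g ∈ words q, ∃ i < T, (e : ℤ) ≤ (x * p (i, g) * y.transpose) 1 1 ∧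
      (((x * p (i, g) * y.transpose) 1 1 : ℤ) : ℝ) < e + η * N) :
    (words q).card * c ≤ q * ∑ h ∈ range T ×ˢ words q,
      (((range H).filter fun i : ℕ => (x * p h * y.transpose) 1 1 = (e : ℤ) + q * i).card : ℝ) := by
  have hxw : red q x ∈ words q := red_mem_words (S.U_subset 0 J₁ hx)
  have hyw : red q y.transpose ∈ words q :=
    red_mem_words (transpose_mem_pow (S.U_subset 0 J₂ hy))
  have hq : 0 < q := Nat.pos_of_ne_zero (NeZero.ne q)
  have heR : (0 : ℝ) < e := by exact_mod_cast he
  have h1 : ((words q).card : ℝ) * e.totient ≤ e * q *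
      ((words q).filter fun g => (red q x * g * red q y.transpose) 1 1 = (e : ZMod q)).card := by
    rw [card_filter_words_mul hxw hyw]
    exact_mod_cast card_words_mul_totient_le e
  have h2 : ((words q).card : ℝ) * c ≤ q *
      ((words q).filter fun g => (red q x * g * red q y.transpose) 1 1 = (e : ZMod q)).card := by
    refine le_of_mul_le_mul_right ?_ heR
    calc ((words q).card : ℝ) * c * e = (words q).card * (c * e) := by ring
      _ ≤ (words q).card * e.totient := by gcongr
      _ ≤ _ := h1
      _ = _ := by ring
  refine h2.trans (mul_le_mul_of_nonneg_left ?_ (Nat.cast_nonneg _))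
  rw [card_filter, sum_product_right]
  push_cast
  refine sum_le_sum fun g hg => ?_
  split_ifs with hge
  · obtain ⟨i, hi, h3, h4⟩ := h g hg
    refine le_trans ?_ (single_le_sum (f := fun i => (((range H).filter fun j : ℕ =>
      (x * p (i, g) * y.transpose) 1 1 = (e : ℤ) + q * j).card : ℝ))
      (fun _ _ => Nat.cast_nonneg _) (mem_range.2 hi))
    have hd : (q : ℤ) ∣ (x * p (i, g) * y.transpose) 1 1 - e := by
      have hpg : red q (p (i, g)) = g := hp (i, g) (mem_product.2 ⟨mem_range.2 hi, hg⟩)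
      rw [← hpg, ← map_mul, ← map_mul, red_apply] at hge
      rw [← ZMod.intCast_zmod_eq_zero_iff_dvd]
      push_cast
      rw [hge, sub_self]
    obtain ⟨j, hj⟩ := hd
    have hj0 : 0 ≤ j := by
      by_contra! hneg
      have : (0 : ℤ) < q := by exact_mod_cast hq
      nlinarith
    lift j to ℕ using hj0
    have hjH : j < H := by
      have h5 : (((x * p (i, g) * y.transpose) 1 1 : ℤ) : ℝ) - e = q * j := by exact_mod_cast hj
      have h6 : (q : ℝ) * j < q * H := by linarith
      exact_mod_cast lt_of_mul_lt_mul_left h6 (by positivity)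
    have : 0 < ((range H).filter fun j : ℕ =>
        (x * p (i, g) * y.transpose) 1 1 = (e : ℤ) + q * j).card :=
      card_pos.2 ⟨j, mem_filter.2 ⟨mem_range.2 hjH, by omega⟩⟩
    exact_mod_cast this
  · positivity

/-- Matrices indexing `expSum`, as triples. -/
def triples {ι : Type*} (S : Blocks) (J₁ J₂ : ℕ) (I : Finset ι) : Finset (Mat × ι × Mat) :=
  S.U 0 J₁ ×ˢ I ×ˢ S.U 0 J₂

lemma card_triples {ι : Type*} (J₁ J₂ : ℕ) (I : Finset ι) :
    (S.triples J₁ J₂ I).card = S.vol J₁ J₂ I := by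
  rw [triples, vol, Finset.card_product, Finset.card_product, mul_assoc]

lemma sum_triples {ι : Type*} (J₁ J₂ : ℕ) (I : Finset ι) (p : ι → Mat) (L t : ℕ) :
    ∑ ω ∈ S.triples J₁ J₂ I, ex (t * ((ω.1 * p ω.2.1 * ω.2.2.transpose) 1 1 : ℤ) / L) =
      S.expSum J₁ J₂ I p L t := by
  rw [triples, expSum, Finset.sum_product]
  exact Finset.sum_congr rfl fun x _ => Finset.sum_product _ _ _

open Finset in
lemma vol_mul_card_le {q : ℕ} [NeZero q] {T N J₁ J₂ H : ℕ} {η c : ℝ} {E : Finset ℕ}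
    {p : ℕ × Matrix (Fin 2) (Fin 2) (ZMod q) → Mat}
    (hE : ∀ e ∈ E, 0 < e ∧ c * e ≤ e.totient)
    (hp : ∀ h ∈ range T ×ˢ words q, red q (p h) = h.2) (hH : η * N ≤ q * H)
    (h : ∀ x ∈ S.U 0 J₁, ∀ y ∈ S.U 0 J₂, ∀ g ∈ words q, ∀ e ∈ E,
      ∃ i < T, (e : ℤ) ≤ (x * p (i, g) * y.transpose) 1 1 ∧
      (((x * p (i, g) * y.transpose) 1 1 : ℤ) : ℝ) < e + η * N) :
    S.vol J₁ J₂ (range T ×ˢ words q) * E.card * c ≤ q * T *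
      ∑ ω ∈ S.triples J₁ J₂ (range T ×ˢ words q), ∑ e ∈ E, (((range H).filter fun i : ℕ =>
        (ω.1 * p ω.2.1 * ω.2.2.transpose) 1 1 = (e : ℤ) + q * i).card : ℝ) := by
  have h1 : ∑ x ∈ S.U 0 J₁, ∑ y ∈ S.U 0 J₂, ∑ e ∈ E, ((words q).card * c : ℝ) ≤
      ∑ x ∈ S.U 0 J₁, ∑ y ∈ S.U 0 J₂, ∑ e ∈ E, (q * ∑ h ∈ range T ×ˢ words q,
        (((range H).filter fun i : ℕ =>
          (x * p h * y.transpose) 1 1 = (e : ℤ) + q * i).card : ℝ)) := by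
    refine sum_le_sum fun x hx => sum_le_sum fun y hy => sum_le_sum fun e he => ?_
    exact words_card_le_sum hx hy (hE e he).1 (hE e he).2 hp hH fun g hg => h x hx y hy g hg e he
  have h2 : ∑ ω ∈ S.triples J₁ J₂ (range T ×ˢ words q), ∑ e ∈ E, (((range H).filter fun i : ℕ =>
        (ω.1 * p ω.2.1 * ω.2.2.transpose) 1 1 = (e : ℤ) + q * i).card : ℝ) =
      ∑ x ∈ S.U 0 J₁, ∑ y ∈ S.U 0 J₂, ∑ e ∈ E, ∑ h ∈ range T ×ˢ words q,
        (((range H).filter fun i : ℕ =>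
          (x * p h * y.transpose) 1 1 = (e : ℤ) + q * i).card : ℝ) := by
    rw [triples, sum_product]
    refine sum_congr rfl fun x _ => ?_
    rw [sum_product, sum_comm]
    exact sum_congr rfl fun y _ => sum_comm
  simp only [← mul_sum] at h1
  rw [← h2] at h1
  simp only [sum_const, nsmul_eq_mul] at h1
  rw [vol, card_product, card_range]
  push_cast
  refine le_of_eq_of_le ?_ ((mul_le_mul_of_nonneg_left h1 (Nat.cast_nonneg T)).trans_eq ?_) <;> ring

end Blocks

namespace Blocks
variable {S : Blocks}

lemma norm_expSum_le {ι : Type*} (J₁ J₂ : ℕ) (I : Finset ι) (p : ι → Mat) (L t : ℕ) :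
    ‖S.expSum J₁ J₂ I p L t‖ ≤ S.vol J₁ J₂ I := by
  rw [← sum_triples, ← card_triples]
  refine (norm_sum_le_of_le _ fun ω _ => (norm_ex _).le).trans ?_
  simp

open Finset Classical in
lemma sum_expSum_le {ι : Type} {J₁ J₂ L M H : ℕ} {I : Finset ι} {p : ι → Mat} {B θ m : ℝ}
    (hH : 0 < H) (hL : 0 < L) (hB : (((range L).filter (Major L M)).card : ℝ) ≤ B)
    (hθ : (M.factorial : ℝ) * H / L ≤ θ)
    (hm : ∑ t ∈ range L with ¬ Major L M t, ‖S.expSum J₁ J₂ I p L t‖ ^ 2 ≤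
      m * (S.vol J₁ J₂ I : ℝ) ^ 2) :
    ∑ t ∈ range L, ‖S.expSum J₁ J₂ I p L t‖ ^ 2 * ‖1 - apAvg L M.factorial H t‖ ^ 2 ≤
      (B * (2 * Real.pi * (M * θ)) ^ 2 + 4 * m) * (S.vol J₁ J₂ I : ℝ) ^ 2 := by
  have hθ0 : 0 ≤ θ := le_trans (by positivity) hθ
  rw [← sum_filter_add_sum_filter_not (range L) (Major L M), add_mul]
  refine add_le_add ?_ ?_
  · calc _ ≤ ∑ t ∈ range L with Major L M t,
          (S.vol J₁ J₂ I : ℝ) ^ 2 * (2 * Real.pi * (M * θ)) ^ 2 := by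
          refine sum_le_sum fun t ht => ?_
          have h1 := (mem_filter.1 ht).2.norm_one_sub_apAvg_le hH hL
          have h2 : ‖1 - apAvg L M.factorial H t‖ ≤ 2 * Real.pi * (M * θ) := by
            refine h1.trans ?_
            rw [mul_div_assoc]
            gcongr
          gcongr
          exact norm_expSum_le _ _ _ _ _ _
      _ = ((range L).filter (Major L M)).card *
          ((S.vol J₁ J₂ I : ℝ) ^ 2 * (2 * Real.pi * (M * θ)) ^ 2) := by
          rw [sum_const, nsmul_eq_mul]
      _ ≤ B * ((S.vol J₁ J₂ I : ℝ) ^ 2 * (2 * Real.pi * (M * θ)) ^ 2) := by gcongr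
      _ = _ := by ring
  · calc _ ≤ ∑ t ∈ range L with ¬ Major L M t, ‖S.expSum J₁ J₂ I p L t‖ ^ 2 * 2 ^ 2 := by
          refine sum_le_sum fun t _ => ?_
          gcongr
          exact norm_one_sub_apAvg_le_two hH
      _ = 4 * ∑ t ∈ range L with ¬ Major L M t, ‖S.expSum J₁ J₂ I p L t‖ ^ 2 := by
          rw [← sum_mul]; ring
      _ ≤ 4 * (m * (S.vol J₁ J₂ I : ℝ) ^ 2) := by gcongr
      _ = _ := by ring

end Blocks

/-- The final bookkeeping for the size `Y` of the exceptional set. -/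
lemma card_bound_of_sq_bound {V Y c q T W H L N η C δ X : ℝ} (hV : 0 < V) (hY : 0 < Y) (hc : 0 < c)
    (hW : V * Y * c ≤ q * T * W) (hWX : W ^ 2 * L ≤ H ^ 2 * Y * X) (hX : X ≤ δ * V ^ 2)
    (hqH : q * H ≤ 2 * (η * N)) (hTη : T * η ≤ C) (hT : 0 ≤ T) (hq : 0 ≤ q)
    (hH : 0 ≤ H) (hN : 0 < N) (hNL : N ≤ L) (hδ : 0 ≤ δ) : Y * c ^ 2 ≤ 4 * C ^ 2 * δ * N := by
  have h1 : (V * Y * c) ^ 2 ≤ (q * T * W) ^ 2 := pow_le_pow_left₀ (by positivity) hW 2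
  have h2 : (T * (q * H)) ^ 2 ≤ (2 * C * N) ^ 2 := by
    refine pow_le_pow_left₀ (by positivity) ?_ 2
    calc T * (q * H) ≤ T * (2 * (η * N)) := by gcongr
      _ = 2 * (T * η) * N := by ring
      _ ≤ 2 * C * N := by gcongr
  have h3 : (V ^ 2 * Y * N) * (Y * c ^ 2) ≤ (V ^ 2 * Y * N) * (4 * C ^ 2 * δ * N) := by
    calc (V ^ 2 * Y * N) * (Y * c ^ 2) = (V * Y * c) ^ 2 * N := by ring
      _ ≤ (V * Y * c) ^ 2 * L := by gcongr
      _ ≤ (q * T * W) ^ 2 * L := by gcongr; exact hN.le.trans hNL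
      _ = (q * T) ^ 2 * (W ^ 2 * L) := by ring
      _ ≤ (q * T) ^ 2 * (H ^ 2 * Y * X) := by gcongr
      _ ≤ (q * T) ^ 2 * (H ^ 2 * Y * (δ * V ^ 2)) := by gcongr
      _ = (T * (q * H)) ^ 2 * (Y * (δ * V ^ 2)) := by ring
      _ ≤ (2 * C * N) ^ 2 * (Y * (δ * V ^ 2)) := by gcongr
      _ = _ := by ring
  exact le_of_mul_le_mul_left h3 (by positivity)

open Finset Classical in
theorem card_not_mem_denoms_le {c ε : ℝ} (hc : 0 < c) (hε : 0 < ε) :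
    ∃ N₀ : ℕ, ∀ N ≥ N₀, ∀ E ⊆ Ico N (2 * N),
      (∀ e ∈ E, e ∉ Denoms {1, 2, 3, 4, 5} ∧ c * e ≤ e.totient) → (E.card : ℝ) ≤ ε * N := by
  obtain ⟨S⟩ := exists_blocks
  obtain ⟨κ, hκ, K, hK, C, hC, hpat⟩ := S.exists_pattern
  obtain ⟨C', hC', hminor⟩ := S.sum_minor_le hκ
  set δ : ℝ := ε * c ^ 2 / (8 * C ^ 2) with hδ
  have hδ0 : 0 < δ := by positivity
  obtain ⟨M₀, hM₀⟩ := exists_forall_le_rpow (4 * C' / δ) (show (0 : ℝ) < 1 / 40 by norm_num)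
  set M : ℕ := max M₀ 2 with hM
  have hM2 : 2 ≤ M := le_max_right _ _
  have hm : 4 * (C' * (M : ℝ) ^ (-(1 / 40) : ℝ)) ≤ δ := by
    have h1 := hM₀ M (le_max_left _ _)
    have hM0 : (0 : ℝ) < M := by positivity
    rw [Real.rpow_neg hM0.le, ← mul_assoc, ← div_eq_mul_inv, div_le_iff₀ (by positivity)]
    rw [div_le_iff₀ hδ0] at h1
    linarith
  obtain ⟨N₁, hN₁⟩ := hminor M (by exact_mod_cast hM2)
  set B : ℝ := (((Icc (-(2 * M : ℤ)) (2 * M) ×ˢ Icc (1 : ℤ) M ×ˢ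
    Icc (-(M * M : ℤ)) (M * M)).card : ℕ) : ℝ) with hB
  have hB0 : 0 ≤ B := Nat.cast_nonneg _
  set G : ℝ := B * (2 * Real.pi * (M * 2)) ^ 2 with hG
  have hG0 : 0 ≤ G := by positivity
  have hq0 : 0 < M.factorial := M.factorial_pos
  have : NeZero M.factorial := ⟨hq0.ne'⟩
  obtain ⟨η, hη, hη0, T, hT, hTη, N₂, hN₂⟩ := hpat M.factorial (min 1 (δ / (G + 1))) (by positivity)
  have hη1 : η ≤ 1 := hη0.trans (min_le_left _ _)
  have hGη : G * η ^ 2 ≤ δ := by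
    have h1 : η * (G + 1) ≤ δ := (le_div_iff₀ (by positivity)).1 (hη0.trans (min_le_right _ _))
    nlinarith
  obtain ⟨N₃, hN₃⟩ := exists_nat_ge (M.factorial / η)
  refine ⟨N₁ + N₂ + N₃ + M, fun N hN E hEN hE => ?_⟩
  have hN0 : 0 < N := by omega
  have hNR : (0 : ℝ) < N := by exact_mod_cast hN0
  obtain ⟨J₁, J₂, p, hgood, hscales, hp, hxy⟩ := hN₂ N (by omega)
  have hLN : 4 * N ≤ K * N := Nat.mul_le_mul_right _ hK
  have hqN : (M.factorial : ℝ) ≤ η * N := by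
    have : (M.factorial : ℝ) / η ≤ N := hN₃.trans (by exact_mod_cast (by omega))
    rw [div_le_iff₀ hη] at this
    linarith
  have hqR : (0 : ℝ) < M.factorial := by exact_mod_cast hq0
  set H : ℕ := ⌈η * N / M.factorial⌉₊ with hH
  have hH0 : 0 < H := Nat.ceil_pos.2 (by positivity)
  have hH1 : η * N ≤ M.factorial * H := by
    have := Nat.le_ceil (η * N / M.factorial)
    rw [div_le_iff₀ hqR] at this
    linarith
  have hH2 : (M.factorial : ℝ) * H < η * N + M.factorial := by
    have := Nat.ceil_lt_add_one (show 0 ≤ η * N / M.factorial by positivity)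
    rw [← hH, ← sub_lt_iff_lt_add, lt_div_iff₀ hqR] at this
    linarith
  rcases E.eq_empty_or_nonempty with rfl | hEne
  · simp; positivity
  have hadm : ∀ ω ∈ S.triples J₁ J₂ (range T ×ˢ words M.factorial),
      ∃ n, n ≠ 0 ∧ ω.1 * p ω.2.1 * ω.2.2.transpose ∈ gens ^ n := by
    intro ω hω
    simp only [Blocks.triples, mem_product] at hω
    obtain ⟨k, hk, hk'⟩ := (hp ω.2.1 (mem_product.2 hω.2.1)).2
    refine ⟨2 * S.len 0 J₁ + 2 * k + 2 * S.len 0 J₂, by omega, ?_⟩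
    rw [pow_add, pow_add]
    exact mul_mem_mul (mul_mem_mul (S.U_subset _ _ hω.1) hk')
      (transpose_mem_pow (S.U_subset _ _ hω.2.2))
  have hsq := sq_card_le (Ω := S.triples J₁ J₂ (range T ×ˢ words M.factorial))
    (d := fun ω => (ω.1 * p ω.2.1 * ω.2.2.transpose) 1 1) (E := E) (L := K * N)
    (q := M.factorial) hH0
    (by
      intro ω hω
      obtain ⟨n, -, h1⟩ := hadm ω hω
      simp only [Blocks.triples, mem_product] at hω
      exact ⟨(adm_of_mem_pow h1).d_pos.le,
        (hxy ω.1 hω.1 ω.2.2 hω.2.2).1 ω.2.1 (mem_product.2 hω.2.1)⟩)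
    (by
      intro e he i hi
      have h1 := (mem_Ico.1 (hEN he)).2
      have h2 : ((i : ℝ) + 1) ≤ H := by exact_mod_cast hi
      have h3 : (M.factorial : ℝ) * (i + 1) ≤ M.factorial * H := by gcongr
      have h4 : (M.factorial : ℝ) * i < N := by nlinarith
      have h5 : M.factorial * i < N := by exact_mod_cast h4
      omega)
    (by
      intro ω hω e he h1
      obtain ⟨n, hn, h2⟩ := hadm ω hω
      exact (hE e he).1 (denoms_of_mem_pow hn h2 h1))
  simp only [Blocks.sum_triples] at hsq
  have hW := Blocks.vol_mul_card_le (S := S) (N := N) (J₁ := J₁) (J₂ := J₂) (H := H) (E := E)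
    (fun e he => ⟨by have := mem_Ico.1 (hEN he); omega, (hE e he).2⟩)
    (fun h hh => (hp h hh).1) hH1
    (fun x hx y hy g hg e he => (hxy x hx y hy).2 g hg e (mem_Ico.1 (hEN he)).1
      (mem_Ico.1 (hEN he)).2)
  have hθ : (M.factorial : ℝ) * H / (K * N : ℕ) ≤ 2 * η := by
    have h1 : (N : ℝ) ≤ (K * N : ℕ) := by exact_mod_cast (by omega)
    rw [div_le_iff₀ (hNR.trans_le h1)]
    nlinarith
  have hX := Blocks.sum_expSum_le hH0 (by omega)
    ((Nat.cast_le (α := ℝ)).2 (card_major_le (L := K * N) (M := M) (by omega))) hθ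
    (hN₁ J₁ J₂ (K * N) _ p (by omega) hgood hscales)
  have hδ2 : B * (2 * Real.pi * (M * (2 * η))) ^ 2 + 4 * (C' * (M : ℝ) ^ (-(1 / 40) : ℝ)) ≤
      2 * δ := by
    have : B * (2 * Real.pi * (M * (2 * η))) ^ 2 = G * η ^ 2 := by rw [hG]; ring
    rw [this]
    linarith
  have hX2 := hX.trans (mul_le_mul_of_nonneg_right hδ2 (sq_nonneg _))
  have hV : 0 < S.vol J₁ J₂ (range T ×ˢ words M.factorial) := by
    have h1 : (range T ×ˢ words M.factorial).Nonempty :=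
      ⟨(0, 1), mem_product.2 ⟨mem_range.2 hT, one_mem_words⟩⟩
    exact Nat.mul_pos (Nat.mul_pos (S.U_nonempty _ _).card_pos h1.card_pos)
      (S.U_nonempty _ _).card_pos
  have hfin := card_bound_of_sq_bound (by exact_mod_cast hV) (by exact_mod_cast hEne.card_pos) hc hW
    hsq hX2 (by linarith) hTη (Nat.cast_nonneg _) (Nat.cast_nonneg _) (Nat.cast_nonneg _) hNR
    (by exact_mod_cast (by omega)) (by positivity)
  have h8 : 4 * C ^ 2 * (2 * δ) * N = ε * N * c ^ 2 := by
    rw [hδ]; field_simp; ring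
  rw [h8] at hfin
  exact le_of_mul_le_mul_right hfin (by positivity)

lemma exp_neg_two_mul_le {x : ℝ} (h0 : 0 ≤ x) (h1 : x ≤ 1 / 2) : Real.exp (-(2 * x)) ≤ 1 - x := by
  rw [Real.exp_neg]
  have h2 := Real.add_one_le_exp (2 * x)
  refine inv_le_of_inv_le₀ (by linarith) ?_
  refine le_trans ?_ h2
  rw [inv_le_iff_one_le_mul₀ (by linarith)]
  nlinarith

open Finset in
lemma exp_mul_le_totient (e : ℕ) :
    Real.exp (-(2 * ∑ p ∈ e.primeFactors, (p : ℝ)⁻¹)) * e ≤ e.totient := by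
  have h : (e.totient : ℝ) = e * ∏ p ∈ e.primeFactors, (1 - (p : ℝ)⁻¹) := by
    have := Nat.totient_eq_mul_prod_factors e
    have h2 : ((e.totient : ℚ) : ℝ) = ((e * ∏ p ∈ e.primeFactors, (1 - (p : ℚ)⁻¹) : ℚ) : ℝ) := by
      rw [this]
    push_cast at h2
    exact h2
  rw [h, mul_comm, mul_sum, ← sum_neg_distrib, Real.exp_sum]
  refine mul_le_mul_of_nonneg_left (prod_le_prod (fun _ _ => (Real.exp_pos _).le) fun p hp => ?_)
    (Nat.cast_nonneg _)
  have hp2 : (2 : ℝ) ≤ p := by exact_mod_cast (Nat.prime_of_mem_primeFactors hp).two_le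
  refine exp_neg_two_mul_le (by positivity) ?_
  rw [inv_le_comm₀ (by positivity) (by norm_num)]
  norm_num
  exact_mod_cast hp2

open Finset in
lemma sum_sum_inv_primeFactors_le (N : ℕ) :
    ∑ e ∈ Ioc 0 N, ∑ p ∈ e.primeFactors, (p : ℝ)⁻¹ ≤ (∑' n : ℕ, 1 / (n : ℝ) ^ 2) * N := by
  have hs : Summable fun n : ℕ => 1 / (n : ℝ) ^ 2 := Real.summable_one_div_nat_pow.2 (by norm_num)
  calc ∑ e ∈ Ioc 0 N, ∑ p ∈ e.primeFactors, (p : ℝ)⁻¹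
      ≤ ∑ e ∈ Ioc 0 N, ∑ p ∈ Ioc 0 N with p ∣ e, (p : ℝ)⁻¹ := by
        refine sum_le_sum fun e he => sum_le_sum_of_subset_of_nonneg ?_ fun _ _ _ => by positivity
        intro p hp
        have he := mem_Ioc.1 he
        have h1 := Nat.dvd_of_mem_primeFactors hp
        exact mem_filter.2 ⟨mem_Ioc.2 ⟨Nat.pos_of_mem_primeFactors hp,
          (Nat.le_of_dvd he.1 h1).trans he.2⟩, h1⟩
    _ = ∑ p ∈ Ioc 0 N, ∑ e ∈ Ioc 0 N with p ∣ e, (p : ℝ)⁻¹ := by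
        simp only [sum_filter]
        rw [sum_comm]
    _ ≤ ∑ p ∈ Ioc 0 N, 1 / (p : ℝ) ^ 2 * N := by
        refine sum_le_sum fun p hp => ?_
        rw [sum_const, Nat.Ioc_filter_dvd_card_eq_div, nsmul_eq_mul]
        have hp0 : (0 : ℝ) < p := by exact_mod_cast (mem_Ioc.1 hp).1
        calc ((N / p : ℕ) : ℝ) * (p : ℝ)⁻¹ ≤ (N / p : ℝ) * (p : ℝ)⁻¹ := by
              gcongr; exact Nat.cast_div_le
          _ = _ := by field_simp
    _ = (∑ p ∈ Ioc 0 N, 1 / (p : ℝ) ^ 2) * N := by rw [sum_mul]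
    _ ≤ _ := by
        gcongr
        exact hs.sum_le_tsum _ fun _ _ => by positivity

open Finset in
/-- The ratio `φ(e) / e` is rarely small. -/
lemma card_totient_lt_le {ε : ℝ} (hε : 0 < ε) : ∃ c : ℝ, 0 < c ∧ ∀ N : ℕ,
    (((Ioc 0 N).filter fun e : ℕ => (e.totient : ℝ) < c * e).card : ℝ) ≤ ε * N := by
  set B : ℝ := ∑' n : ℕ, 1 / (n : ℝ) ^ 2 with hB
  have hB0 : 0 ≤ B := tsum_nonneg fun _ => by positivity
  set R : ℝ := B / ε + 1 with hR
  have hR0 : 0 < R := by positivity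
  refine ⟨Real.exp (-(2 * R)), Real.exp_pos _, fun N => ?_⟩
  have h1 : (((Ioc 0 N).filter fun e : ℕ => (e.totient : ℝ) < Real.exp (-(2 * R)) * e).card : ℝ) * R
      ≤ B * N := by
    refine le_trans ?_ (sum_sum_inv_primeFactors_le N)
    rw [← nsmul_eq_mul]
    refine (card_nsmul_le_sum _ (fun e : ℕ => ∑ p ∈ e.primeFactors, (p : ℝ)⁻¹) _ fun e he => ?_).trans
      (sum_le_sum_of_subset_of_nonneg (filter_subset _ _) fun _ _ _ => by positivity)
    obtain ⟨he, he'⟩ := mem_filter.1 he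
    have he0 : (0 : ℝ) < e := by exact_mod_cast (mem_Ioc.1 he).1
    have h2 := lt_of_mul_lt_mul_right ((exp_mul_le_totient e).trans_lt he') he0.le
    rw [Real.exp_lt_exp] at h2
    linarith
  have h3 : B ≤ ε * R := by rw [hR]; field_simp; linarith
  refine le_of_mul_le_mul_right (h1.trans ?_) hR0
  nlinarith [(Nat.cast_nonneg N : (0 : ℝ) ≤ N)]

open Finset Classical in
lemma card_Ico_not_mem_denoms_le {ε : ℝ} (hε : 0 < ε) : ∃ N₀ : ℕ, ∀ N ≥ N₀,
    (((Ico N (2 * N)).filter fun e => e ∉ Denoms {1, 2, 3, 4, 5}).card : ℝ) ≤ ε * N := by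
  obtain ⟨c, hc, hrare⟩ := card_totient_lt_le (show 0 < ε / 4 by positivity)
  obtain ⟨N₀, hN₀⟩ := card_not_mem_denoms_le hc (show 0 < ε / 2 by positivity)
  refine ⟨N₀ + 1, fun N hN => ?_⟩
  set F := (Ico N (2 * N)).filter fun e => e ∉ Denoms {1, 2, 3, 4, 5} with hF
  have h1 := hN₀ N (by omega) (F.filter fun e : ℕ => ¬ (e.totient : ℝ) < c * e)
    ((filter_subset _ _).trans (filter_subset _ _)) (by
      intro e he
      obtain ⟨h1, h2⟩ := mem_filter.1 he
      exact ⟨(mem_filter.1 h1).2, not_lt.1 h2⟩)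
  have h2 : ((F.filter fun e : ℕ => (e.totient : ℝ) < c * e).card : ℝ) ≤
      ((Ioc 0 (2 * N)).filter fun e : ℕ => (e.totient : ℝ) < c * e).card := by
    refine Nat.cast_le.2 (card_le_card (filter_subset_filter _ fun e he => ?_))
    have := mem_Ico.1 (mem_filter.1 he).1
    exact mem_Ioc.2 ⟨by omega, by omega⟩
  have h3 := hrare (2 * N)
  have h4 := card_filter_add_card_filter_not (s := F) (fun e : ℕ => (e.totient : ℝ) < c * e)
  rw [← h4]
  push_cast at h3 ⊢
  linarith

open Finset in
lemma card_range_filter_le {P : ℕ → Prop} [DecidablePred P] {ε : ℝ} {N₀ : ℕ} (hε : 0 ≤ ε)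
    (h : ∀ N ≥ N₀, (((Ico N (2 * N)).filter P).card : ℝ) ≤ ε * N) (n : ℕ) :
    (((range n).filter P).card : ℝ) ≤ 3 * ε * n + (2 * N₀ + 2) := by
  induction n using Nat.strong_induction_on with
  | _ n ih =>
    rcases le_or_gt n (2 * N₀ + 2) with hn | hn
    · have h1 : (((range n).filter P).card : ℝ) ≤ 2 * N₀ + 2 := by
        have := (card_filter_le (range n) P).trans ((card_range n).le.trans hn)
        exact_mod_cast this
      have : 0 ≤ 3 * ε * n := by positivity
      linarith
    · set m := (n + 1) / 2 with hm
      have h1 := ih m (by omega)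
      have h2 := h m (by omega)
      have h3 : ((range n).filter P).card ≤
          ((range m).filter P).card + ((Ico m (2 * m)).filter P).card := by
        refine le_trans (card_le_card ?_) (card_union_le _ _)
        intro e he
        simp only [mem_union, mem_filter, mem_range, mem_Ico] at he ⊢
        rcases lt_or_ge e m with h | h
        · exact Or.inl ⟨h, he.2⟩
        · exact Or.inr ⟨⟨h, by omega⟩, he.2⟩
      have h4 : (((range n).filter P).card : ℝ) ≤
          ((range m).filter P).card + ((Ico m (2 * m)).filter P).card := by exact_mod_cast h3
      have h5 : (4 : ℝ) * m ≤ 3 * n := by exact_mod_cast (by omega)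
      nlinarith

lemma tendsto_sub_one_div {f : ℕ → ℕ} (h : ∀ ε : ℝ, 0 < ε → ∃ K : ℝ, ∀ n, (f n : ℝ) ≤ ε * n + K) :
    Filter.Tendsto (fun N : ℕ => ((f (N + 1) : ℝ) - 1) / N) Filter.atTop (nhds 0) := by
  rw [Metric.tendsto_atTop]
  intro ε hε
  obtain ⟨K, hK⟩ := h (ε / 4) (by positivity)
  obtain ⟨N₁, hN₁⟩ := exists_nat_ge ((|K| + 1) * (4 / ε))
  refine ⟨N₁ + 1, fun N hN => ?_⟩
  have hN0 : (1 : ℝ) ≤ N := by exact_mod_cast (by omega)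
  have h1 := hK (N + 1)
  have h2 : (|K| + 1) * 4 ≤ ε * N := by
    have h3 : (|K| + 1) * (4 / ε) ≤ N := hN₁.trans (by exact_mod_cast (by omega))
    rw [← mul_div_assoc, div_le_iff₀ hε] at h3
    linarith
  have h4 : (0 : ℝ) ≤ f (N + 1) := Nat.cast_nonneg _
  have h5 : ε ≤ ε * N := le_mul_of_one_le_right hε.le hN0
  have h6 := le_abs_self K
  have h7 := abs_nonneg K
  push_cast at h1
  rw [dist_zero_right, Real.norm_eq_abs, abs_div, abs_of_pos (show (0 : ℝ) < N by linarith),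
    div_lt_iff₀ (by linarith), abs_lt]
  constructor <;> linarith

theorem denominators_density_one :
    Filter.Tendsto
      (fun N : ℕ =>
        (Nat.card {d : ℕ | d ∈ Denoms {1, 2, 3, 4, 5} ∧ d ≤ N} : ℝ) / (N : ℝ))
      Filter.atTop (nhds 1) := by
  classical
  set f : ℕ → ℕ := fun n => ((Finset.range n).filter fun e => e ∉ Denoms {1, 2, 3, 4, 5}).card
    with hf
  have hcard (N : ℕ) : (Nat.card {d : ℕ | d ∈ Denoms {1, 2, 3, 4, 5} ∧ d ≤ N} : ℝ) =
      N + 1 - f (N + 1) := by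
    have h1 : {d : ℕ | d ∈ Denoms {1, 2, 3, 4, 5} ∧ d ≤ N} =
        ((Finset.range (N + 1)).filter fun e => e ∈ Denoms {1, 2, 3, 4, 5} : Finset ℕ) := by
      ext d
      simp [and_comm]
    have h2 := Finset.card_filter_add_card_filter_not (s := Finset.range (N + 1))
      (fun e => e ∈ Denoms {1, 2, 3, 4, 5})
    rw [Finset.card_range] at h2
    rw [Nat.card_coe_set_eq, h1, Set.ncard_coe_finset, eq_sub_iff_add_eq]
    exact_mod_cast h2
  have hlim : Filter.Tendsto (fun N : ℕ => ((f (N + 1) : ℝ) - 1) / N) Filter.atTop (nhds 0) := by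
    refine tendsto_sub_one_div fun ε hε => ?_
    obtain ⟨N₀, hN₀⟩ := card_Ico_not_mem_denoms_le (show 0 < ε / 3 by positivity)
    refine ⟨2 * N₀ + 2, fun n => (card_range_filter_le (by positivity) hN₀ n).trans_eq ?_⟩
    rw [mul_div_cancel₀ _ (by norm_num : (3 : ℝ) ≠ 0)]
  have h := (tendsto_const_nhds (x := (1 : ℝ))).sub hlim
  rw [sub_zero] at h
  refine h.congr' ?_
  filter_upwards [Filter.eventually_gt_atTop 0] with N hN
  have : (N : ℝ) ≠ 0 := by exact_mod_cast hN.ne'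
  rw [hcard]
  field_simp
  ring
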